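/- Fix an integer g ≥ 1. For each n ≥ 2, let μₙ⁰ denote the uniform probability distribution on the set 𝔽ₙ⁰ of minimal factorizations and μₙ^{g} the uniform distribution on 𝔽ₙᵍ (viewed as a distribution on 𝔽ₙᵍ ∪ {†}). Let Λᵍ(μₙ⁰) denote the distribution obtained by applying, successively and independently, the randomized maps Λ with target genus 1, 2, …, g to a uniform element of 𝔽ₙ⁰ (with the convention Λ(†) = †). Then d_TV(Λᵍ(μₙ⁰), μₙ^{g}) tends to 0 as n → ∞. -/

import Mathlib

/-- Left-to-right product of a list of permutations: the leftmost entry is applied first. -/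
def prodLR {n : ℕ} (l : List (Equiv.Perm (Fin n))) : Equiv.Perm (Fin n) :=
  l.reverse.prod

/-- The set `𝔽ₙᵍ` of genus-`g` factorizations of the `n`-cycle `(1 2 ⋯ n)`
into transpositions. -/
def Fcal (n g : ℕ) : Set (List (Equiv.Perm (Fin n))) :=
  {l | l.length = n - 1 + 2 * g ∧ (∀ t ∈ l, t.IsSwap) ∧ prodLR l = finRotate n}

/-- A permutation of `{1,…,n}` is a long cycle (a single cycle of length `n`)
iff it acts as a cycle on the whole set. -/
def IsLongCycle {n : ℕ} (π : Equiv.Perm (Fin n)) : Prop :=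
  π.IsCycleOn (Set.univ : Set (Fin n))

/-- The random choices of one step of the algorithm: a pair of (0-indexed) insertion
positions `(v, w)` and a triple `(a, b, c)` of elements of `{1,…,n}`. -/
abbrev Param (n : ℕ) := (ℕ × ℕ) × (Fin n × Fin n × Fin n)

/-- Validity of a choice of parameters for the step targeting genus `i`:
`v < w` are positions in `{0,…,n-2+2i}` (i.e. a 2-element subset of the
`n-1+2i` possible positions) and `a < b < c` in `Fin n`. -/
def paramOK (n i : ℕ) (p : Param n) : Prop :=
  p.1.1 < p.1.2 ∧ p.1.2 < n - 1 + 2 * i ∧ p.2.1 < p.2.2.1 ∧ p.2.2.1 < p.2.2.2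

open scoped Classical in
/-- The deterministic part of one step of the algorithm `Λ`: given the input
factorization `F` and the random choices `p = ((v,w),(a,b,c))`, insert the two
transpositions `(a c)`, `(a b)` (or `(a b)`, `(a c)`) at positions `v` and `w`;
if one of the two resulting products is a long cycle `ζ`, conjugate every entry by
the unique `σ` fixing `1` with `σ ζ σ⁻¹ = (1 2 ⋯ n)`; otherwise fail (`none = †`). -/
noncomputable def lamDet (n : ℕ) (F : List (Equiv.Perm (Fin n))) (p : Param n) :
    Option (List (Equiv.Perm (Fin n))) :=
  let v := p.1.1
  let w := p.1.2
  let a := p.2.1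
  let b := p.2.2.1
  let c := p.2.2.2
  let L1 := (F.insertIdx v (Equiv.swap a c)).insertIdx w (Equiv.swap a b)
  let L2 := (F.insertIdx v (Equiv.swap a b)).insertIdx w (Equiv.swap a c)
  let Lsel : Option (List (Equiv.Perm (Fin n))) :=
    if IsLongCycle (prodLR L1) then some L1
    else if IsLongCycle (prodLR L2) then some L2
    else none
  Lsel.bind fun L =>
    if h : ∃! σ : Equiv.Perm (Fin n),
        (∀ h0 : 0 < n, σ ⟨0, h0⟩ = ⟨0, h0⟩) ∧ σ * prodLR L * σ⁻¹ = finRotate n then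
      some (L.map fun t => h.choose * t * h.choose⁻¹)
    else none

/-- Successive application of the steps of the algorithm, with the convention
`Λ(†) = †`: the parameters in the list are used in order. -/
noncomputable def lamIter (n : ℕ) :
    List (Param n) → Option (List (Equiv.Perm (Fin n))) →
      Option (List (Equiv.Perm (Fin n)))
  | [], x => x
  | p :: ps, x => lamIter n ps (x.bind fun F => lamDet n F p)

/-- Validity of a list of parameters for `g` successive steps: the `i`-th step
(`i = 0, …, g-1`) targets genus `i+1`. -/
def paramsOK (n g : ℕ) (ps : List (Param n)) : Prop :=
  ps.length = g ∧ ∀ i : Fin ps.length, paramOK n ((i : ℕ) + 1) (ps.get i)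

/-- The output distribution on `𝔽ₙᵍ ∪ {†}` of the `g`-fold iteration `Λᵍ` applied to
a uniform element of `𝔽ₙ⁰`, all random choices being uniform and independent. -/
noncomputable def lamIterDist (n g : ℕ) : Option (List (Equiv.Perm (Fin n))) → ℝ :=
  fun x =>
    (Set.ncard {q : List (Equiv.Perm (Fin n)) × List (Param n) |
        q.1 ∈ Fcal n 0 ∧ paramsOK n g q.2 ∧ lamIter n q.2 (some q.1) = x} : ℝ) /
      ((Set.ncard (Fcal n 0) : ℝ) *
        (Set.ncard {ps : List (Param n) | paramsOK n g ps} : ℝ))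

/-- The uniform distribution on `𝔽ₙᵍ`, viewed as a distribution on `𝔽ₙᵍ ∪ {†}`. -/
noncomputable def unifF (n g : ℕ) : Option (List (Equiv.Perm (Fin n))) → ℝ :=
  fun x =>
    match x with
    | none => 0
    | some l => Set.indicator (Fcal n g) (fun _ => 1 / (Set.ncard (Fcal n g) : ℝ)) l

/-- Total variation distance between two probability mass functions. -/
noncomputable def dTV {X : Type*} (μ ν : X → ℝ) : ℝ :=
  (1 / 2) * ∑' x, |μ x - ν x|

section
open Polynomial Matrix

lemma det_add_vmv_field {K : Type*} [Field K] {α : Type*} [Fintype α] [DecidableEq α]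
    (M : Matrix α α K) (u w : α → K) (h : M.det ≠ 0) :
    (M + vecMulVec u w).det = M.det + w ⬝ᵥ (M.adjugate *ᵥ u) := by
  have h1 := det_add_replicateCol_mul_replicateRow (ι := Unit) (A := M) (isUnit_iff_ne_zero.2 h) u w
  have h2 : replicateCol Unit u * replicateRow Unit w = vecMulVec u w := by
    rw [vecMulVec_eq Unit]
  rw [h2] at h1
  rw [h1, Matrix.inv_def, det_unique (1 + replicateRow Unit w * _ * replicateCol Unit u)]
  simp only [Matrix.add_apply, Matrix.one_apply_eq, Matrix.mul_smul, Matrix.smul_mul,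
    Matrix.smul_apply, smul_eq_mul]
  rw [Ring.inverse_eq_inv', mul_add, mul_one, ← mul_assoc, mul_inv_cancel₀ h, one_mul]
  congr 1
  rw [Matrix.mul_assoc]
  rfl

lemma det_add_vmv {R : Type*} [CommRing R] [IsDomain R] {α : Type*} [Fintype α] [DecidableEq α]
    (M : Matrix α α R) (u w : α → R) (h : M.det ≠ 0) :
    (M + vecMulVec u w).det = M.det + w ⬝ᵥ (M.adjugate *ᵥ u) := by
  let f := algebraMap R (FractionRing R)
  have hf : Function.Injective f := IsFractionRing.injective R (FractionRing R)
  apply hf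
  have h1 : (f.mapMatrix M).det ≠ 0 := by
    rw [← RingHom.map_det]; intro h0; exact h (hf (by simpa using h0))
  have h2 := det_add_vmv_field (f.mapMatrix M) (f ∘ u) (f ∘ w) h1
  rw [map_add, RingHom.map_det, RingHom.map_det, RingHom.map_dotProduct]
  rw [map_add]
  have e1 : f.mapMatrix (vecMulVec u w) = vecMulVec (f ∘ u) (f ∘ w) := by
    ext i j; simp [vecMulVec_apply]
  have e2 : (⇑f ∘ (M.adjugate *ᵥ u)) = (f.mapMatrix M).adjugate *ᵥ (f ∘ u) := by
    rw [← RingHom.map_adjugate]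
    ext i; simp [mulVec, RingHom.map_dotProduct]; rfl
  rw [e1, e2, h2]

lemma derivative_det_jacobi {α : Type*} [Fintype α] [DecidableEq α] (M : Matrix α α ℝ[X]) :
    derivative M.det = (M.adjugate * M.map derivative).trace := by
  have h1 : derivative M.det = ∑ i, (M.updateCol i (fun r => derivative (M r i))).det := by
    rw [det_apply', derivative_sum]
    simp_rw [det_apply']
    rw [Finset.sum_comm]
    refine Finset.sum_congr rfl fun σ _ => ?_
    rw [derivative_intCast_mul, derivative_prod_finset, Finset.mul_sum]
    refine Finset.sum_congr rfl fun i _ => ?_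
    congr 1
    rw [← Finset.mul_prod_erase Finset.univ (fun x => (M.updateCol i fun r => derivative (M r i)) (σ x) x) (Finset.mem_univ i), mul_comm]
    simp only [updateCol_self]
    congr 1
    refine Finset.prod_congr rfl fun x hx => ?_
    rw [updateCol_ne (Finset.ne_of_mem_erase hx)]
  rw [h1, trace]
  refine Finset.sum_congr rfl fun i _ => ?_
  rw [← cramer_apply, cramer_eq_adjugate_mulVec]
  rfl

/-- the matrix `1 - X P` -/
noncomputable def Mx {α : Type*} [DecidableEq α] (π : Equiv.Perm α) : Matrix α α ℝ[X] :=
  Matrix.of fun i j => (if i = j then 1 else 0) - (if i = π j then X else 0)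

noncomputable def Ex {α : Type*} [Fintype α] [DecidableEq α] (π : Equiv.Perm α) : ℝ[X] := (Mx π).det

lemma Ex_ne_zero {α : Type*} [Fintype α] [DecidableEq α] (π : Equiv.Perm α) : Ex π ≠ 0 := by
  intro h
  have : (Ex π).eval 0 = 1 := by
    rw [Ex, ← coe_evalRingHom, RingHom.map_det]
    have : (evalRingHom 0).mapMatrix (Mx π) = 1 := by
      ext i j
      simp [Mx, Matrix.one_apply]
      split_ifs <;> simp
    rw [this, det_one]
  rw [h] at this; simp at this

lemma Ex_swap {α : Type*} [Fintype α] [DecidableEq α] (π : Equiv.Perm α) (i j : α) (hij : i ≠ j) :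
    Ex (Equiv.swap i j * π) = Ex π +
      X * ((Mx π).adjugate (π.symm i) i + (Mx π).adjugate (π.symm j) j
        - (Mx π).adjugate (π.symm i) j - (Mx π).adjugate (π.symm j) i) := by
  have h : Mx (Equiv.swap i j * π) = Mx π + vecMulVec (Pi.single i 1 - Pi.single j 1 : α → ℝ[X])
      ((X : ℝ[X]) • (Pi.single (π.symm i) 1 - Pi.single (π.symm j) 1 : α → ℝ[X])) := by
    ext1 r k
    simp only [Mx, Matrix.of_apply, Matrix.add_apply, vecMulVec_apply, Pi.sub_apply, Pi.smul_apply, smul_eq_mul,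
      Equiv.Perm.mul_apply, Pi.single_apply, Equiv.swap_apply_def, Equiv.eq_symm_apply]
    by_cases h1 : π k = i
    · subst h1
      by_cases h2 : r = π k
      · subst h2; simp [hij]
      · by_cases h3 : r = j
        · subst h3; simp [h2, hij, sub_eq_add_neg]
        · simp [h2, h3, hij]
    · by_cases h2 : π k = j
      · subst h2
        by_cases h3 : r = π k
        · subst h3; simp [hij, hij.symm]
        · by_cases h4 : r = i
          · subst h4; simp [h3, h1, sub_eq_add_neg]
          · simp [h3, h4, h1]
      · simp [h1, h2]
  unfold Ex
  rw [h, det_add_vmv _ _ _ (Ex_ne_zero π)]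
  congr 1
  rw [smul_dotProduct, smul_eq_mul]
  congr 1
  rw [mulVec_sub, sub_dotProduct, dotProduct_sub, dotProduct_sub]
  simp
  ring

end

section
open Polynomial Matrix

open scoped Classical in
noncomputable def swaps (α : Type*) [Fintype α] [DecidableEq α] : Finset (Equiv.Perm α) :=
  Finset.univ.filter fun t => t.IsSwap

lemma mem_swaps {α : Type*} [Fintype α] [DecidableEq α] {t : Equiv.Perm α} :
    t ∈ swaps α ↔ t.IsSwap := by simp [swaps]

lemma sum_swaps {α : Type*} [Fintype α] [DecidableEq α] {R : Type*} [CommRing R]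
    (f : Equiv.Perm α → R) :
    ∑ p ∈ (Finset.univ : Finset α).offDiag, f (Equiv.swap p.1 p.2) = 2 * ∑ t ∈ swaps α, f t := by
  rw [← Finset.sum_fiberwise_of_maps_to (t := swaps α)
    (g := fun p : α × α => Equiv.swap p.1 p.2)]
  · rw [Finset.mul_sum]
    refine Finset.sum_congr rfl fun t ht => ?_
    obtain ⟨a, b, hab, rfl⟩ := mem_swaps.1 ht
    have : ((Finset.univ : Finset α).offDiag.filter fun p => Equiv.swap p.1 p.2 = Equiv.swap a b)
        = {(a, b), (b, a)} := by
      ext ⟨x, y⟩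
      simp only [Finset.mem_filter, Finset.mem_offDiag, Finset.mem_univ, true_and,
        Finset.mem_insert, Finset.mem_singleton, Prod.mk.injEq]
      constructor
      · rintro ⟨hxy, h⟩
        have h1 := congrArg (fun e => e a) h
        have h2 := congrArg (fun e => e b) h
        simp only [Equiv.swap_apply_left, Equiv.swap_apply_right, Equiv.swap_apply_def] at h1 h2
        clear h ht
        grind
      · rintro (⟨rfl, rfl⟩ | ⟨rfl, rfl⟩)
        · exact ⟨hab, rfl⟩
        · exact ⟨hab.symm, Equiv.swap_comm _ _⟩
    rw [this, Finset.sum_pair (by simp [hab]), Equiv.swap_comm b a]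
    ring
  · rintro ⟨a, b⟩ h
    exact mem_swaps.2 ⟨a, b, by simpa using h, rfl⟩

lemma deriv_Ex {α : Type*} [Fintype α] [DecidableEq α] (π : Equiv.Perm α) :
    derivative (Ex π) = - ∑ i, (Mx π).adjugate (π.symm i) i := by
  rw [Ex, derivative_det_jacobi, trace]
  rw [← Finset.sum_neg_distrib,
    ← Equiv.sum_comp π (fun i => - (Mx π).adjugate (π.symm i) i)]
  refine Finset.sum_congr rfl fun j _ => ?_
  rw [diag_apply, Matrix.mul_apply, Finset.sum_eq_single (π j)]
  · simp [Mx]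
    split_ifs <;> simp
  · intro b _ hb
    simp [Mx, hb]
    split_ifs <;> simp
  · simp

lemma sum_adj {α : Type*} [Fintype α] [DecidableEq α] (π : Equiv.Perm α) :
    (1 - X) * ∑ i, ∑ j, (Mx π).adjugate (π.symm i) j = (Fintype.card α : ℝ[X]) * Ex π := by
  have e0 : ∑ i, ∑ j, (Mx π).adjugate (π.symm i) j = ∑ j, ∑ i, (Mx π).adjugate i j := by
    rw [Finset.sum_comm]
    refine Finset.sum_congr rfl fun j _ => ?_
    exact Equiv.sum_comp π.symm (fun i => (Mx π).adjugate i j)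
  rw [e0, Finset.mul_sum]
  have : ∀ j, (1 - X) * ∑ i, (Mx π).adjugate i j = Ex π := by
    intro j
    have h := mul_adjugate (Mx π)
    have h2 : ∑ i, (Mx π * (Mx π).adjugate) i j = Ex π := by
      rw [h]; simp [Matrix.one_apply, Ex]
    rw [← h2]
    simp only [Matrix.mul_apply]
    rw [Finset.sum_comm, Finset.mul_sum]
    refine Finset.sum_congr rfl fun k _ => ?_
    rw [← Finset.sum_mul]
    congr 1
    simp [Mx]
  simp [this]

lemma sum_swap_Ex {α : Type*} [Fintype α] [DecidableEq α] (π : Equiv.Perm α) :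
    2 * ((1 - X) * ∑ t ∈ swaps α, Ex (t * π)) =
      (1 - X) * ((Fintype.card α : ℝ[X]) * ((Fintype.card α : ℝ[X]) - 1) * Ex π
        - 2 * (Fintype.card α : ℝ[X]) * X * derivative (Ex π))
      - 2 * (Fintype.card α : ℝ[X]) * X * Ex π := by
  have h0 := sum_swaps (α := α) (fun t => Ex (t * π))
  have h1 : ∑ p ∈ (Finset.univ : Finset α).offDiag, Ex (Equiv.swap p.1 p.2 * π)
     = ∑ p ∈ (Finset.univ : Finset α).offDiag, Ex π +
       ∑ i, ∑ j, X * ((Mx π).adjugate (π.symm i) i + (Mx π).adjugate (π.symm j) j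
        - (Mx π).adjugate (π.symm i) j - (Mx π).adjugate (π.symm j) i) := by
    rw [← Finset.sum_product', ← Finset.diag_union_offDiag, Finset.sum_union (Finset.disjoint_diag_offDiag _)]
    rw [Finset.sum_eq_zero (s := Finset.diag _), zero_add, ← Finset.sum_add_distrib]
    · refine Finset.sum_congr rfl ?_
      rintro ⟨i, j⟩ h
      exact Ex_swap π i j (by simpa using h)
    · rintro ⟨i, j⟩ h
      simp at h; subst h; ring
  have h2 : ∑ i, ∑ j, X * ((Mx π).adjugate (π.symm i) i + (Mx π).adjugate (π.symm j) j
        - (Mx π).adjugate (π.symm i) j - (Mx π).adjugate (π.symm j) i)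
      = X * (2 * (Fintype.card α : ℝ[X]) * ∑ i, (Mx π).adjugate (π.symm i) i
        - 2 * ∑ i, ∑ j, (Mx π).adjugate (π.symm i) j) := by
    simp_rw [← Finset.mul_sum, Finset.sum_sub_distrib, Finset.sum_add_distrib]
    rw [Finset.sum_comm (f := fun i j => (Mx π).adjugate (π.symm j) i)]
    simp only [Finset.sum_const, Finset.card_univ, nsmul_eq_mul, ← Finset.mul_sum]
    ring
  have h3 := sum_adj π
  have h4 := deriv_Ex π
  have h5 : ∑ i, (Mx π).adjugate (π.symm i) i = - derivative (Ex π) := by rw [h4]; ring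
  rw [h2, h0, h5] at h1
  have h6 : ∑ p ∈ (Finset.univ : Finset α).offDiag, Ex π
      = (Fintype.card α : ℝ[X]) * ((Fintype.card α : ℝ[X]) - 1) * Ex π := by
    rw [Finset.sum_const, Finset.offDiag_card, nsmul_eq_mul, Finset.card_univ,
      Nat.cast_sub (Nat.le_mul_self _)]
    push_cast; ring
  rw [h6] at h1
  linear_combination (1 - X) * h1 - 2 * X * h3

lemma Ex_root {α : Type*} [Fintype α] [DecidableEq α] [Nonempty α] (π : Equiv.Perm α) :
    (Ex π).eval 1 = 0 := by
  have h := congrArg (Polynomial.eval 1) (sum_adj π)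
  simp at h
  exact h

noncomputable def Ph {α : Type*} [Fintype α] [DecidableEq α] (π : Equiv.Perm α) : ℝ[X] :=
  - (Ex π /ₘ (X - C 1))

lemma Ex_eq {α : Type*} [Fintype α] [DecidableEq α] [Nonempty α] (π : Equiv.Perm α) :
    Ex π = (1 - X) * Ph π := by
  have := (mul_divByMonic_eq_iff_isRoot (p := Ex π) (a := 1)).2 (Ex_root π)
  rw [Ph, ← mul_neg_one, ← this]
  rw [this]
  have h2 := this
  simp only [map_one] at *
  linear_combination -h2

lemma one_sub_X_ne : (1 - X : ℝ[X]) ≠ 0 := by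
  intro h
  have := congrArg (Polynomial.eval 0) h
  simp at this

lemma sum_swap_Ph {α : Type*} [Fintype α] [DecidableEq α] [Nonempty α] (π : Equiv.Perm α) :
    ∑ t ∈ swaps α, Ph (t * π) =
      C ((Fintype.card α : ℝ) * ((Fintype.card α : ℝ) - 1) / 2) * Ph π
        - C (Fintype.card α : ℝ) * X * derivative (Ph π) := by
  have h := sum_swap_Ex π
  simp_rw [Ex_eq, ← Finset.mul_sum] at h
  have hd : derivative ((1 - X) * Ph π) = - Ph π + (1 - X) * derivative (Ph π) := by
    simp
  rw [hd] at h
  have h2 : (2 : ℝ[X]) ≠ 0 := two_ne_zero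
  apply mul_left_cancel₀ (mul_ne_zero h2 (mul_ne_zero one_sub_X_ne one_sub_X_ne))
  have e1 : (2 : ℝ[X]) * C ((Fintype.card α : ℝ) * ((Fintype.card α : ℝ) - 1) / 2) =
     (Fintype.card α : ℝ[X]) * ((Fintype.card α : ℝ[X]) - 1) := by
    have : (2 : ℝ[X]) = C 2 := rfl
    rw [this, ← C_mul, mul_div_cancel₀ _ (by norm_num : (2:ℝ) ≠ 0)]
    simp
  have e2 : C (Fintype.card α : ℝ) = (Fintype.card α : ℝ[X]) := by simp
  rw [e2]
  linear_combination h - (1 - X)^2 * Ph π * e1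

lemma Ex_one {α : Type*} [Fintype α] [DecidableEq α] : Ex (1 : Equiv.Perm α) = (1 - X) ^ Fintype.card α := by
  have : Mx (1 : Equiv.Perm α) = Matrix.diagonal fun _ => (1 - X) := by
    ext1 i j
    by_cases h : i = j <;> simp [Mx, Matrix.diagonal_apply, h]
  rw [Ex, this, det_diagonal]; simp

lemma Ph_one {α : Type*} [Fintype α] [DecidableEq α] [Nonempty α] :
    Ph (1 : Equiv.Perm α) = (1 - X) ^ (Fintype.card α - 1) := by
  apply mul_left_cancel₀ one_sub_X_ne
  rw [← Ex_eq, Ex_one, ← pow_succ', Nat.sub_add_cancel Fintype.card_pos]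

end

section
open Polynomial Matrix

lemma Ph_eval_one {α : Type*} [Fintype α] [DecidableEq α] [Nonempty α] (π : Equiv.Perm α) :
    (Ph π).eval 1 = - (derivative (Ex π)).eval 1 := by
  rw [Ex_eq]; simp

lemma IsCycleOn.fixed_all {α : Type*} {π : Equiv.Perm α} (h : π.IsCycleOn (Set.univ : Set α))
    (p : α → Prop) (hp : ∀ x, p x → p (π⁻¹ x)) [Finite α] {x : α} (hx : p x) (y : α) : p y := by
  have hpow : ∀ k : ℕ, p ((π⁻¹ ^ k) x) := by
    intro k
    induction k with
    | zero => simpa using hx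
    | succ k ih => rw [pow_succ', Equiv.Perm.mul_apply]; exact hp _ ih
  obtain ⟨k, hk⟩ := ((h.inv).2 (Set.mem_univ x) (Set.mem_univ y)).exists_nat_pow_eq
  rw [← hk]; exact hpow k

lemma Ex_long {α : Type*} [Fintype α] [DecidableEq α] (hc : 2 ≤ Fintype.card α) (π : Equiv.Perm α)
    (h : π.IsCycleOn (Set.univ : Set α)) : Ex π = 1 - X ^ Fintype.card α := by
  have hnt : Nontrivial α := Fintype.one_lt_card_iff_nontrivial.1 hc
  have hne : ∀ i, π i ≠ i := by
    intro i
    exact (h.apply_ne (Set.nontrivial_univ) (Set.mem_univ i))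
  have hπ1 : (1 : Equiv.Perm α) ≠ π := by
    intro h1
    obtain ⟨i⟩ := hnt.to_nonempty
    exact hne i (by rw [← h1]; rfl)
  have hsign : (Equiv.Perm.sign π : ℤ) = - (-1) ^ Fintype.card α := by
    have hcyc : π.IsCycle := by
      obtain ⟨i⟩ := hnt.to_nonempty
      exact ⟨i, hne i, fun y _ => h.2 (Set.mem_univ i) (Set.mem_univ y)⟩
    rw [hcyc.sign]
    have : π.support = Finset.univ := by ext i; simp [hne]
    rw [this]; simp
  rw [Ex, det_apply', ← Finset.sum_subset (Finset.subset_univ {1, π})]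
  · rw [Finset.sum_pair hπ1]
    have e1 : ∀ i, Mx π ((1 : Equiv.Perm α) i) i = 1 := by
      intro i; simp [Mx, (hne i).symm]
    have e2 : ∀ i, Mx π (π i) i = - X := by
      intro i; simp [Mx, (hne i)]
    simp_rw [e1, e2]
    rw [hsign]
    simp only [Equiv.Perm.sign_one, Finset.prod_const, Finset.card_univ]
    push_cast
    rw [neg_pow (X : ℝ[X]), neg_mul, ← mul_assoc, ← mul_pow]
    simp [sub_eq_add_neg]
  · intro τ _ hτ
    simp only [Finset.mem_insert, Finset.mem_singleton, not_or] at hτ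
    suffices H : ∃ i, τ i ≠ i ∧ τ i ≠ π i by
      obtain ⟨i, h1, h2⟩ := H
      rw [Finset.prod_eq_zero (Finset.mem_univ i), mul_zero]
      simp [Mx, h1, h2]
    by_contra! H
    have hstep : ∀ x, τ x = x → τ (π⁻¹ x) = π⁻¹ x := by
      intro x hx
      by_contra hh
      have h2 := H _ hh
      have : τ (π⁻¹ x) = x := by rw [h2]; simp
      have h3 : π⁻¹ x = x := τ.injective (this.trans hx.symm)
      have h4 := hne (π⁻¹ x)
      simp [h3] at h4
      exact h4 (by conv_lhs => rw [← h3]; simp)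
    by_cases hx : ∃ x, τ x = x
    · obtain ⟨x, hx⟩ := hx
      apply hτ.1
      ext y
      exact IsCycleOn.fixed_all h (fun x => τ x = x) hstep hx y
    · push Not at hx
      apply hτ.2
      ext y; exact H y (hx y)

lemma Ph_long {α : Type*} [Fintype α] [DecidableEq α] (hc : 2 ≤ Fintype.card α) (π : Equiv.Perm α)
    (h : π.IsCycleOn (Set.univ : Set α)) : (Ph π).eval 1 = Fintype.card α := by
  have : Nonempty α := Fintype.card_pos_iff.1 (by omega)
  rw [Ph_eval_one, Ex_long hc π h]; simp [derivative_X_pow]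

lemma Ph_not_long {α : Type*} [Fintype α] [DecidableEq α] [Nonempty α] (π : Equiv.Perm α)
    (h : ¬ π.IsCycleOn (Set.univ : Set α)) : (Ph π).eval 1 = 0 := by
  classical
  have h1 : ∃ x y, ¬ π.SameCycle x y := by
    by_contra! H
    exact h ⟨by simp [Set.bijOn_univ, π.bijective], fun x _ y _ => H x y⟩
  obtain ⟨x, y, hxy⟩ := h1
  have hz : ∀ (p : α → Prop) [Fintype {a // p a}] [DecidableEq {a // p a}], (∀ z, p (π z) ↔ p z) → (∃ z, p z) →
      (toSquareBlockProp (Mx π) p).det.eval 1 = 0 := by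
    intro p _ _ hp ⟨z, hz⟩
    rw [← coe_evalRingHom, RingHom.map_det]
    apply (Matrix.exists_vecMul_eq_zero_iff).1
    refine ⟨fun _ => 1, ?_, ?_⟩
    · intro h0
      have := congrFun h0 ⟨z, hz⟩
      simp at this
    · ext ⟨j, hj⟩
      simp only [vecMul, dotProduct, one_mul, Pi.zero_apply, RingHom.mapMatrix_apply, map_apply,
        toSquareBlockProp_def, Mx, of_apply, eval_sub, coe_evalRingHom]
      rw [Finset.sum_sub_distrib, sub_eq_zero]
      rw [Finset.sum_eq_single (⟨j, hj⟩ : {a // p a}), Finset.sum_eq_single (⟨π j, (hp j).2 hj⟩ : {a // p a})]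
      · simp
      · rintro ⟨b, hb⟩ _ hne
        have : b ≠ π j := fun h => hne (by simp [h])
        simp [this]
      · simp
      · rintro ⟨b, hb⟩ _ hne
        have : b ≠ j := fun h => hne (by simp [h])
        simp [this]
      · simp
  have hp : ∀ z, π.SameCycle x (π z) ↔ π.SameCycle x z := fun z => Equiv.Perm.sameCycle_apply_right
  have hdet := twoBlockTriangular_det (Mx π) (fun z => π.SameCycle x z) (by
    intro i hi j hj
    have e1 : i ≠ j := by rintro rfl; exact hi hj
    have e2 : i ≠ π j := by rintro rfl; exact hi ((hp j).2 hj)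
    simp [Mx, e1, e2])
  rw [Ph_eval_one, Ex, hdet, derivative_mul]
  simp only [eval_add, eval_mul]
  rw [hz (fun z => π.SameCycle x z) hp ⟨x, Equiv.Perm.SameCycle.refl _ _⟩,
    hz (fun z => ¬ π.SameCycle x z) (fun z => not_congr (hp z)) ⟨y, hxy⟩]
  simp

/-- number of `m`-tuples of transpositions with product `π` -/
noncomputable def cnt {α : Type*} [Fintype α] [DecidableEq α] : ℕ → Equiv.Perm α → ℕ
  | 0, π => if π = 1 then 1 else 0
  | m + 1, π => ∑ t ∈ swaps α, cnt m (t * π)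

lemma IsSwap.mul_self_eq {α : Type*} [DecidableEq α] {t : Equiv.Perm α} (h : t.IsSwap) : t * t = 1 := by
  obtain ⟨a, b, _, rfl⟩ := h
  exact Equiv.swap_mul_self a b

lemma IsSwap.conj {α : Type*} [DecidableEq α] {t : Equiv.Perm α} (h : t.IsSwap) (σ : Equiv.Perm α) :
    (σ * t * σ⁻¹).IsSwap := by
  obtain ⟨a, b, hab, rfl⟩ := h
  exact ⟨σ a, σ b, by simpa using hab, by rw [Equiv.mul_swap_eq_swap_mul]; simp⟩

lemma cnt_conj {α : Type*} [Fintype α] [DecidableEq α] (σ : Equiv.Perm α) (m : ℕ) (π : Equiv.Perm α) :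
    cnt m (σ * π * σ⁻¹) = cnt m π := by
  induction m generalizing π with
  | zero => simp [cnt, mul_inv_eq_one]
  | succ m ih =>
    simp only [cnt]
    refine Finset.sum_bij' (fun t _ => σ⁻¹ * t * σ) (fun t _ => σ * t * σ⁻¹) ?_ ?_ ?_ ?_ ?_
    · intro t ht
      have := IsSwap.conj (mem_swaps.1 ht) σ⁻¹
      simpa using mem_swaps.2 this
    · intro t ht
      exact mem_swaps.2 (IsSwap.conj (mem_swaps.1 ht) σ)
    · intro t _; group
    · intro t _; group
    · intro t _
      rw [← ih (σ⁻¹ * t * σ * π)]; congr 1; group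

lemma sum_cnt_succ {α : Type*} [Fintype α] [DecidableEq α] {R : Type*} [CommRing R]
    (m : ℕ) (f : Equiv.Perm α → R) :
    ∑ π, (cnt (m + 1) π : R) * f π = ∑ π, (cnt m π : R) * ∑ t ∈ swaps α, f (t * π) := by
  simp only [cnt, Nat.cast_sum, Finset.sum_mul, Finset.mul_sum]
  rw [Finset.sum_comm, Finset.sum_comm (s := (Finset.univ : Finset (Equiv.Perm α)))]
  refine Finset.sum_congr rfl fun t ht => ?_
  rw [← Equiv.sum_comp (Equiv.mulLeft t)]
  refine Finset.sum_congr rfl fun π _ => ?_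
  simp only [Equiv.coe_mulLeft]
  rw [← mul_assoc, IsSwap.mul_self_eq (mem_swaps.1 ht), one_mul]

lemma sum_cnt_Ph {α : Type*} [Fintype α] [DecidableEq α] [Nonempty α] (m : ℕ) :
    ∑ π : Equiv.Perm α, (cnt m π : ℝ[X]) * Ph π =
      ∑ k ∈ Finset.range (Fintype.card α), C ((-1 : ℝ) ^ k * ((Fintype.card α - 1).choose k : ℝ) *
        ((Fintype.card α : ℝ) * ((Fintype.card α : ℝ) - 1) / 2 - (Fintype.card α : ℝ) * k) ^ m) * X ^ k := by
  induction m with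
  | zero =>
    rw [Finset.sum_eq_single 1]
    · simp only [cnt, if_true, Nat.cast_one, one_mul, Ph_one, pow_zero, mul_one]
      rw [sub_eq_neg_add, add_pow, Nat.sub_add_cancel Fintype.card_pos]
      refine Finset.sum_congr rfl fun k _ => ?_
      rw [neg_pow]; simp; ring
    · intro π _ h; simp [cnt, h]
    · simp
  | succ m ih =>
    rw [sum_cnt_succ]
    simp_rw [sum_swap_Ph]
    have : ∀ π : Equiv.Perm α, (cnt m π : ℝ[X]) * (C ((Fintype.card α : ℝ) * ((Fintype.card α : ℝ) - 1) / 2) * Ph π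
        - C (Fintype.card α : ℝ) * X * derivative (Ph π)) =
        C ((Fintype.card α : ℝ) * ((Fintype.card α : ℝ) - 1) / 2) * ((cnt m π : ℝ[X]) * Ph π)
        - C (Fintype.card α : ℝ) * X * derivative ((cnt m π : ℝ[X]) * Ph π) := by
      intro π
      rw [derivative_natCast_mul]; ring
    simp_rw [this]
    rw [Finset.sum_sub_distrib, ← Finset.mul_sum, ← Finset.mul_sum, ← derivative_sum, ih,
      derivative_sum, Finset.mul_sum, Finset.mul_sum, ← Finset.sum_sub_distrib]
    refine Finset.sum_congr rfl fun k _ => ?_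
    rw [derivative_C_mul_X_pow]
    rcases k with _ | k
    · simp; rw [pow_succ]; ring
    · simp only [Nat.add_sub_cancel]
      rw [show C (Fintype.card α : ℝ) * X * (C (((-1 : ℝ) ^ (k+1) * ((Fintype.card α - 1).choose (k+1) : ℝ) *
        ((Fintype.card α : ℝ) * ((Fintype.card α : ℝ) - 1) / 2 - (Fintype.card α : ℝ) * ((k+1 : ℕ) : ℝ)) ^ m) * ((k+1 : ℕ) : ℝ)) * X ^ k)
        = C ((Fintype.card α : ℝ) * (((-1 : ℝ) ^ (k+1) * ((Fintype.card α - 1).choose (k+1) : ℝ) *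
        ((Fintype.card α : ℝ) * ((Fintype.card α : ℝ) - 1) / 2 - (Fintype.card α : ℝ) * ((k+1 : ℕ) : ℝ)) ^ m) * ((k+1 : ℕ) : ℝ))) * X ^ (k+1) by
          rw [C_mul (a := (Fintype.card α : ℝ)) (b := _ * _), pow_succ]; ring]
      rw [← mul_assoc, ← C_mul, ← sub_mul, ← C_sub]
      congr 2
      ring

open scoped Classical in
lemma sum_cnt_long {α : Type*} [Fintype α] [DecidableEq α] (hc : 2 ≤ Fintype.card α) (m : ℕ) :
    (Fintype.card α : ℝ) * ∑ π ∈ (Finset.univ : Finset (Equiv.Perm α)).filter (fun π => π.IsCycleOn (Set.univ : Set α)), (cnt m π : ℝ) =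
      ∑ k ∈ Finset.range (Fintype.card α), (-1 : ℝ) ^ k * ((Fintype.card α - 1).choose k : ℝ) *
        ((Fintype.card α : ℝ) * ((Fintype.card α : ℝ) - 1) / 2 - (Fintype.card α : ℝ) * k) ^ m := by
  have : Nonempty α := Fintype.card_pos_iff.1 (by omega)
  have h := congrArg (Polynomial.eval 1) (sum_cnt_Ph (α := α) m)
  simp only [eval_finsetSum, eval_mul, eval_C, eval_pow, eval_X, one_pow, mul_one, eval_natCast] at h
  rw [← h, Finset.mul_sum, Finset.sum_filter]
  refine Finset.sum_congr rfl fun π _ => ?_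
  split_ifs with hp
  · rw [Ph_long hc π hp]; ring
  · rw [Ph_not_long π hp]; ring

end

section
open PowerSeries

noncomputable def Ec (c : ℝ) : PowerSeries ℝ := rescale c (exp ℝ)

lemma coeff_Ec (c : ℝ) (m : ℕ) : coeff m (Ec c) = c ^ m / (m.factorial : ℝ) := by
  simp [Ec, coeff_rescale, coeff_exp, div_eq_mul_inv]

lemma Ec_pow (c : ℝ) (k : ℕ) : Ec c ^ k = Ec (k * c) := by
  induction k with
  | zero => simp [Ec]
  | succ k ih =>
    rw [pow_succ, ih]
    simp only [Ec]
    rw [exp_mul_exp_eq_exp_add]; congr 1; push_cast; ring_nf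

lemma Ec_mul (c d : ℝ) : Ec c * Ec d = Ec (c + d) := by
  simp only [Ec]; rw [exp_mul_exp_eq_exp_add]

noncomputable def Ssh : PowerSeries ℝ := mk fun i => 1 / ((4 : ℝ) ^ i * ((2 * i + 1).factorial : ℝ))

lemma Ec_sub : Ec (1/2) - Ec (-(1/2)) = X * expand 2 two_ne_zero Ssh := by
  ext m
  rw [map_sub, coeff_Ec, coeff_Ec]
  rcases m with _ | m
  · simp
  · rw [coeff_succ_X_mul, coeff_expand]
    split_ifs with h
    · obtain ⟨i, rfl⟩ := h
      rw [Nat.mul_div_cancel_left _ (by norm_num : 0 < 2), Ssh, coeff_mk]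
      have p1 : ((1:ℝ)/2) ^ (2 * i + 1) = ((1/2)^2)^i * (1/2) := by rw [pow_succ, pow_mul]
      have p2 : (-((1:ℝ)/2)) ^ (2 * i + 1) = -(((1/2)^2)^i * (1/2)) := by
        rw [Odd.neg_pow ⟨i, rfl⟩, p1]
      rw [p1, p2]
      have : ((2 * i + 1).factorial : ℝ) ≠ 0 := by positivity
      field_simp
      have e : ((4:ℝ) ^ i) * (((1 / 2) ^ 2) ^ i) = 1 := by rw [← mul_pow]; norm_num
      norm_num
      norm_num at e
      linarith
    · have : Odd m := by rwa [← Nat.not_even_iff_odd, even_iff_two_dvd]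
      have h2 : Even (m + 1) := this.add_one
      rw [h2.neg_pow, sub_self]

lemma alt_sum (N M : ℕ) :
    ∑ k ∈ Finset.range (N + 1), (-1 : ℝ) ^ k * (N.choose k : ℝ) * ((N : ℝ) / 2 - k) ^ M =
      (M.factorial : ℝ) * coeff M ((Ec (1/2) - Ec (-(1/2))) ^ N) := by
  rw [sub_eq_neg_add, add_pow, map_sum, Finset.mul_sum]
  refine Finset.sum_congr rfl fun k hk => ?_
  have hk' : k ≤ N := by simpa [Nat.lt_succ_iff] using hk
  rw [neg_pow (Ec _), mul_assoc ((-1 : PowerSeries ℝ) ^ k), Ec_pow, Ec_pow, Ec_mul]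
  have e1 : ((-1 : PowerSeries ℝ) ^ k * Ec (k * -(1/2) + ((N - k : ℕ) : ℝ) * (1/2)) * (N.choose k : PowerSeries ℝ))
      = C ((-1 : ℝ) ^ k * (N.choose k : ℝ)) * Ec (k * -(1/2) + ((N - k : ℕ) : ℝ) * (1/2)) := by
    simp; ring
  rw [e1, coeff_C_mul, coeff_Ec, Nat.cast_sub hk']
  have : (M.factorial : ℝ) ≠ 0 := by positivity
  field_simp
  congr 2
  ring

lemma coeff_pow_sub (N g : ℕ) : coeff (N + 2 * g) ((Ec (1/2) - Ec (-(1/2))) ^ N) = coeff g (Ssh ^ N) := by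
  rw [Ec_sub, mul_pow, add_comm, coeff_X_pow_mul, ← map_pow, coeff_expand_mul]

lemma Ssh_coeff_le (i : ℕ) : coeff i Ssh ≤ coeff i (Ec (1/24)) := by
  rw [Ssh, coeff_mk, coeff_Ec, div_pow, one_pow, div_div]
  have : (24 : ℝ) ^ i * (i.factorial : ℝ) ≤ 4 ^ i * ((2 * i + 1).factorial : ℝ) := by
    induction i with
    | zero => simp
    | succ i ih =>
      have e : ((2 * (i + 1) + 1).factorial : ℝ) = (2 * i + 3) * ((2 * i + 2) * ((2 * i + 1).factorial : ℝ)) := by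
        rw [show 2 * (i + 1) + 1 = (2 * i + 1) + 1 + 1 by ring, Nat.factorial_succ, Nat.factorial_succ]
        push_cast; ring
      rw [e, Nat.factorial_succ, pow_succ, pow_succ]
      push_cast
      have h4 : (0:ℝ) ≤ (4:ℝ)^i * ((2 * i + 1).factorial : ℝ) := by positivity
      calc (24:ℝ) ^ i * 24 * ((i + 1) * (i.factorial : ℝ)) = 24 * (i + 1) * (24 ^ i * i.factorial) := by ring
        _ ≤ 24 * (i + 1) * (4 ^ i * ((2 * i + 1).factorial : ℝ)) := by gcongr
        _ ≤ (4 * ((2 * i + 3) * (2 * i + 2))) * (4 ^ i * ((2 * i + 1).factorial : ℝ)) := by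
            apply mul_le_mul_of_nonneg_right _ h4
            have : (0:ℝ) ≤ i := by positivity
            nlinarith
        _ = _ := by ring
  exact one_div_le_one_div_of_le (by positivity) this

lemma Ssh_coeff_nonneg (i : ℕ) : 0 ≤ coeff i Ssh := by
  rw [Ssh, coeff_mk]; positivity

lemma Ssh_pow (N g : ℕ) : 0 ≤ coeff g (Ssh ^ N) ∧ coeff g (Ssh ^ N) ≤ ((N : ℝ) / 24) ^ g / (g.factorial : ℝ) := by
  have key : ∀ g, 0 ≤ coeff g (Ssh ^ N) ∧ coeff g (Ssh ^ N) ≤ coeff g (Ec (1/24) ^ N) := by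
    induction N with
    | zero => intro g; simp only [pow_zero, coeff_one, le_refl, and_true]; split_ifs <;> norm_num
    | succ N ih =>
      intro g
      rw [pow_succ, pow_succ, coeff_mul, coeff_mul]
      constructor
      · exact Finset.sum_nonneg fun p _ => mul_nonneg (ih _).1 (Ssh_coeff_nonneg _)
      · exact Finset.sum_le_sum fun p _ => mul_le_mul (ih _).2 (Ssh_coeff_le _) (Ssh_coeff_nonneg _)
          ((ih _).1.trans (ih _).2)
  have := key g
  rwa [Ec_pow, coeff_Ec, mul_one_div] at this

lemma Ssh_pow_zero (N : ℕ) : coeff 0 (Ssh ^ N) = 1 := by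
  rw [coeff_zero_eq_constantCoeff, map_pow, ← coeff_zero_eq_constantCoeff_apply]
  simp [Ssh]

section
variable {α : Type*} [Fintype α] [DecidableEq α]

lemma long_iff_cycleType (hc : 2 ≤ Fintype.card α) (π : Equiv.Perm α) :
    π.IsCycleOn (Set.univ : Set α) ↔ π.cycleType = {Fintype.card α} := by
  have hnt : Nontrivial α := Fintype.one_lt_card_iff_nontrivial.1 hc
  constructor
  · intro h
    have hne : ∀ i, π i ≠ i := fun i => h.apply_ne (Set.nontrivial_univ) (Set.mem_univ i)
    have hcyc : π.IsCycle := by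
      obtain ⟨i⟩ := hnt.to_nonempty
      exact ⟨i, hne i, fun y _ => h.2 (Set.mem_univ i) (Set.mem_univ y)⟩
    rw [hcyc.cycleType]
    have : π.support = Finset.univ := by ext i; simp [hne]
    rw [this]; simp
  · intro h
    have hcyc : π.IsCycle := by rw [← Equiv.Perm.card_cycleType_eq_one, h]; simp
    have hs : π.support.card = Fintype.card α := by
      rw [← Equiv.Perm.sum_cycleType, h]; simp
    have hs' : π.support = Finset.univ := by rwa [Finset.card_eq_iff_eq_univ] at hs
    refine ⟨by simp [Set.bijOn_univ, π.bijective], fun x _ y _ => hcyc.sameCycle ?_ ?_⟩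
    · rw [← Equiv.Perm.mem_support, hs']; simp
    · rw [← Equiv.Perm.mem_support, hs']; simp

lemma cnt_long (hc : 2 ≤ Fintype.card α) (π : Equiv.Perm α) (h : π.IsCycleOn (Set.univ : Set α)) (g : ℕ) :
    (cnt (Fintype.card α - 1 + 2 * g) π : ℝ) * ((Fintype.card α).factorial : ℝ) =
      (Fintype.card α : ℝ) ^ (Fintype.card α - 1 + 2 * g) * ((Fintype.card α - 1 + 2 * g).factorial : ℝ) *
        coeff g (Ssh ^ (Fintype.card α - 1)) := by
  classical
  have h1 := sum_cnt_long hc (Fintype.card α - 1 + 2 * g)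
  have h2 : ∀ τ ∈ (Finset.univ : Finset (Equiv.Perm α)).filter (fun π => π.IsCycleOn (Set.univ : Set α)),
      (cnt (Fintype.card α - 1 + 2 * g) τ : ℝ) = cnt (Fintype.card α - 1 + 2 * g) π := by
    intro τ hτ
    simp only [Finset.mem_filter, Finset.mem_univ, true_and] at hτ
    have : IsConj π τ := by
      rw [Equiv.Perm.isConj_iff_cycleType_eq, (long_iff_cycleType hc _).1 hτ, (long_iff_cycleType hc _).1 h]
    obtain ⟨c, hc⟩ := isConj_iff.1 this
    rw [← hc, cnt_conj]
  rw [Finset.sum_congr rfl h2, Finset.sum_const] at h1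
  have h3 : ((Finset.univ : Finset (Equiv.Perm α)).filter (fun π => π.IsCycleOn (Set.univ : Set α))).card
      = (Fintype.card α - 1).factorial := by
    have := Equiv.Perm.card_of_cycleType_singleton (α := α) hc le_rfl
    rw [Nat.choose_self, mul_one] at this
    rw [← this]
    congr 1
    ext π
    simp [long_iff_cycleType hc]
  rw [h3] at h1
  obtain ⟨N, hN⟩ : ∃ N, Fintype.card α = N + 1 := ⟨Fintype.card α - 1, by omega⟩
  rw [hN] at h1 ⊢
  simp only [Nat.add_sub_cancel] at h1 ⊢
  have h4 : ∀ k : ℕ, (((N + 1 : ℕ) : ℝ) * (((N + 1 : ℕ) : ℝ) - 1) / 2 - ((N + 1 : ℕ) : ℝ) * k) ^ (N + 2 * g) =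
      ((N + 1 : ℕ) : ℝ) ^ (N + 2 * g) * ((N : ℝ) / 2 - k) ^ (N + 2 * g) := by
    intro k; rw [← mul_pow]; congr 1; push_cast; ring
  simp_rw [h4] at h1
  have h5 : ∑ k ∈ Finset.range (N + 1), (-1 : ℝ) ^ k * (N.choose k : ℝ) * (((N + 1 : ℕ) : ℝ) ^ (N + 2 * g) * ((N : ℝ) / 2 - k) ^ (N + 2 * g)) =
     ((N + 1 : ℕ) : ℝ) ^ (N + 2 * g) * ∑ k ∈ Finset.range (N + 1), (-1 : ℝ) ^ k * (N.choose k : ℝ) * ((N : ℝ) / 2 - k) ^ (N + 2 * g) := by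
    rw [Finset.mul_sum]; exact Finset.sum_congr rfl fun k _ => by ring
  rw [h5, alt_sum, coeff_pow_sub] at h1
  rw [Nat.factorial_succ, mul_assoc, ← h1]
  simp only [nsmul_eq_mul]
  push_cast
  ring

lemma cnt_long_zero (hc : 1 ≤ Fintype.card α) (π : Equiv.Perm α) (h : π.IsCycleOn (Set.univ : Set α)) :
    cnt (Fintype.card α - 1) π * Fintype.card α = Fintype.card α ^ (Fintype.card α - 1) := by
  rcases hc.eq_or_lt with h1 | h1
  · rw [← h1]
    have : Subsingleton α := Fintype.card_le_one_iff_subsingleton.1 h1.symm.le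
    have : π = 1 := Subsingleton.elim _ _
    simp [cnt, this]
  · have := cnt_long h1 π h 0
    simp only [mul_zero, add_zero, Ssh_pow_zero, mul_one] at this
    obtain ⟨N, hN⟩ : ∃ N, Fintype.card α = N + 1 := ⟨Fintype.card α - 1, by omega⟩
    rw [hN] at this ⊢
    simp only [Nat.add_sub_cancel] at this ⊢
    rw [Nat.factorial_succ] at this
    have h6 : (N.factorial : ℝ) ≠ 0 := by positivity
    have h7 : (cnt N π : ℝ) * ((N + 1 : ℕ) : ℝ) = ((N + 1 : ℕ) : ℝ) ^ N := by
      apply mul_right_cancel₀ h6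
      rw [← this]; push_cast; ring
    exact_mod_cast h7

lemma cnt_long_le (hc : 2 ≤ Fintype.card α) (π : Equiv.Perm α) (h : π.IsCycleOn (Set.univ : Set α)) (g : ℕ) :
    (cnt (Fintype.card α - 1 + 2 * g) π : ℝ) * ((Fintype.card α).factorial : ℝ) * (24 ^ g * (g.factorial : ℝ)) ≤
      (Fintype.card α : ℝ) ^ (Fintype.card α - 1 + 2 * g) * ((Fintype.card α - 1 + 2 * g).factorial : ℝ) *
        (Fintype.card α : ℝ) ^ g := by
  rw [cnt_long hc π h]
  have h1 := (Ssh_pow (Fintype.card α - 1) g).2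
  rw [div_pow, div_div, le_div_iff₀ (by positivity)] at h1
  rw [mul_assoc]
  gcongr
  refine h1.trans ?_
  gcongr
  omega
end

end

section

section
variable {α : Type*} [Fintype α] [DecidableEq α]

noncomputable def tup : ℕ → Equiv.Perm α → Finset (List (Equiv.Perm α))
  | 0, π => if π = 1 then {[]} else ∅
  | m + 1, π => (swaps α).biUnion fun t => (tup m (t * π)).image (fun L => t :: L)

lemma mem_tup {m : ℕ} {π : Equiv.Perm α} {L : List (Equiv.Perm α)} :
    L ∈ tup m π ↔ L.length = m ∧ (∀ t ∈ L, t.IsSwap) ∧ L.prod = π := by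
  induction m generalizing π L with
  | zero =>
    rw [tup]
    split_ifs with h
    · subst h; constructor
      · intro h; rw [Finset.mem_singleton] at h; subst h; simp
      · rintro ⟨h, -⟩; simpa using h
    · simp only [Finset.notMem_empty, false_iff, List.length_eq_zero_iff]
      rintro ⟨rfl, -, h2⟩; exact h (by simpa using h2.symm)
  | succ m ih =>
    simp only [tup, Finset.mem_biUnion, Finset.mem_image, ih, mem_swaps]
    constructor
    · rintro ⟨t, ht, L', ⟨h1, h2, h3⟩, rfl⟩
      refine ⟨by simp [h1], ?_, ?_⟩
      · intro s hs
        rcases List.mem_cons.1 hs with rfl | hs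
        · exact ht
        · exact h2 s hs
      · rw [List.prod_cons, h3, ← mul_assoc, IsSwap.mul_self_eq ht, one_mul]
    · rintro ⟨h1, h2, h3⟩
      rcases L with _ | ⟨t, L'⟩
      · simp at h1
      · have ht := h2 t (by simp)
        refine ⟨t, ht, L', ⟨by simpa using h1, fun s hs => h2 s (by simp [hs]), ?_⟩, rfl⟩
        rw [← h3, List.prod_cons, ← mul_assoc, IsSwap.mul_self_eq ht, one_mul]

lemma card_tup (m : ℕ) (π : Equiv.Perm α) : (tup m π).card = cnt m π := by
  induction m generalizing π with
  | zero => rw [tup, cnt]; split_ifs <;> simp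
  | succ m ih =>
    rw [tup, cnt, Finset.card_biUnion]
    · refine Finset.sum_congr rfl fun t _ => ?_
      rw [Finset.card_image_of_injective _ (List.cons_injective), ih]
    · intro t _ s _ hts
      rw [Function.onFun, Finset.disjoint_left]
      intro L h1 h2
      simp only [Finset.mem_image] at h1 h2
      obtain ⟨L1, _, rfl⟩ := h1
      obtain ⟨L2, _, h⟩ := h2
      exact hts (by simpa using (List.cons.inj h).1.symm)
end

lemma prod_reverse_swaps {n : ℕ} (L : List (Equiv.Perm (Fin n))) (h : ∀ t ∈ L, t.IsSwap) :
    prodLR L = (L.prod)⁻¹ := by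
  rw [prodLR, List.prod_inv_reverse]
  congr 2
  have : L.map (fun x => x⁻¹) = L.map id := by
    apply List.map_congr_left
    intro t ht
    rw [inv_eq_iff_mul_eq_one]; exact IsSwap.mul_self_eq (h t ht)
  rw [this]; simp

/-- the finset of factorizations -/
noncomputable def FF (n g : ℕ) : Finset (List (Equiv.Perm (Fin n))) := tup (n - 1 + 2 * g) (finRotate n)⁻¹

lemma mem_FF {n g : ℕ} {L : List (Equiv.Perm (Fin n))} :
    L ∈ FF n g ↔ L.length = n - 1 + 2 * g ∧ (∀ t ∈ L, t.IsSwap) ∧ L.prod = (finRotate n)⁻¹ := mem_tup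

lemma Fcal_eq (n g : ℕ) : Fcal n g = (FF n g : Set _) := by
  ext L
  simp only [Fcal, Set.mem_ofPred_eq, Finset.mem_coe, mem_FF]
  constructor
  · rintro ⟨h1, h2, h3⟩
    rw [prod_reverse_swaps L h2] at h3
    exact ⟨h1, h2, by rw [← h3, inv_inv]⟩
  · rintro ⟨h1, h2, h3⟩
    refine ⟨h1, h2, ?_⟩
    rw [prod_reverse_swaps L h2, h3, inv_inv]

lemma finRotate_long (n : ℕ) : (finRotate n).IsCycleOn (Set.univ : Set (Fin n)) := by
  rcases n with _ | _ | n
  · exact ⟨by simp [Set.bijOn_univ, (finRotate 0).bijective], fun x => x.elim0⟩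
  · exact ⟨by simp [Set.bijOn_univ, (finRotate 1).bijective], fun x _ y _ => by
      have : x = y := by ext; omega
      rw [this]⟩
  · rw [long_iff_cycleType (by simp), cycleType_finRotate]; simp

lemma card_FF_zero (n : ℕ) (hn : 1 ≤ n) : (FF n 0).card * n = n ^ (n - 1) := by
  have := cnt_long_zero (α := Fin n) (by simpa using hn) (finRotate n)⁻¹ (finRotate_long n).inv
  simpa [FF, card_tup] using this

lemma card_FF_le (n g : ℕ) (hn : 2 ≤ n) :
    ((FF n g).card : ℝ) * (n.factorial : ℝ) * (24 ^ g * (g.factorial : ℝ)) ≤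
      (n : ℝ) ^ (n - 1 + 2 * g) * ((n - 1 + 2 * g).factorial : ℝ) * (n : ℝ) ^ g := by
  have := cnt_long_le (α := Fin n) (by simpa using hn) (finRotate n)⁻¹ (finRotate_long n).inv g
  simpa [FF, card_tup] using this

end

section

lemma finRotate_val {n : ℕ} (x : Fin n) :
    (finRotate n x).val = if x.val + 1 = n then 0 else x.val + 1 := by
  rcases n with _ | n
  · exact x.elim0
  · split_ifs with h
    · have : x = Fin.last n := by ext; simp; omega
      rw [this, finRotate_last]; simp
    · exact coe_finRotate_of_ne_last (by intro h'; apply h; rw [h']; simp)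

lemma finRotate_inv_val {n : ℕ} (x : Fin n) :
    ((finRotate n)⁻¹ x).val = if x.val = 0 then n - 1 else x.val - 1 := by
  have h := finRotate_val ((finRotate n)⁻¹ x)
  rw [show finRotate n ((finRotate n)⁻¹ x) = x from Equiv.apply_symm_apply _ _] at h
  have := x.isLt
  have := ((finRotate n)⁻¹ x).isLt
  split_ifs at h ⊢ <;> omega

def sg (α δ β γ x : ℕ) : ℕ :=
  if x ≤ α then x else if x ≤ δ then x + γ - δ else if x ≤ β then x + α + γ - δ - β
  else if x ≤ γ then x + α - β else x

lemma sg_spec {α δ β γ : ℕ} (h1 : α ≤ δ) (h2 : δ < β) (h3 : β < γ) (x : ℕ) :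
    (x ≤ α ∧ sg α δ β γ x = x) ∨ (α < x ∧ x ≤ δ ∧ sg α δ β γ x + δ = x + γ) ∨
    (δ < x ∧ x ≤ β ∧ sg α δ β γ x + δ + β = x + α + γ) ∨ (β < x ∧ x ≤ γ ∧ sg α δ β γ x + β = x + α) ∨
    (γ < x ∧ sg α δ β γ x = x) := by
  unfold sg
  split_ifs <;> omega

lemma sg_step (n α δ β γ x y z z' : ℕ) (h1 : α ≤ δ) (h2 : δ < β) (h3 : β < γ) (hγ : γ < n) (hx : x < n)
   (hy : y = if x = α then β else if x = β then α else x)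
   (hz : z = if y = δ then γ else if y = γ then δ else y)
   (hz' : z' = if z + 1 = n then 0 else z + 1) :
   sg α δ β γ z' = if sg α δ β γ x + 1 = n then 0 else sg α δ β γ x + 1 := by
  have e1 := sg_spec h1 h2 h3 x
  have e2 := sg_spec h1 h2 h3 z'
  generalize sg α δ β γ x = p at *
  generalize sg α δ β γ z' = q at *
  by_cases ha : x = α
  · have : y = β := by simp [hy, ha]
    have : z = β := by rw [hz, if_neg (by omega), if_neg (by omega), this]
    split_ifs at hz' ⊢ <;> omega
  by_cases hb : x = β
  · have hy' : y = α := by rw [hy, if_neg ha, if_pos hb]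
    by_cases hd : α = δ
    · have : z = γ := by rw [hz, if_pos (by omega)]
      split_ifs at hz' ⊢ <;> omega
    · have : z = α := by rw [hz, if_neg (by omega), if_neg (by omega), hy']
      split_ifs at hz' ⊢ <;> omega
  have hy' : y = x := by rw [hy, if_neg ha, if_neg hb]
  by_cases hd : x = δ
  · have : z = γ := by rw [hz, if_pos (by omega)]
    split_ifs at hz' ⊢ <;> omega
  by_cases hg : x = γ
  · have : z = δ := by rw [hz, if_neg (by omega), if_pos (by omega)]
    split_ifs at hz' ⊢ <;> omega
  have : z = x := by rw [hz, if_neg (by omega), if_neg (by omega), hy']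
  split_ifs at hz' ⊢ <;> omega

lemma swap_val {n : ℕ} (x y z : Fin n) :
    (Equiv.swap x y z).val = if z.val = x.val then y.val else if z.val = y.val then x.val else z.val := by
  rw [Equiv.swap_apply_def]
  simp only [Fin.ext_iff]
  split_ifs <;> rfl

lemma exists_sigma {n : ℕ} (α δ β γ : Fin n) (h1 : α.val ≤ δ.val) (h2 : δ.val < β.val) (h3 : β.val < γ.val) :
    ∃ σ : Equiv.Perm (Fin n), (∀ x, (σ x).val = sg α δ β γ x) ∧
      ∀ x, σ (finRotate n (Equiv.swap δ γ (Equiv.swap α β x))) = finRotate n (σ x) := by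
  have hγ := γ.isLt
  have hlt : ∀ x : Fin n, sg α δ β γ x < n := by
    intro x
    have := x.isLt
    have := sg_spec h1 h2 h3 x
    omega
  have hinj : Function.Injective (fun x : Fin n => (⟨sg α δ β γ x, hlt x⟩ : Fin n)) := by
    intro x y hxy
    simp only [Fin.mk.injEq] at hxy
    have e1 := sg_spec h1 h2 h3 x
    have e2 := sg_spec h1 h2 h3 y
    ext
    omega
  refine ⟨Equiv.ofBijective _ (Finite.injective_iff_bijective.1 hinj), fun x => rfl, ?_⟩
  intro x
  ext
  rw [finRotate_val]
  simp only [Equiv.ofBijective_apply]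
  exact sg_step n α δ β γ x _ _ _ h1 h2 h3 hγ x.isLt (swap_val _ _ _) (swap_val _ _ _) (finRotate_val _)

def Qv {n : ℕ} (L : List (Equiv.Perm (Fin n))) (u : ℕ) (y : Fin n) : Fin n := (L.take u).prod y

lemma Qv_zero {n : ℕ} (L : List (Equiv.Perm (Fin n))) (y : Fin n) : Qv L 0 y = y := by simp [Qv]

lemma Qv_of_le {n : ℕ} (L : List (Equiv.Perm (Fin n))) (u : ℕ) (h : L.length ≤ u) (y : Fin n) :
    Qv L u y = L.prod y := by rw [Qv, List.take_of_length_le h]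

lemma Qv_succ {n : ℕ} (L : List (Equiv.Perm (Fin n))) (u : ℕ) (h : u < L.length) (y : Fin n) :
    Qv L (u + 1) y = Qv L u (L[u] y) := by
  rw [Qv, Qv, List.take_add_one, List.prod_append, List.getElem?_eq_getElem h]; simp

def Dn {n : ℕ} (L : List (Equiv.Perm (Fin n))) (y : Fin n) : ℕ :=
  ((Finset.range L.length).filter (fun u => (Qv L (u + 1) y).val < (Qv L u y).val)).card

def Bad {n : ℕ} (r : ℕ) (L : List (Equiv.Perm (Fin n))) : Set (Fin n) :=
  {y | ∃ u, y.val + r < (Qv L u y).val ∨ (Qv L u y).val + r < y.val}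

lemma sum_Dn {n : ℕ} (L : List (Equiv.Perm (Fin n))) (h : ∀ t ∈ L, t.IsSwap) :
    ∑ y, Dn L y = L.length := by
  unfold Dn
  simp_rw [Finset.card_filter]
  rw [Finset.sum_comm]
  have : ∀ u ∈ Finset.range L.length,
      ∑ y : Fin n, (if (Qv L (u + 1) y).val < (Qv L u y).val then 1 else 0) = 1 := by
    intro u hu
    rw [Finset.mem_range] at hu
    obtain ⟨p, q, hpq, ht⟩ := h L[u] (List.getElem_mem hu)
    have hne : Qv L u p ≠ Qv L u q := fun h => hpq ((L.take u).prod.injective h)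
    have hne' : (Qv L u p).val ≠ (Qv L u q).val := fun h => hne (Fin.ext h)
    rw [← Finset.card_filter, Finset.card_eq_one]
    rcases lt_or_gt_of_ne hne' with hlt | hlt
    · refine ⟨q, ?_⟩
      ext y
      simp only [Finset.mem_filter, Finset.mem_univ, true_and, Finset.mem_singleton]
      rw [Qv_succ L u hu, ht, Equiv.swap_apply_def]
      split_ifs with h1 h2
      · subst h1; simp [hpq]; omega
      · subst h2; simp [hlt]
      · simp [h2]
    · refine ⟨p, ?_⟩
      ext y
      simp only [Finset.mem_filter, Finset.mem_univ, true_and, Finset.mem_singleton]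
      rw [Qv_succ L u hu, ht, Equiv.swap_apply_def]
      split_ifs with h1 h2
      · subst h1; simp [hlt]
      · subst h2; simp [hpq.symm]; omega
      · simp [h1]
  rw [Finset.sum_congr rfl this]; simp

/-- if no descents in an interval then monotone -/
lemma mono_of_no_desc (f : ℕ → ℕ) (s e : ℕ) (h : ∀ u, s ≤ u → u < e → f u ≤ f (u + 1)) :
    ∀ u u', s ≤ u → u ≤ u' → u' ≤ e → f u ≤ f u' := by
  intro u u' hs huu' he
  induction u', huu' using Nat.le_induction with
  | base => exact le_rfl
  | succ k hk ih => exact (ih (by omega)).trans (h k (by omega) (by omega))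

lemma exists_desc (f : ℕ → ℕ) (s e : ℕ) (hse : s ≤ e) (h : f e < f s) :
    ∃ u, s ≤ u ∧ u < e ∧ f (u + 1) < f u := by
  by_contra! H
  have := mono_of_no_desc f s e H s e le_rfl hse le_rfl
  omega

lemma one_desc (f : ℕ → ℕ) (m : ℕ)
    (hD : ((Finset.range m).filter (fun u => f (u + 1) < f u)).card ≤ 1) (hlt : f m < f 0) :
    ∃ k < m, (∀ u u', u ≤ u' → u' ≤ k → f u ≤ f u') ∧
      (∀ u u', k < u → u ≤ u' → u' ≤ m → f u ≤ f u') := by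
  obtain ⟨k, -, hk, hd⟩ := exists_desc f 0 m (Nat.zero_le _) hlt
  have huniq : ∀ u < m, f (u + 1) < f u → u = k := by
    intro u hu h
    exact Finset.card_le_one.1 hD u (by simp [hu, h]) k (by simp [hk, hd])
  refine ⟨k, hk, ?_, ?_⟩
  · intro u u' h1 h2
    refine mono_of_no_desc f 0 k ?_ u u' (Nat.zero_le _) h1 h2
    intro x _ hx
    by_contra! hh
    have := huniq x (by omega) hh
    omega
  · intro u u' h1 h2 h3
    refine mono_of_no_desc f (k + 1) m ?_ u u' h1 h2 h3
    intro x hx1 hx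
    by_contra! hh
    have := huniq x (by omega) hh
    omega

lemma two_desc (f : ℕ → ℕ) (m : ℕ) (u1 u2 u3 u4 : ℕ) (h12 : u1 ≤ u2) (h23 : u2 ≤ u3) (h34 : u3 ≤ u4) (h4 : u4 ≤ m)
    (hA : f u2 < f u1) (hB : f u4 < f u3) :
    2 ≤ ((Finset.range m).filter (fun u => f (u + 1) < f u)).card := by
  obtain ⟨x, hx1, hx2, hx⟩ := exists_desc f u1 u2 h12 hA
  obtain ⟨y, hy1, hy2, hy⟩ := exists_desc f u3 u4 h34 hB
  have : 1 < ((Finset.range m).filter (fun u => f (u + 1) < f u)).card := by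
    rw [Finset.one_lt_card]
    refine ⟨x, ?_, y, ?_, by omega⟩
    · simp [hx]; omega
    · simp [hy]; omega
  exact this

lemma Dn_pos {n g : ℕ} (L : List (Equiv.Perm (Fin n))) (hL : L ∈ FF n g) (y : Fin n) (hy : y.val ≠ 0) :
    1 ≤ Dn L y := by
  obtain ⟨h1, h2, h3⟩ := mem_FF.1 hL
  have hlt : (Qv L L.length y).val < (Qv L 0 y).val := by
    rw [Qv_zero, Qv_of_le L _ le_rfl, h3, finRotate_inv_val, if_neg hy]; omega
  obtain ⟨u, _, hu, hd⟩ := exists_desc (fun u => (Qv L u y).val) 0 L.length (Nat.zero_le _) hlt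
  exact Finset.card_pos.2 ⟨u, Finset.mem_filter.2 ⟨Finset.mem_range.2 hu, hd⟩⟩

lemma card_multi {n g : ℕ} (hn : 1 ≤ n) (L : List (Equiv.Perm (Fin n))) (hL : L ∈ FF n g) :
    ((Finset.univ : Finset (Fin n)).filter (fun y => y.val ≠ 0 ∧ 2 ≤ Dn L y)).card ≤ 2 * g := by
  obtain ⟨h1, h2, h3⟩ := mem_FF.1 hL
  have hs := sum_Dn L h2
  have hle : ∑ y : Fin n, ((if y.val ≠ 0 then 1 else 0) + (if y.val ≠ 0 ∧ 2 ≤ Dn L y then 1 else 0)) ≤ ∑ y, Dn L y := by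
    refine Finset.sum_le_sum fun y _ => ?_
    by_cases hy : y.val = 0
    · simp [hy]
    · have := Dn_pos L hL y hy
      simp only [hy, ne_eq, not_false_eq_true, if_true, true_and]
      split_ifs <;> omega
  rw [Finset.sum_add_distrib, ← Finset.card_filter, ← Finset.card_filter, hs, h1] at hle
  have hc : ((Finset.univ : Finset (Fin n)).filter (fun y => y.val ≠ 0)).card = n - 1 := by
    have : ((Finset.univ : Finset (Fin n)).filter (fun y => y.val ≠ 0)) = Finset.univ.erase ⟨0, hn⟩ := by
      ext y; simp [Fin.ext_iff]
    rw [this, Finset.card_erase_of_mem (Finset.mem_univ _)]; simp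
  omega

end

section

lemma insertIdx_len_append {β : Type*} (X W : List β) (s : β) :
    (X ++ W).insertIdx X.length s = X ++ s :: W := by
  induction X with
  | nil => simp
  | cons x X ih => simp [ih]

lemma ins_decomp {β : Type*} (F : List β) (v w : ℕ) (hvw : v < w) (hw : w ≤ F.length + 1) :
    ∃ X Y Z, F = X ++ Y ++ Z ∧ X.length = v ∧ X.length + Y.length + 1 = w ∧
      ∀ s s', (F.insertIdx v s).insertIdx w s' = X ++ s :: (Y ++ s' :: Z) := by
  refine ⟨F.take v, (F.drop v).take (w - 1 - v), (F.drop v).drop (w - 1 - v), ?_, ?_, ?_, ?_⟩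
  · rw [List.append_assoc, List.take_append_drop, List.take_append_drop]
  · simp; omega
  · simp; omega
  · intro s s'
    have h1 : F.insertIdx v s = F.take v ++ s :: F.drop v := by
      have := insertIdx_len_append (F.take v) (F.drop v) s
      rw [List.take_append_drop] at this
      rw [← this]; congr 1; simp; omega
    have h2 := insertIdx_len_append (F.take v ++ s :: (F.drop v).take (w - 1 - v)) ((F.drop v).drop (w - 1 - v)) s'
    have h3 : (F.take v ++ s :: (F.drop v).take (w - 1 - v)).length = w := by simp; omega
    rw [h3] at h2
    rw [h1]
    have h4 : F.take v ++ s :: F.drop v = (F.take v ++ s :: (F.drop v).take (w - 1 - v)) ++ ((F.drop v).drop (w - 1 - v)) := by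
      rw [List.append_assoc, List.cons_append, List.take_append_drop]
    rw [h4, h2]; simp

lemma conj_swap' {n : ℕ} (A : Equiv.Perm (Fin n)) (a b : Fin n) :
    A * Equiv.swap a b * A⁻¹ = Equiv.swap (A a) (A b) := by
  rw [Equiv.mul_swap_eq_swap_mul]; simp

section
variable {n : ℕ} (F : List (Equiv.Perm (Fin n))) (v w : ℕ) (hvw : v < w) (hw : w ≤ F.length + 1)
  (a s1 s2 : Fin n)
include hvw hw

lemma Q_ins1 (u : ℕ) (hu : u ≤ v) (y : Fin n) :
    Qv ((F.insertIdx v (Equiv.swap a s1)).insertIdx w (Equiv.swap a s2)) u y = Qv F u y := by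
  obtain ⟨X, Y, Z, hF, hX, hY, h⟩ := ins_decomp F v w hvw hw
  rw [h, Qv, Qv, hF, List.append_assoc, List.take_append_of_le_length (by omega),
    List.take_append_of_le_length (by omega)]

lemma Q_ins2 (u : ℕ) (hu : v < u) (hu' : u ≤ w) (y : Fin n) :
    Qv ((F.insertIdx v (Equiv.swap a s1)).insertIdx w (Equiv.swap a s2)) u y =
      Equiv.swap (Qv F v a) (Qv F v s1) (Qv F (u - 1) y) := by
  obtain ⟨X, Y, Z, hF, hX, hY, h⟩ := ins_decomp F v w hvw hw
  obtain ⟨k, rfl⟩ : ∃ k, u = v + (k + 1) := ⟨u - v - 1, by omega⟩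
  rw [h]
  simp only [Qv]
  have e1 : F.take v = X := by rw [hF, List.append_assoc, ← hX, List.take_left]
  have e2 : F.take (v + (k + 1) - 1) = X ++ Y.take k := by
    rw [show v + (k + 1) - 1 = X.length + k by omega, hF, List.append_assoc, List.take_length_add_append,
      List.take_append_of_le_length (by omega)]
  have e3 : (X ++ Equiv.swap a s1 :: (Y ++ Equiv.swap a s2 :: Z)).take (v + (k + 1)) = X ++ Equiv.swap a s1 :: Y.take k := by
    rw [← hX, List.take_length_add_append, List.take_succ_cons, List.take_append_of_le_length (by omega)]
  rw [e1, e2, e3, ← conj_swap']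
  simp only [List.prod_append, List.prod_cons, ← Equiv.Perm.mul_apply]
  congr 1; group

lemma Q_ins3 (u : ℕ) (hu : w < u) (y : Fin n) :
    Qv ((F.insertIdx v (Equiv.swap a s1)).insertIdx w (Equiv.swap a s2)) u y =
      Equiv.swap (Qv F v a) (Qv F v s1) (Equiv.swap (Qv F (w - 1) a) (Qv F (w - 1) s2) (Qv F (u - 2) y)) := by
  obtain ⟨X, Y, Z, hF, hX, hY, h⟩ := ins_decomp F v w hvw hw
  obtain ⟨k, rfl⟩ : ∃ k, u = v + (Y.length + (k + 1) + 1) := ⟨u - w - 1, by omega⟩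
  rw [h]
  simp only [Qv]
  have e1 : F.take v = X := by rw [hF, List.append_assoc, ← hX, List.take_left]
  have e1' : F.take (w - 1) = X ++ Y := by
    rw [hF, show w - 1 = (X ++ Y).length by rw [List.length_append]; omega, List.take_left]
  have e2 : F.take (v + (Y.length + (k + 1) + 1) - 2) = X ++ Y ++ Z.take k := by
    rw [show v + (Y.length + (k + 1) + 1) - 2 = (X ++ Y).length + k by rw [List.length_append]; omega, hF,
      List.take_length_add_append]
  have e3 : (X ++ Equiv.swap a s1 :: (Y ++ Equiv.swap a s2 :: Z)).take (v + (Y.length + (k + 1) + 1)) =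
      X ++ Equiv.swap a s1 :: (Y ++ Equiv.swap a s2 :: Z.take k) := by
    rw [← hX, List.take_length_add_append, List.take_succ_cons, List.take_length_add_append, List.take_succ_cons]
  rw [e1, e1', e2, e3, ← conj_swap', ← conj_swap']
  simp only [List.prod_append, List.prod_cons, ← Equiv.Perm.mul_apply]
  congr 1; group

lemma ins_length (s s' : Equiv.Perm (Fin n)) : ((F.insertIdx v s).insertIdx w s').length = F.length + 2 := by
  obtain ⟨X, Y, Z, hF, hX, hY, h⟩ := ins_decomp F v w hvw hw
  rw [h, hF]; simp; omega

lemma ins_swaps (s s' : Equiv.Perm (Fin n)) (hs : s.IsSwap) (hs' : s'.IsSwap) (hF' : ∀ t ∈ F, t.IsSwap) :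
    ∀ t ∈ ((F.insertIdx v s).insertIdx w s'), t.IsSwap := by
  obtain ⟨X, Y, Z, hF, hX, hY, h⟩ := ins_decomp F v w hvw hw
  rw [h]
  intro t ht
  simp only [List.mem_append, List.mem_cons] at ht
  rcases ht with h | rfl | h | rfl | h
  · exact hF' t (by simp [hF, h])
  · exact hs
  · exact hF' t (by simp [hF, h])
  · exact hs'
  · exact hF' t (by simp [hF, h])

lemma ins_prod (y : Fin n) :
    ((F.insertIdx v (Equiv.swap a s1)).insertIdx w (Equiv.swap a s2)).prod y =
      Equiv.swap (Qv F v a) (Qv F v s1) (Equiv.swap (Qv F (w - 1) a) (Qv F (w - 1) s2) (F.prod y)) := by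
  have := Q_ins3 F v w hvw hw a s1 s2 (F.length + 2) (by omega) y
  rw [Qv_of_le _ _ (by rw [ins_length F v w hvw hw])] at this
  rw [this, show F.length + 2 - 2 = F.length by omega, Qv_of_le F F.length le_rfl]
end

lemma prod_map_conj {n : ℕ} (σ : Equiv.Perm (Fin n)) (L : List (Equiv.Perm (Fin n))) :
    (L.map fun t => σ * t * σ⁻¹).prod = σ * L.prod * σ⁻¹ := by
  have := (map_list_prod (MulAut.conj σ) L).symm
  exact this

lemma Qv_conj {n : ℕ} (σ : Equiv.Perm (Fin n)) (L : List (Equiv.Perm (Fin n))) (u : ℕ) (y : Fin n) :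
    Qv (L.map fun t => σ * t * σ⁻¹) u (σ y) = σ (Qv L u y) := by
  rw [Qv, Qv, ← List.map_take, prod_map_conj]; simp

lemma comm_fix {n : ℕ} (ρ : Equiv.Perm (Fin n)) (h : ∀ x, ρ (finRotate n x) = finRotate n (ρ x))
    (h0 : ∀ z : Fin n, z.val = 0 → (ρ z).val = 0) : ρ = 1 := by
  have : ∀ k (hk : k < n), ρ ⟨k, hk⟩ = ⟨k, hk⟩ := by
    intro k
    induction k with
    | zero => intro hk; ext; simp [h0 ⟨0, hk⟩ rfl]
    | succ k ih =>
      intro hk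
      have e : finRotate n ⟨k, by omega⟩ = ⟨k + 1, hk⟩ := by
        ext; rw [finRotate_val]; simp; omega
      rw [← e, h, ih]
  ext x
  rw [this x.val x.isLt]; rfl

lemma conj_unique {n : ℕ} (σ τ π : Equiv.Perm (Fin n))
    (hσ0 : ∀ z : Fin n, z.val = 0 → (σ z).val = 0) (hτ0 : ∀ z : Fin n, z.val = 0 → (τ z).val = 0)
    (hσ : σ * π * σ⁻¹ = finRotate n) (hτ : τ * π * τ⁻¹ = finRotate n) : τ = σ := by
  have : τ * σ⁻¹ = 1 := by
    apply comm_fix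
    · intro x
      have e : (τ * σ⁻¹) * finRotate n = finRotate n * (τ * σ⁻¹) := by
        conv_lhs => rw [← hσ]
        rw [← hτ]; group
      exact congrArg (fun f : Equiv.Perm (Fin n) => f x) e
    · intro z hz
      rw [Equiv.Perm.mul_apply]
      apply hτ0
      have h1 : σ z = z := by ext; rw [hσ0 z hz, hz]
      have : σ⁻¹ z = z := by rw [Equiv.Perm.inv_eq_iff_eq, h1]
      rw [this, hz]
  rwa [mul_inv_eq_one] at this

end

section

lemma long_of_conj {n : ℕ} (π σ : Equiv.Perm (Fin n)) (h : σ * π * σ⁻¹ = finRotate n) : IsLongCycle π := by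
  have h2 : π = σ⁻¹ * finRotate n * σ⁻¹⁻¹ := by rw [← h]; group
  rw [IsLongCycle, h2]
  have := (finRotate_long n).conj (g := σ⁻¹)
  have e : ⇑(σ⁻¹) '' (Set.univ : Set (Fin n)) = Set.univ := Set.image_univ_of_surjective (σ⁻¹).surjective
  rwa [e] at this

lemma lamDet_of_sel {n : ℕ} (F : List (Equiv.Perm (Fin n))) (v w : ℕ) (a b c : Fin n)
    (L : List (Equiv.Perm (Fin n))) (σ : Equiv.Perm (Fin n))
    (hσ0 : ∀ z : Fin n, z.val = 0 → (σ z).val = 0)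
    (hσ : σ * prodLR L * σ⁻¹ = finRotate n)
    (hsel : L = (F.insertIdx v (Equiv.swap a c)).insertIdx w (Equiv.swap a b) ∨
      (¬ IsLongCycle (prodLR ((F.insertIdx v (Equiv.swap a c)).insertIdx w (Equiv.swap a b))) ∧
        L = (F.insertIdx v (Equiv.swap a b)).insertIdx w (Equiv.swap a c))) :
    lamDet n F ((v, w), (a, b, c)) = some (L.map fun t => σ * t * σ⁻¹) := by
  classical
  have hlong : IsLongCycle (prodLR L) := long_of_conj _ σ hσ
  have hex : ∃! σ : Equiv.Perm (Fin n),
        (∀ h0 : 0 < n, σ ⟨0, h0⟩ = ⟨0, h0⟩) ∧ σ * prodLR L * σ⁻¹ = finRotate n := by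
    refine ⟨σ, ⟨fun h0 => ?_, hσ⟩, ?_⟩
    · ext; exact hσ0 _ rfl
    · rintro τ ⟨h1, h2⟩
      refine conj_unique σ τ _ hσ0 ?_ hσ h2
      intro z hz
      have hz' : z = ⟨0, by have := z.isLt; omega⟩ := by ext; exact hz
      rw [hz', h1]
  have hch : hex.choose = σ := by
    have h3 := hex.choose_spec.1
    refine conj_unique σ _ _ hσ0 ?_ hσ h3.2
    intro z hz
    have hz' : z = ⟨0, by have := z.isLt; omega⟩ := by ext; exact hz
    rw [hz', h3.1]
  have hsel' : (if IsLongCycle (prodLR ((F.insertIdx v (Equiv.swap a c)).insertIdx w (Equiv.swap a b)))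
      then some ((F.insertIdx v (Equiv.swap a c)).insertIdx w (Equiv.swap a b))
      else if IsLongCycle (prodLR ((F.insertIdx v (Equiv.swap a b)).insertIdx w (Equiv.swap a c)))
      then some ((F.insertIdx v (Equiv.swap a b)).insertIdx w (Equiv.swap a c)) else none) = some L := by
    rcases hsel with h | ⟨h, h'⟩
    · rw [← h, if_pos hlong]
    · rw [if_neg h, ← h', if_pos hlong]
  simp only [lamDet]
  rw [hsel']
  simp only [Option.bind_some]
  rw [dif_pos hex, hch]

/-- the outcome of one step in the good case -/
def Outcome {n : ℕ} (F : List (Equiv.Perm (Fin n))) (v w : ℕ) (a b c : Fin n)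
    (x : List (Equiv.Perm (Fin n))) (σ : Equiv.Perm (Fin n)) : Prop :=
  ((Qv F (w - 1) a).val < (Qv F v a).val ∧
    (∀ z : Fin n, (σ z).val = sg (Qv F (w - 1) a) (Qv F v a) (Qv F (w - 1) b) (Qv F v c) z) ∧
    x = ((F.insertIdx v (Equiv.swap a c)).insertIdx w (Equiv.swap a b)).map fun t => σ * t * σ⁻¹) ∨
  ((Qv F v a).val ≤ (Qv F (w - 1) a).val ∧
    (∀ z : Fin n, (σ z).val = sg (Qv F v a) (Qv F (w - 1) a) (Qv F v b) (Qv F (w - 1) c) z) ∧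
    x = ((F.insertIdx v (Equiv.swap a b)).insertIdx w (Equiv.swap a c)).map fun t => σ * t * σ⁻¹)

lemma not_long_of_inv {n : ℕ} (π : Equiv.Perm (Fin n)) (p : Fin n → Prop) (hp : ∀ x, p x → p (π x))
    (y z : Fin n) (hy : p y) (hz : ¬ p z) : ¬ IsLongCycle π := by
  intro h
  have h' : (π⁻¹).IsCycleOn (Set.univ : Set (Fin n)) := Equiv.Perm.IsCycleOn.inv h
  exact hz (IsCycleOn.fixed_all h' p (by simpa using hp) hy z)

lemma inv_val_eq {n : ℕ} (ρ : Equiv.Perm (Fin n)) (x y : Fin n) (h : ρ y = x) : ρ⁻¹ x = y := by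
  rw [Equiv.Perm.inv_eq_iff_eq, h]

lemma sw_inv {n : ℕ} (x y : Fin n) : (Equiv.swap x y)⁻¹ = Equiv.swap x y := Equiv.swap_inv x y

lemma lam_good {n i : ℕ} (F : List (Equiv.Perm (Fin n))) (hF : F ∈ FF n i) (v w : ℕ) (a b c : Fin n)
    (hvw : v < w) (hw : w < n - 1 + 2 * (i + 1)) (hab : a ≠ b) (hac : a ≠ c)
    (h1 : (Qv F v a).val < (Qv F v b).val) (h2 : (Qv F v a).val < (Qv F (w - 1) b).val)
    (h3 : (Qv F (w - 1) a).val < (Qv F v b).val) (h4 : (Qv F (w - 1) a).val < (Qv F (w - 1) b).val)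
    (h5 : (Qv F v b).val < (Qv F v c).val) (h6 : (Qv F v b).val < (Qv F (w - 1) c).val)
    (h7 : (Qv F (w - 1) b).val < (Qv F v c).val) (h8 : (Qv F (w - 1) b).val < (Qv F (w - 1) c).val) :
    ∃ x σ, lamDet n F ((v, w), (a, b, c)) = some x ∧ x ∈ FF n (i + 1) ∧ Outcome F v w a b c x σ := by
  obtain ⟨l1, l2, l3⟩ := mem_FF.1 hF
  have hw' : w ≤ F.length + 1 := by omega
  have hacs : (Equiv.swap a c).IsSwap := ⟨a, c, hac, rfl⟩
  have habs : (Equiv.swap a b).IsSwap := ⟨a, b, hab, rfl⟩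
  have key : ∀ (L : List (Equiv.Perm (Fin n))) (σ : Equiv.Perm (Fin n)), L.length = F.length + 2 → (∀ t ∈ L, t.IsSwap) →
      σ * prodLR L * σ⁻¹ = finRotate n → (L.map fun t => σ * t * σ⁻¹) ∈ FF n (i + 1) := by
    intro L σ e1 e2 e3
    rw [mem_FF]
    refine ⟨by simp [e1, l1]; omega, ?_, ?_⟩
    · intro t ht
      obtain ⟨s, hs, rfl⟩ := List.mem_map.1 ht
      exact IsSwap.conj (e2 s hs) σ
    · rw [prod_map_conj, ← e3, prod_reverse_swaps L e2]; group
  by_cases hlt : (Qv F (w - 1) a).val < (Qv F v a).val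
  · obtain ⟨σ, hσ, hσ'⟩ := exists_sigma (Qv F (w - 1) a) (Qv F v a) (Qv F (w - 1) b) (Qv F v c) hlt.le h2 h7
    set L := (F.insertIdx v (Equiv.swap a c)).insertIdx w (Equiv.swap a b) with hL
    have hLs := ins_swaps F v w hvw hw' _ _ hacs habs l2
    have hLl := ins_length F v w hvw hw' (Equiv.swap a c) (Equiv.swap a b)
    have hconj : σ * prodLR L * σ⁻¹ = finRotate n := by
      rw [prod_reverse_swaps L hLs]
      have hprod : L.prod = Equiv.swap (Qv F v a) (Qv F v c) * (Equiv.swap (Qv F (w - 1) a) (Qv F (w - 1) b) * (finRotate n)⁻¹) := by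
        ext y
        rw [hL, ins_prod F v w hvw hw', l3]; rfl
      have hcomm : Equiv.swap (Qv F v a) (Qv F v c) * Equiv.swap (Qv F (w - 1) a) (Qv F (w - 1) b) =
          Equiv.swap (Qv F (w - 1) a) (Qv F (w - 1) b) * Equiv.swap (Qv F v a) (Qv F v c) := by
        apply Equiv.Perm.Disjoint.commute
        apply Equiv.Perm.disjoint_swap_swap
        simp only [List.nodup_cons, List.mem_cons, Fin.ext_iff, List.not_mem_nil, List.nodup_nil, or_false,
          not_false_eq_true, and_true, not_or]
        refine ⟨⟨?_, ?_, ?_⟩, ⟨?_, ?_⟩, ?_⟩ <;> omega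
      rw [hprod, ← mul_assoc, hcomm, mul_inv_rev, inv_inv, mul_inv_rev, sw_inv, sw_inv, mul_inv_eq_iff_eq_mul]
      ext1 x
      exact hσ' x
    refine ⟨L.map fun t => σ * t * σ⁻¹, σ, ?_, key L σ hLl hLs hconj, Or.inl ⟨hlt, hσ, rfl⟩⟩
    refine lamDet_of_sel F v w a b c L σ ?_ hconj (Or.inl rfl)
    intro z hz; rw [hσ, hz]; simp [sg]
  · push Not at hlt
    obtain ⟨σ, hσ, hσ'⟩ := exists_sigma (Qv F v a) (Qv F (w - 1) a) (Qv F v b) (Qv F (w - 1) c) hlt h3 h6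
    set L := (F.insertIdx v (Equiv.swap a b)).insertIdx w (Equiv.swap a c) with hL
    have hLs := ins_swaps F v w hvw hw' _ _ habs hacs l2
    have hLl := ins_length F v w hvw hw' (Equiv.swap a b) (Equiv.swap a c)
    have hconj : σ * prodLR L * σ⁻¹ = finRotate n := by
      rw [prod_reverse_swaps L hLs]
      have hprod : L.prod = Equiv.swap (Qv F v a) (Qv F v b) * (Equiv.swap (Qv F (w - 1) a) (Qv F (w - 1) c) * (finRotate n)⁻¹) := by
        ext y
        rw [hL, ins_prod F v w hvw hw', l3]; rfl
      rw [hprod, ← mul_assoc, mul_inv_rev, inv_inv, mul_inv_rev, sw_inv, sw_inv, mul_inv_eq_iff_eq_mul]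
      ext1 x
      exact hσ' x
    refine ⟨L.map fun t => σ * t * σ⁻¹, σ, ?_, key L σ hLl hLs hconj, Or.inr ⟨hlt, hσ, rfl⟩⟩
    refine lamDet_of_sel F v w a b c L σ ?_ hconj (Or.inr ⟨?_, rfl⟩)
    · intro z hz; rw [hσ, hz]; simp [sg]
    · have hLs' := ins_swaps F v w hvw hw' _ _ hacs habs l2
      rw [prod_reverse_swaps _ hLs']
      have hprod : ((F.insertIdx v (Equiv.swap a c)).insertIdx w (Equiv.swap a b)).prod =
          Equiv.swap (Qv F v a) (Qv F v c) * (Equiv.swap (Qv F (w - 1) a) (Qv F (w - 1) b) * (finRotate n)⁻¹) := by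
        ext y
        rw [ins_prod F v w hvw hw', l3]; rfl
      rw [hprod, ← mul_assoc, mul_inv_rev, inv_inv, mul_inv_rev, sw_inv, sw_inv]
      refine not_long_of_inv _ (fun z => z.val ≤ (Qv F v a).val ∨ (Qv F v c).val < z.val) ?_
        (Qv F v a) (Qv F v c) (Or.inl le_rfl) (by push Not; constructor <;> omega)
      intro z hz
      simp only [Equiv.Perm.mul_apply]
      have e1 := swap_val (Qv F v a) (Qv F v c) z
      generalize Equiv.swap (Qv F v a) (Qv F v c) z = z1 at *
      have e2 := swap_val (Qv F (w - 1) a) (Qv F (w - 1) b) z1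
      generalize Equiv.swap (Qv F (w - 1) a) (Qv F (w - 1) b) z1 = z2 at *
      have e3 := finRotate_val z2
      by_cases hza : z.val = (Qv F v a).val
      · rw [if_pos hza] at e1
        rw [if_neg (by omega), if_neg (by omega)] at e2
        split_ifs at e3 <;> omega
      · rw [if_neg hza, if_neg (by omega)] at e1
        rw [if_neg (by omega), if_neg (by omega)] at e2
        split_ifs at e3 <;> omega

end

section
set_option linter.unusedSectionVars false

structure Good {n : ℕ} (r : ℕ) (F : List (Equiv.Perm (Fin n))) (p : Param n) : Prop where
  ha : p.2.1 ∉ Bad r F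
  hb : p.2.2.1 ∉ Bad r F
  hc : p.2.2.2 ∉ Bad r F
  hD : Dn F p.2.1 ≤ 1
  h0 : p.2.1.val ≠ 0
  hab : p.2.1.val + 20 * r < p.2.2.1.val
  hbc : p.2.2.1.val + 20 * r < p.2.2.2.val

lemma not_bad {n : ℕ} {r : ℕ} {F : List (Equiv.Perm (Fin n))} {y : Fin n} (h : y ∉ Bad r F) (u : ℕ) :
    (Qv F u y).val ≤ y.val + r ∧ y.val ≤ (Qv F u y).val + r := by
  constructor
  · by_contra! H; exact h ⟨u, Or.inl H⟩
  · by_contra! H; exact h ⟨u, Or.inr H⟩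

def sw (x y z : ℕ) : ℕ := if z = x then y else if z = y then x else z

lemma sw_spec (x y z : ℕ) : (z = x ∧ sw x y z = y) ∨ (z ≠ x ∧ z = y ∧ sw x y z = x) ∨ (z ≠ x ∧ z ≠ y ∧ sw x y z = z) := by
  unfold sw; split_ifs <;> omega

section
variable {α δ β γ a b c r q : ℕ} (h1 : α ≤ δ) (h2 : δ < β) (h3 : β < γ)
  (ha1 : α ≤ a + r) (ha2 : a ≤ α + r) (hd1 : δ ≤ a + r) (hd2 : a ≤ δ + r)
  (hb1 : β ≤ b + r) (hb2 : b ≤ β + r) (hc1 : γ ≤ c + r) (hc2 : c ≤ γ + r)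
  (hab : a + 20 * r < b) (hbc : b + 20 * r < c) (hq1 : q ≤ a + r) (hq2 : a ≤ q + r)
include h1 h2 h3 ha1 ha2 hd1 hd2 hb1 hb2 hc1 hc2 hab hbc hq1 hq2

lemma segA1 (h : q ≤ α ∨ δ < q) : sg α δ β γ q + 15 * r < c := by
  have := sg_spec h1 h2 h3 q
  omega

lemma segA2 (h : α ≤ q ∧ q ≤ δ) : c ≤ sg α δ β γ (sw α β q) + 3 * r ∧ sg α δ β γ (sw α β q) ≤ c + 3 * r := by
  have := sg_spec h1 h2 h3 (sw α β q)
  have := sw_spec α β q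
  omega

lemma segA3 (h : δ ≤ q ∨ q < α) : sg α δ β γ (sw α β (sw δ γ q)) + 15 * r < c := by
  have e1 := sg_spec h1 h2 h3 (sw α β (sw δ γ q))
  have e2 := sw_spec α β (sw δ γ q)
  have e3 := sw_spec δ γ q
  generalize sw δ γ q = q1 at *
  generalize sw α β q1 = q2 at *
  generalize sg α δ β γ q2 = q3 at *
  rcases e3 with e3 | e3 | e3 <;> rcases e2 with e2 | e2 | e2 <;> omega

lemma segB1 (h : α < q ∧ q ≤ δ) : c ≤ sg α δ β γ q + 3 * r ∧ sg α δ β γ q ≤ c + 3 * r := by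
  have := sg_spec h1 h2 h3 q
  omega

lemma segB2 (h : q ≤ α ∨ δ ≤ q) (hlt : α < δ) : sg α δ β γ (sw δ γ q) + 15 * r < c := by
  have := sg_spec h1 h2 h3 (sw δ γ q)
  have := sw_spec δ γ q
  omega

lemma segB3 (h : α ≤ q ∧ q < δ) : c ≤ sg α δ β γ (sw δ γ (sw α β q)) + 3 * r ∧
    sg α δ β γ (sw δ γ (sw α β q)) ≤ c + 3 * r := by
  have e1 := sg_spec h1 h2 h3 (sw δ γ (sw α β q))
  have e2 := sw_spec δ γ (sw α β q)
  have e3 := sw_spec α β q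
  generalize sw α β q = q1 at *
  generalize sw δ γ q1 = q2 at *
  generalize sg α δ β γ q2 = q3 at *
  rcases e3 with e3 | e3 | e3 <;> rcases e2 with e2 | e2 | e2 <;> omega
end

lemma swap_val' {n : ℕ} (x y z : Fin n) : (Equiv.swap x y z).val = sw x y z := swap_val x y z

/-- description of the center -/
def Desc {n : ℕ} (r : ℕ) (a1 a2 v w c : ℕ) (x : List (Equiv.Perm (Fin n))) (j : Fin n) : Prop :=
  (a1 ≤ a2 ∧ ∀ u ≤ x.length,
    ((v < u ∧ u ≤ w) → c ≤ (Qv x u j).val + 3 * r ∧ (Qv x u j).val ≤ c + 3 * r) ∧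
    (¬ (v < u ∧ u ≤ w) → (Qv x u j).val + 15 * r < c)) ∨
  (a2 < a1 ∧ ∀ u ≤ x.length,
    (¬ (v < u ∧ u ≤ w) → c ≤ (Qv x u j).val + 3 * r ∧ (Qv x u j).val ≤ c + 3 * r) ∧
    ((v < u ∧ u ≤ w) → (Qv x u j).val + 15 * r < c))

lemma good_desc {n i r : ℕ} (F : List (Equiv.Perm (Fin n))) (hF : F ∈ FF n i) (v w : ℕ) (a b c : Fin n)
    (hvw : v < w) (hw : w < n - 1 + 2 * (i + 1)) (hg : Good r F ((v, w), (a, b, c)))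
    (x : List (Equiv.Perm (Fin n))) (σ : Equiv.Perm (Fin n)) (ho : Outcome F v w a b c x σ) :
    Desc r (Qv F v a).val (Qv F (w - 1) a).val v w c x (σ a) ∧ 2 ≤ Dn x (σ a) := by
  obtain ⟨hbada, hbadb, hbadc, hD, h0, hab, hbc⟩ := hg
  replace hbada : a ∉ Bad r F := hbada
  replace hbadb : b ∉ Bad r F := hbadb
  replace hbadc : c ∉ Bad r F := hbadc
  dsimp only at hD h0 hab hbc
  obtain ⟨l1, l2, l3⟩ := mem_FF.1 hF
  have hw' : w ≤ F.length + 1 := by omega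
  have q0 : (Qv F 0 a).val = a.val := by rw [Qv_zero]
  have qm : (Qv F F.length a).val = a.val - 1 := by
    rw [Qv_of_le F _ le_rfl, l3, finRotate_inv_val, if_neg h0]
  obtain ⟨k, hk, m1, m2⟩ := one_desc (fun u => (Qv F u a).val) F.length hD (by simp only [q0, qm]; omega)
  beta_reduce at m1 m2
  have up : ∀ u ≤ k, a.val ≤ (Qv F u a).val := fun u hu => by rw [← q0]; exact m1 0 u (Nat.zero_le _) hu
  have dn : ∀ u, k < u → u ≤ F.length → (Qv F u a).val < a.val := fun u h1 h2 => by
    have := m2 u F.length h1 h2 le_rfl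
    omega
  have A1 := not_bad hbada v
  have A2 := not_bad hbada (w - 1)
  have B1 := not_bad hbadb v
  have B2 := not_bad hbadb (w - 1)
  have C1 := not_bad hbadc v
  have C2 := not_bad hbadc (w - 1)
  rcases ho with ⟨hlt, hσ, hx⟩ | ⟨hle, hσ, hx⟩
  · have hxl : x.length = F.length + 2 := by rw [hx, List.length_map, ins_length F v w hvw hw']
    have hvk : v ≤ k := by
      by_contra! H
      have := m2 v (w - 1) H (by omega) (by omega)
      omega
    have hwk : k < w - 1 := by
      by_contra! H
      have := m1 v (w - 1) (by omega) H
      omega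
    have hE : ∀ u ≤ x.length, (¬ (v < u ∧ u ≤ w) → c ≤ (Qv x u (σ a)).val + 3 * r ∧ (Qv x u (σ a)).val ≤ c + 3 * r) ∧
        ((v < u ∧ u ≤ w) → (Qv x u (σ a)).val + 15 * r < c) := by
      intro u hu
      rcases le_or_gt u v with huv | huv
      · refine ⟨fun _ => ?_, fun h => by omega⟩
        rw [hx, Qv_conj, Q_ins1 F v w hvw hw' _ _ _ u huv, hσ]
        have N := not_bad hbada u
        have := m1 u v huv hvk
        have := up u (by omega)
        have := dn (w - 1) hwk (by omega)
        apply segB1 (a := a.val) (b := b.val) <;> omega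
      rcases le_or_gt u w with huw | huw
      · refine ⟨fun h => by omega, fun _ => ?_⟩
        rw [hx, Qv_conj, Q_ins2 F v w hvw hw' _ _ _ u huv huw, hσ, swap_val']
        have N := not_bad hbada (u - 1)
        have : (Qv F (u - 1) a).val ≤ (Qv F (w - 1) a).val ∨ (Qv F v a).val ≤ (Qv F (u - 1) a).val := by
          rcases le_or_gt (u - 1) k with h | h
          · right; exact m1 _ _ (by omega) h
          · left; exact m2 _ _ h (by omega) (by omega)
        apply segB2 (a := a.val) (b := b.val) <;> omega
      · refine ⟨fun _ => ?_, fun h => by omega⟩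
        rw [hx, Qv_conj, Q_ins3 F v w hvw hw' _ _ _ u huw, hσ, swap_val', swap_val']
        have N := not_bad hbada (u - 2)
        have := m2 (w - 1) (u - 2) (by omega) (by omega) (by omega)
        have := dn (u - 2) (by omega) (by omega)
        have := up v hvk
        apply segB3 (a := a.val) (b := b.val) <;> omega
    refine ⟨Or.inr ⟨hlt, hE⟩, ?_⟩
    have fv : c ≤ (Qv x v (σ a)).val + 3 * r := ((hE v (by omega)).1 (by omega)).1
    have fv1 := (hE (v + 1) (by omega)).2 (by omega)
    have fv1' : (Qv x (v + 1) (σ a)).val = sg (Qv F (w - 1) a) (Qv F v a) (Qv F (w - 1) b) (Qv F v c) (Qv F v c) := by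
      rw [hx, Qv_conj, Q_ins2 F v w hvw hw' _ _ _ (v + 1) (by omega) (by omega), hσ, swap_val']
      congr 1; simp [sw]
    have fw' : (Qv x w (σ a)).val = sg (Qv F (w - 1) a) (Qv F v a) (Qv F (w - 1) b) (Qv F v c) (Qv F (w - 1) a) := by
      rw [hx, Qv_conj, Q_ins2 F v w hvw hw' _ _ _ w (by omega) (by omega), hσ, swap_val']
      congr 1
      unfold sw; rw [if_neg (by omega), if_neg (by omega)]
    have s1 := sg_spec (α := (Qv F (w - 1) a)) (δ := (Qv F v a)) (β := (Qv F (w - 1) b)) (γ := (Qv F v c))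
      (by omega) (by omega) (by omega) (Qv F v c)
    have s2 := sg_spec (α := (Qv F (w - 1) a)) (δ := (Qv F v a)) (β := (Qv F (w - 1) b)) (γ := (Qv F v c))
      (by omega) (by omega) (by omega) (Qv F (w - 1) a)
    refine two_desc (fun u => (Qv x u (σ a)).val) x.length v (v + 1) (v + 1) w (by omega) (by omega) (by omega) (by omega) ?_ ?_
    · beta_reduce; omega
    · simp only [fv1', fw']; omega
  · have hxl : x.length = F.length + 2 := by rw [hx, List.length_map, ins_length F v w hvw hw']
    have hcase : w - 1 ≤ k ∨ k < v := by
      by_contra! H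
      have := up v H.2
      have := dn (w - 1) H.1 (by omega)
      omega
    have hE : ∀ u ≤ x.length, ((v < u ∧ u ≤ w) → c ≤ (Qv x u (σ a)).val + 3 * r ∧ (Qv x u (σ a)).val ≤ c + 3 * r) ∧
        (¬ (v < u ∧ u ≤ w) → (Qv x u (σ a)).val + 15 * r < c) := by
      intro u hu
      rcases le_or_gt u v with huv | huv
      · refine ⟨fun h => by omega, fun _ => ?_⟩
        rw [hx, Qv_conj, Q_ins1 F v w hvw hw' _ _ _ u huv, hσ]
        have N := not_bad hbada u
        have : (Qv F u a).val ≤ (Qv F v a).val ∨ (Qv F (w - 1) a).val < (Qv F u a).val := by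
          rcases hcase with h | h
          · left; exact m1 _ _ (by omega) (by omega)
          · rcases le_or_gt u k with h' | h'
            · right
              have := up u h'
              have := dn (w - 1) (by omega) (by omega)
              omega
            · left; exact m2 _ _ h' (by omega) (by omega)
        apply segA1 (a := a.val) (b := b.val) <;> omega
      rcases le_or_gt u w with huw | huw
      · refine ⟨fun _ => ?_, fun h => by omega⟩
        rw [hx, Qv_conj, Q_ins2 F v w hvw hw' _ _ _ u huv huw, hσ, swap_val']
        have N := not_bad hbada (u - 1)
        have : (Qv F v a).val ≤ (Qv F (u - 1) a).val ∧ (Qv F (u - 1) a).val ≤ (Qv F (w - 1) a).val := by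
          rcases hcase with h | h
          · exact ⟨m1 _ _ (by omega) (by omega), m1 _ _ (by omega) (by omega)⟩
          · exact ⟨m2 _ _ (by omega) (by omega) (by omega), m2 _ _ (by omega) (by omega) (by omega)⟩
        apply segA2 (a := a.val) (b := b.val) <;> omega
      · refine ⟨fun h => by omega, fun _ => ?_⟩
        rw [hx, Qv_conj, Q_ins3 F v w hvw hw' _ _ _ u huw, hσ, swap_val', swap_val']
        have N := not_bad hbada (u - 2)
        have : (Qv F (w - 1) a).val ≤ (Qv F (u - 2) a).val ∨ (Qv F (u - 2) a).val < (Qv F v a).val := by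
          rcases hcase with h | h
          · rcases le_or_gt (u - 2) k with h' | h'
            · left; exact m1 _ _ (by omega) (by omega)
            · right
              have := dn (u - 2) (by omega) (by omega)
              have := up v (by omega)
              omega
          · left; exact m2 _ _ (by omega) (by omega) (by omega)
        apply segA3 (a := a.val) (b := b.val) <;> omega
    refine ⟨Or.inl ⟨hle, hE⟩, ?_⟩
    have fw : c ≤ (Qv x w (σ a)).val + 3 * r := ((hE w (by omega)).1 (by omega)).1
    have fw1 := (hE (w + 1) (by omega)).2 (by omega)
    have SP : ∀ z, _ := fun z => sg_spec (α := (Qv F v a)) (δ := (Qv F (w - 1) a)) (β := (Qv F v b)) (γ := (Qv F (w - 1) c))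
      (by omega) (by omega) (by omega) z
    rcases hcase with hk1 | hk1
    · have fw1' : (Qv x (w + 1) (σ a)).val = sg (Qv F v a) (Qv F (w - 1) a) (Qv F v b) (Qv F (w - 1) c) (Qv F (w - 1) c) := by
        rw [hx, Qv_conj, Q_ins3 F v w hvw hw' _ _ _ (w + 1) (by omega), hσ, swap_val', swap_val']
        congr 1
        rw [show w + 1 - 2 = w - 1 by omega]
        unfold sw; rw [if_pos rfl, if_neg (by omega), if_neg (by omega)]
      have u0 := up v (by omega)
      have fe : (Qv x x.length (σ a)).val = sg (Qv F v a) (Qv F (w - 1) a) (Qv F v b) (Qv F (w - 1) c) (a - 1) := by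
        rw [hxl, hx, Qv_conj, Q_ins3 F v w hvw hw' _ _ _ (F.length + 2) (by omega), hσ, swap_val', swap_val']
        congr 1
        rw [show F.length + 2 - 2 = F.length by omega, qm]
        have uw := up (w - 1) hk1
        have t1 := sw_spec (Qv F (w - 1) a) (Qv F (w - 1) c) (a.val - 1)
        have t2 := sw_spec (Qv F v a) (Qv F v b) (sw (Qv F (w - 1) a) (Qv F (w - 1) c) (a.val - 1))
        omega
      have s1 := SP (Qv F (w - 1) c)
      have s2 := SP (a - 1)
      refine two_desc (fun u => (Qv x u (σ a)).val) x.length w (w + 1) (w + 1) x.length (by omega) (by omega) (by omega) (by omega) ?_ ?_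
      · beta_reduce; omega
      · simp only [fw1', fe]; omega
    · have f0 : (Qv x 0 (σ a)).val = sg (Qv F v a) (Qv F (w - 1) a) (Qv F v b) (Qv F (w - 1) c) a := by
        rw [hx, Qv_conj, Q_ins1 F v w hvw hw' _ _ _ 0 (by omega), hσ, q0]
      have fv : (Qv x v (σ a)).val = sg (Qv F v a) (Qv F (w - 1) a) (Qv F v b) (Qv F (w - 1) c) (Qv F v a) := by
        rw [hx, Qv_conj, Q_ins1 F v w hvw hw' _ _ _ v (by omega), hσ]
      have s1 := SP a
      have s2 := SP (Qv F v a)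
      have := dn (w - 1) (by omega) (by omega)
      refine two_desc (fun u => (Qv x u (σ a)).val) x.length 0 v w (w + 1) (by omega) (by omega) (by omega) (by omega) ?_ ?_
      · simp only [f0, fv]; omega
      · beta_reduce; omega

end

section

lemma desc_gam {n : ℕ} {r a1 a2 v w c : ℕ} {x : List (Equiv.Perm (Fin n))} {j : Fin n}
    (h : Desc r a1 a2 v w c x j) (hvw : v < w) (hw : w < x.length) :
    (a1 ≤ a2 ∧ ∀ u ≤ x.length, ((∀ u' ≤ x.length, (Qv x u' j).val ≤ (Qv x u j).val + 10 * r) ↔ (v < u ∧ u ≤ w))) ∨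
    (a2 < a1 ∧ ∀ u ≤ x.length, ((∀ u' ≤ x.length, (Qv x u' j).val ≤ (Qv x u j).val + 10 * r) ↔ ¬ (v < u ∧ u ≤ w))) := by
  rcases h with ⟨h, H⟩ | ⟨h, H⟩
  · left
    refine ⟨h, fun u hu => ⟨fun K => ?_, fun K u' hu' => ?_⟩⟩
    · by_contra hc
      have := (H u hu).2 hc
      have := K w hw.le
      have := (H w hw.le).1 (by omega)
      omega
    · have := (H u hu).1 K
      by_cases h3 : v < u' ∧ u' ≤ w
      · have := (H u' hu').1 h3
        omega
      · have := (H u' hu').2 h3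
        omega
  · right
    refine ⟨h, fun u hu => ⟨fun K => ?_, fun K u' hu' => ?_⟩⟩
    · intro hc
      have := (H u hu).2 hc
      have := K 0 (by omega)
      have := (H 0 (by omega)).1 (by omega)
      omega
    · have := (H u hu).1 K
      by_cases h3 : v < u' ∧ u' ≤ w
      · have := (H u' hu').2 h3
        omega
      · have := (H u' hu').1 h3
        omega

lemma desc_inj {n : ℕ} {r a1 a2 v w c a1' a2' v' w' c' : ℕ} {x : List (Equiv.Perm (Fin n))} {j : Fin n}
    (h : Desc r a1 a2 v w c x j) (hvw : v < w) (hw : w < x.length)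
    (h' : Desc r a1' a2' v' w' c' x j) (hvw' : v' < w') (hw' : w' < x.length) :
    (a1 ≤ a2 ↔ a1' ≤ a2') ∧ v = v' ∧ w = w' := by
  have key : ∀ u ≤ x.length, ∀ u' ≤ x.length, True := fun _ _ _ _ => trivial
  rcases desc_gam h hvw hw with ⟨g, H⟩ | ⟨g, H⟩ <;> rcases desc_gam h' hvw' hw' with ⟨g', H'⟩ | ⟨g', H'⟩
  all_goals
    have K := fun u hu => (H u hu).symm.trans (H' u hu)
    have k0 := K 0 (by omega)
    have k1 := K v (by omega)
    have k2 := K (v + 1) (by omega)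
    have k3 := K w (by omega)
    have k4 := K (w + 1) (by omega)
    have k5 := K v' (by omega)
    have k6 := K (v' + 1) (by omega)
    have k7 := K w' (by omega)
    have k8 := K (w' + 1) (by omega)
    clear K H H'
    refine ⟨?_, ?_, ?_⟩ <;> omega

lemma ins_map_inj {β γ : Type*} (f f' : β → γ) (F F' : List β) (v w : ℕ) (hvw : v < w)
    (hl : F.length = F'.length) (hw : w ≤ F.length + 1) (s1 s2 s1' s2' : β)
    (h : ((F.insertIdx v s1).insertIdx w s2).map f = ((F'.insertIdx v s1').insertIdx w s2').map f') :
    F.map f = F'.map f' ∧ f s1 = f' s1' ∧ f s2 = f' s2' := by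
  obtain ⟨X, Y, Z, hF, hX, hY, e⟩ := ins_decomp F v w hvw hw
  obtain ⟨X', Y', Z', hF', hX', hY', e'⟩ := ins_decomp F' v w hvw (by omega)
  rw [e, e'] at h
  simp only [List.map_append, List.map_cons] at h
  have h1 := List.append_inj h (by simp [hX, hX'])
  have h2 := List.cons.inj h1.2
  have h3 := List.append_inj h2.2 (by simp; omega)
  have h4 := List.cons.inj h3.2
  refine ⟨?_, h2.1, h4.1⟩
  rw [hF, hF']
  simp [h1.1, h3.1, h4.2]

lemma map_conj_inj {n i : ℕ} (F F' : List (Equiv.Perm (Fin n))) (hF : F ∈ FF n i) (hF' : F' ∈ FF n i)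
    (σ σ' : Equiv.Perm (Fin n)) (hσ0 : ∀ z : Fin n, z.val = 0 → (σ z).val = 0)
    (hσ0' : ∀ z : Fin n, z.val = 0 → (σ' z).val = 0)
    (h : F.map (fun t => σ * t * σ⁻¹) = F'.map (fun t => σ' * t * σ'⁻¹)) : σ = σ' ∧ F = F' := by
  have hp := congrArg List.prod h
  rw [prod_map_conj, prod_map_conj, (mem_FF.1 hF).2.2, (mem_FF.1 hF').2.2] at hp
  have hσ : σ'⁻¹ * σ = 1 := by
    apply comm_fix
    · intro x
      have : (σ'⁻¹ * σ) * finRotate n = finRotate n * (σ'⁻¹ * σ) := by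
        have h2 := congrArg (fun t => σ'⁻¹ * t⁻¹ * σ) hp
        simp only [mul_inv_rev, inv_inv, mul_assoc, inv_mul_cancel, mul_one, inv_mul_cancel_left] at h2
        simpa [mul_assoc] using h2
      exact congrArg (fun t => t x) this
    · intro z hz
      rw [Equiv.Perm.mul_apply]
      have e : σ z = σ' z := by ext; rw [hσ0 z hz, hσ0' z hz]
      rw [e]; simpa using hz
  have hs : σ = σ' := (inv_mul_eq_one.1 hσ).symm
  subst hs
  refine ⟨rfl, ?_⟩
  refine List.map_injective_iff.2 ?_ h
  intro s t hst
  simpa using hst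

lemma swap_left_inj {n : ℕ} {a b b' : Fin n} (h : Equiv.swap a b = Equiv.swap a b') : b = b' := by
  have := congrArg (fun t => t a) h
  simpa using this

lemma outcome_zero {n : ℕ} {F : List (Equiv.Perm (Fin n))} {v w : ℕ} {a b c : Fin n}
    {x : List (Equiv.Perm (Fin n))} {σ : Equiv.Perm (Fin n)} (h : Outcome F v w a b c x σ) :
    ∀ z : Fin n, z.val = 0 → (σ z).val = 0 := by
  intro z hz
  rcases h with ⟨_, h, _⟩ | ⟨_, h, _⟩ <;> rw [h, hz] <;> simp [sg]

lemma good_inj {n i r : ℕ} (F F' : List (Equiv.Perm (Fin n))) (hF : F ∈ FF n i) (hF' : F' ∈ FF n i)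
    (v w v' w' : ℕ) (a b c a' b' c' : Fin n)
    (hvw : v < w) (hw : w < n - 1 + 2 * (i + 1)) (hg : Good r F ((v, w), (a, b, c)))
    (hvw' : v' < w') (hw' : w' < n - 1 + 2 * (i + 1)) (hg' : Good r F' ((v', w'), (a', b', c')))
    (x : List (Equiv.Perm (Fin n))) (σ σ' : Equiv.Perm (Fin n)) (ho : Outcome F v w a b c x σ)
    (ho' : Outcome F' v' w' a' b' c' x σ') (hj : σ a = σ' a') :
    F = F' ∧ v = v' ∧ w = w' ∧ a = a' ∧ b = b' ∧ c = c' := by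
  have l1 := (mem_FF.1 hF).1
  have l1' := (mem_FF.1 hF').1
  have D := (good_desc F hF v w a b c hvw hw hg x σ ho).1
  have D' := (good_desc F' hF' v' w' a' b' c' hvw' hw' hg' x σ' ho').1
  have hxl : x.length = F.length + 2 := by
    rcases ho with ⟨_, _, h⟩ | ⟨_, _, h⟩ <;>
    rw [h, List.length_map, ins_length F v w hvw (by omega)]
  rw [← hj] at D'
  obtain ⟨hc, rfl, rfl⟩ := desc_inj D hvw (by omega) D' hvw' (by omega)
  have z := outcome_zero ho
  have z' := outcome_zero ho'
  rcases ho with ⟨t, _, hx⟩ | ⟨t, _, hx⟩ <;> rcases ho' with ⟨t', _, hx'⟩ | ⟨t', _, hx'⟩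
  · rw [hx] at hx'
    obtain ⟨e1, e2, e3⟩ := ins_map_inj _ _ F F' v w hvw (by omega) (by omega) _ _ _ _ hx'
    obtain ⟨rfl, rfl⟩ := map_conj_inj F F' hF hF' σ σ' z z' e1
    obtain rfl := σ.injective hj
    simp only [mul_left_inj, mul_right_inj] at e2 e3
    exact ⟨rfl, rfl, rfl, rfl, swap_left_inj e3, swap_left_inj e2⟩
  · omega
  · omega
  · rw [hx] at hx'
    obtain ⟨e1, e2, e3⟩ := ins_map_inj _ _ F F' v w hvw (by omega) (by omega) _ _ _ _ hx'
    obtain ⟨rfl, rfl⟩ := map_conj_inj F F' hF hF' σ σ' z z' e1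
    obtain rfl := σ.injective hj
    simp only [mul_left_inj, mul_right_inj] at e2 e3
    exact ⟨rfl, rfl, rfl, rfl, swap_left_inj e2, swap_left_inj e3⟩

open scoped Classical in
/-- finset of valid parameters -/
noncomputable def PF (n i : ℕ) : Finset (Param n) :=
  ((Finset.range (n - 1 + 2 * i) ×ˢ Finset.range (n - 1 + 2 * i)) ×ˢ Finset.univ).filter (paramOK n i)

lemma mem_PF {n i : ℕ} {p : Param n} : p ∈ PF n i ↔ paramOK n i p := by
  classical
  rw [PF, Finset.mem_filter, Finset.mem_product, Finset.mem_product]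
  simp only [Finset.mem_range, Finset.mem_univ, and_true, and_iff_right_iff_imp]
  intro h
  exact ⟨h.1.trans h.2.1, h.2.1⟩

lemma good_out {n i r : ℕ} (F : List (Equiv.Perm (Fin n))) (hF : F ∈ FF n i) (p : Param n)
    (hp : p ∈ PF n (i + 1)) (hg : Good r F p) :
    ∃ x σ, lamDet n F p = some x ∧ x ∈ FF n (i + 1) ∧ Outcome F p.1.1 p.1.2 p.2.1 p.2.2.1 p.2.2.2 x σ := by
  obtain ⟨⟨v, w⟩, a, b, c⟩ := p
  obtain ⟨h1, h2, h3, h4⟩ := mem_PF.1 hp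
  obtain ⟨hbada, hbadb, hbadc, hD, h0, hab, hbc⟩ := hg
  replace hbada : a ∉ Bad r F := hbada
  replace hbadb : b ∉ Bad r F := hbadb
  replace hbadc : c ∉ Bad r F := hbadc
  dsimp only at *
  have A1 := not_bad hbada v
  have A2 := not_bad hbada (w - 1)
  have B1 := not_bad hbadb v
  have B2 := not_bad hbadb (w - 1)
  have C1 := not_bad hbadc v
  have C2 := not_bad hbadc (w - 1)
  exact lam_good F hF v w a b c h1 h2 h3.ne (h3.trans h4).ne (by omega) (by omega) (by omega) (by omega)
    (by omega) (by omega) (by omega) (by omega)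

open scoped Classical in
lemma fiber_card {n i r : ℕ} (hn : 1 ≤ n) (x : List (Equiv.Perm (Fin n))) :
    ((FF n i ×ˢ PF n (i + 1)).filter
      (fun q => Good r q.1 q.2 ∧ lamDet n q.1 q.2 = some x)).card ≤ 2 * (i + 1) := by
  by_cases hx : x ∈ FF n (i + 1)
  · have key : ∀ q : List (Equiv.Perm (Fin n)) × Param n, q ∈ (FF n i ×ˢ PF n (i + 1)).filter
      (fun q => Good r q.1 q.2 ∧ lamDet n q.1 q.2 = some x) →
        ∃ σ, Outcome q.1 q.2.1.1 q.2.1.2 q.2.2.1 q.2.2.2.1 q.2.2.2.2 x σ := by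
      intro q hq
      simp only [Finset.mem_filter, Finset.mem_product] at hq
      obtain ⟨⟨h1, h2⟩, h3, h4⟩ := hq
      obtain ⟨y, σ, e, _, ho⟩ := good_out q.1 h1 q.2 h2 h3
      rw [h4] at e
      obtain rfl := Option.some.inj e
      exact ⟨σ, ho⟩
    choose! S hS using key
    refine le_trans (Finset.card_le_card_of_injOn (fun q => S q q.2.2.1) ?_ ?_) (card_multi hn x hx)
    · intro q hq
      have ho := hS q hq
      simp only [Finset.coe_filter, Finset.mem_product, Set.mem_ofPred_eq] at hq
      obtain ⟨⟨h1, h2⟩, h3, h4⟩ := hq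
      have h2' := mem_PF.1 h2
      simp only [Finset.coe_filter, Finset.mem_univ, true_and, Set.mem_ofPred_eq]
      refine ⟨?_, (good_desc q.1 h1 _ _ _ _ _ h2'.1 h2'.2.1 h3 x _ ho).2⟩
      intro h
      have hz := outcome_zero ho ⟨0, hn⟩ rfl
      have : (S q) q.2.2.1 = S q ⟨0, hn⟩ := by ext; rw [h, hz]
      exact h3.h0 (by rw [(S q).injective this])
    · intro q hq q' hq' hj
      have ho := hS q hq
      have ho' := hS q' hq'
      simp only [Finset.coe_filter, Finset.mem_product, Set.mem_ofPred_eq] at hq hq'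
      obtain ⟨⟨h1, h2⟩, h3, h4⟩ := hq
      obtain ⟨⟨h1', h2'⟩, h3', h4'⟩ := hq'
      obtain ⟨F, ⟨v, w⟩, a, b, c⟩ := q
      obtain ⟨F', ⟨v', w'⟩, a', b', c'⟩ := q'
      obtain ⟨k1, k2, -⟩ := mem_PF.1 h2
      obtain ⟨k1', k2', -⟩ := mem_PF.1 h2'
      have := good_inj F F' h1 h1' v w v' w' a b c a' b' c' k1 k2 h3 k1' k2' h3' x _ _ ho ho' hj
      obtain ⟨rfl, rfl, rfl, rfl, rfl, rfl⟩ := this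
      rfl
  · rw [Finset.card_eq_zero.2]
    · exact Nat.zero_le _
    · rw [Finset.filter_eq_empty_iff]
      rintro q hq ⟨h3, h4⟩
      rw [Finset.mem_product] at hq
      obtain ⟨y, σ, e, hy, -⟩ := good_out q.1 hq.1 q.2 hq.2 h3
      rw [h4] at e
      obtain rfl := Option.some.inj e
      exact hx hy

end

section

def nearSet (n r : ℕ) (a : Fin n) : Set (Fin n) := {y | y.val ≤ a.val + 2 * r ∧ a.val ≤ y.val + 2 * r}

lemma nearSet_card (n r : ℕ) (a : Fin n) : (nearSet n r a).ncard ≤ 4 * r + 1 := by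
  have h : (nearSet n r a).ncard ≤ (Set.Icc (a.val - 2 * r) (a.val + 2 * r)).ncard := by
    refine Set.ncard_le_ncard_of_injOn (fun y => y.val) ?_ ?_ (Set.toFinite _)
    · intro y hy
      have h1 := hy.1
      have h2 := hy.2
      simp only [Set.mem_Icc]; omega
    · intro x _ y _ h; exact Fin.ext h
  refine h.trans ?_
  rw [← Finset.coe_Icc, Set.ncard_coe_finset, Nat.card_Icc]; omega

lemma sg_near {α δ β γ a b c r q y : ℕ} (h1 : α ≤ δ) (h2 : δ < β) (h3 : β < γ)
  (ha1 : α ≤ a + r) (ha2 : a ≤ α + r) (hd1 : δ ≤ a + r) (hd2 : a ≤ δ + r)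
  (hb1 : β ≤ b + r) (hb2 : b ≤ β + r) (hc1 : γ ≤ c + r) (hc2 : c ≤ γ + r)
  (hq1 : q ≤ y + r) (hq2 : y ≤ q + r) (na : a + 2 * r < y ∨ y + 2 * r < a)
  (nb : b + 2 * r < y ∨ y + 2 * r < b) (nc : c + 2 * r < y ∨ y + 2 * r < c) :
    sg α δ β γ q ≤ sg α δ β γ y + r ∧ sg α δ β γ y ≤ sg α δ β γ q + r := by
  have e1 := sg_spec h1 h2 h3 q
  have e2 := sg_spec h1 h2 h3 y
  rcases na with na | na <;> rcases nb with nb | nb <;> rcases nc with nc | nc <;> omega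

lemma near_swap {n : ℕ} (F : List (Equiv.Perm (Fin n))) (r u u' : ℕ) (a b y : Fin n) (ha : a ∉ Bad r F)
    (hb : b ∉ Bad r F) (hy : y ∉ Bad r F) (na : y ∉ nearSet n r a) (nb : y ∉ nearSet n r b) :
    Equiv.swap (Qv F u a) (Qv F u b) (Qv F u' y) = Qv F u' y := by
  have h1 := not_bad ha u
  have h2 := not_bad hb u
  have h3 := not_bad hy u'
  simp only [nearSet, Set.mem_ofPred_eq] at na nb
  apply Equiv.swap_apply_of_ne_of_ne <;> rw [Ne, Fin.ext_iff] <;> omega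

lemma bad_step {n i r : ℕ} (F : List (Equiv.Perm (Fin n))) (hF : F ∈ FF n i) (p : Param n)
    (hp : p ∈ PF n (i + 1)) (hg : Good r F p) (x : List (Equiv.Perm (Fin n))) (hx : lamDet n F p = some x) :
    (Bad r x).ncard ≤ (Bad r F).ncard + 3 * (4 * r + 1) := by
  obtain ⟨x', σ, e, -, ho⟩ := good_out F hF p hp hg
  rw [hx] at e
  obtain rfl := Option.some.inj e
  obtain ⟨⟨v, w⟩, a, b, c⟩ := p
  have l1 := (mem_FF.1 hF).1
  obtain ⟨h1, h2, -⟩ := mem_PF.1 hp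
  obtain ⟨hbada, hbadb, hbadc, hD, h0, hab, hbc⟩ := hg
  replace hbada : a ∉ Bad r F := hbada
  replace hbadb : b ∉ Bad r F := hbadb
  replace hbadc : c ∉ Bad r F := hbadc
  dsimp only at *
  have hw' : w ≤ F.length + 1 := by omega
  have A1 := not_bad hbada v
  have A2 := not_bad hbada (w - 1)
  have B1 := not_bad hbadb v
  have B2 := not_bad hbadb (w - 1)
  have C1 := not_bad hbadc v
  have C2 := not_bad hbadc (w - 1)
  have key : ∀ y : Fin n, y ∉ Bad r F → y ∉ nearSet n r a → y ∉ nearSet n r b → y ∉ nearSet n r c → σ y ∉ Bad r x := by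
    intro y hy na nb nc
    have na' := na
    have nb' := nb
    have nc' := nc
    simp only [nearSet, Set.mem_ofPred_eq] at na' nb' nc'
    rintro ⟨u, hu⟩
    have main : ∃ u', Qv x u (σ y) = σ (Qv F u' y) := by
      rcases ho with ⟨_, _, hx⟩ | ⟨_, _, hx⟩
      · rcases le_or_gt u v with huv | huv
        · exact ⟨u, by rw [hx, Qv_conj, Q_ins1 F v w h1 hw' _ _ _ u huv]⟩
        rcases le_or_gt u w with huw | huw
        · exact ⟨u - 1, by rw [hx, Qv_conj, Q_ins2 F v w h1 hw' _ _ _ u huv huw,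
            near_swap F r v _ a c y hbada hbadc hy na nc]⟩
        · exact ⟨u - 2, by rw [hx, Qv_conj, Q_ins3 F v w h1 hw' _ _ _ u huw,
            near_swap F r _ _ a b y hbada hbadb hy na nb, near_swap F r _ _ a c y hbada hbadc hy na nc]⟩
      · rcases le_or_gt u v with huv | huv
        · exact ⟨u, by rw [hx, Qv_conj, Q_ins1 F v w h1 hw' _ _ _ u huv]⟩
        rcases le_or_gt u w with huw | huw
        · exact ⟨u - 1, by rw [hx, Qv_conj, Q_ins2 F v w h1 hw' _ _ _ u huv huw,
            near_swap F r v _ a b y hbada hbadb hy na nb]⟩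
        · exact ⟨u - 2, by rw [hx, Qv_conj, Q_ins3 F v w h1 hw' _ _ _ u huw,
            near_swap F r _ _ a c y hbada hbadc hy na nc, near_swap F r _ _ a b y hbada hbadb hy na nb]⟩
    obtain ⟨u', hu'⟩ := main
    rw [hu'] at hu
    have N := not_bad hy u'
    rcases ho with ⟨ht, hσ, _⟩ | ⟨ht, hσ, _⟩
    · rw [hσ, hσ] at hu
      have := sg_near (r := r) (α := Qv F (w - 1) a) (δ := Qv F v a) (β := Qv F (w - 1) b) (γ := Qv F v c)
        (a := a) (b := b) (c := c) (q := Qv F u' y) (y := y) (by omega) (by omega) (by omega) (by omega)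
        (by omega) (by omega) (by omega) (by omega) (by omega) (by omega) (by omega) (by omega) (by omega) (by omega)
        (by omega) (by omega)
      omega
    · rw [hσ, hσ] at hu
      have := sg_near (r := r) (α := Qv F v a) (δ := Qv F (w - 1) a) (β := Qv F v b) (γ := Qv F (w - 1) c)
        (a := a) (b := b) (c := c) (q := Qv F u' y) (y := y) (by omega) (by omega) (by omega) (by omega)
        (by omega) (by omega) (by omega) (by omega) (by omega) (by omega) (by omega) (by omega) (by omega) (by omega)
        (by omega) (by omega)
      omega
  have sub : Bad r x ⊆ σ '' (Bad r F ∪ (nearSet n r a ∪ (nearSet n r b ∪ nearSet n r c))) := by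
    intro z hz
    refine ⟨σ⁻¹ z, ?_, by simp⟩
    by_contra H
    simp only [Set.mem_union, not_or] at H
    have := key (σ⁻¹ z) H.1 H.2.1 H.2.2.1 H.2.2.2
    rw [show σ (σ⁻¹ z) = z by simp] at this
    exact this hz
  have c1 := Set.ncard_le_ncard sub (Set.toFinite _)
  have c2 := Set.ncard_image_le (f := σ) (Set.toFinite (Bad r F ∪ (nearSet n r a ∪ (nearSet n r b ∪ nearSet n r c))))
  have c3 := Set.ncard_union_le (Bad r F) (nearSet n r a ∪ (nearSet n r b ∪ nearSet n r c))
  have c4 := Set.ncard_union_le (nearSet n r a) (nearSet n r b ∪ nearSet n r c)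
  have c5 := Set.ncard_union_le (nearSet n r b) (nearSet n r c)
  have := nearSet_card n r a
  have := nearSet_card n r b
  have := nearSet_card n r c
  omega

end

section

def WF (m : ℕ) : Finset (ℕ × ℕ) := (Finset.range m ×ˢ Finset.range m).filter (fun q => q.1 < q.2)

def TF (n : ℕ) : Finset (Fin n × Fin n × Fin n) := Finset.univ.filter (fun q => q.1 < q.2.1 ∧ q.2.1 < q.2.2)

lemma PF_eq (n i : ℕ) : PF n i = WF (n - 1 + 2 * i) ×ˢ TF n := by
  ext ⟨⟨v, w⟩, a, b, c⟩
  rw [mem_PF]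
  simp only [paramOK, WF, TF, Finset.mem_product, Finset.mem_filter, Finset.mem_range, Finset.mem_univ, true_and]
  constructor
  · rintro ⟨h1, h2, h3, h4⟩; exact ⟨⟨⟨h1.trans h2, h2⟩, h1⟩, h3, h4⟩
  · rintro ⟨⟨⟨h1, h2⟩, h5⟩, h3, h4⟩; exact ⟨h5, h2, h3, h4⟩

lemma card_WF_ge (m : ℕ) : m.choose 2 ≤ (WF m).card := by
  rw [← Finset.card_range m, ← Finset.card_powersetCard, Finset.card_range]
  refine Finset.card_le_card_of_surjOn (fun q => {q.1, q.2}) ?_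
  intro s hs
  rw [Finset.mem_coe, Finset.mem_powersetCard] at hs
  obtain ⟨hs, hc⟩ := hs
  obtain ⟨x, y, hxy, rfl⟩ := Finset.card_eq_two.1 hc
  have hx := hs (show x ∈ ({x, y} : Finset ℕ) by simp)
  have hy := hs (show y ∈ ({x, y} : Finset ℕ) by simp)
  rcases lt_or_gt_of_ne hxy with h | h
  · exact ⟨(x, y), by simp only [WF, Finset.coe_filter, Finset.mem_product, Set.mem_ofPred_eq]; exact ⟨⟨hx, hy⟩, h⟩, rfl⟩
  · exact ⟨(y, x), by simp only [WF, Finset.coe_filter, Finset.mem_product, Set.mem_ofPred_eq]; exact ⟨⟨hy, hx⟩, h⟩,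
      Finset.pair_comm _ _⟩

lemma card_TF_ge (n : ℕ) : n.choose 3 ≤ (TF n).card := by
  rw [← Finset.card_fin n, ← Finset.card_powersetCard, Finset.card_fin]
  refine Finset.card_le_card_of_surjOn (fun q => {q.1, q.2.1, q.2.2}) ?_
  intro s hs
  rw [Finset.mem_coe, Finset.mem_powersetCard] at hs
  obtain ⟨hs, hc⟩ := hs
  have := s.orderIsoOfFin hc
  let f := s.orderEmbOfFin hc
  refine ⟨(f 0, f 1, f 2), ?_, ?_⟩
  · simp only [TF, Finset.coe_filter, Finset.mem_univ, true_and, Set.mem_ofPred_eq]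
    exact ⟨f.strictMono (by decide), f.strictMono (by decide)⟩
  · have h := Finset.range_orderEmbOfFin s hc
    apply Finset.coe_injective
    rw [← h]
    ext z
    simp only [Finset.coe_insert, Finset.coe_singleton, Set.mem_insert_iff, Set.mem_singleton_iff, Set.mem_range]
    constructor
    · rintro (h | h | h)
      · exact ⟨0, h.symm⟩
      · exact ⟨1, h.symm⟩
      · exact ⟨2, h.symm⟩
    · rintro ⟨k, rfl⟩
      fin_cases k
      · left; rfl
      · right; left; rfl
      · right; right; rfl

lemma card_close (n R : ℕ) : ((Finset.univ : Finset (Fin n × Fin n)).filter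
    (fun q => q.1 < q.2 ∧ q.2.val ≤ q.1.val + R)).card ≤ n * R := by
  have : ((Finset.univ : Finset (Fin n × Fin n)).filter
    (fun q => q.1 < q.2 ∧ q.2.val ≤ q.1.val + R)).card ≤ ((Finset.univ : Finset (Fin n)) ×ˢ Finset.range R).card := by
    refine Finset.card_le_card_of_injOn (fun q => (q.1, q.2.val - q.1.val - 1)) ?_ ?_
    · rintro ⟨a, b⟩ h
      simp only [Finset.coe_filter, Finset.mem_univ, true_and, Set.mem_ofPred_eq, Fin.lt_def] at h
      simp only [Finset.coe_product, Set.mem_prod, Finset.coe_univ, Set.mem_univ, true_and, Finset.coe_range, Set.mem_Iio]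
      omega
    · rintro ⟨a, b⟩ h ⟨a', b'⟩ h' e
      simp only [Finset.coe_filter, Finset.mem_univ, true_and, Set.mem_ofPred_eq, Fin.lt_def] at h h'
      simp only [Prod.mk.injEq] at e ⊢
      obtain ⟨rfl, e⟩ := e
      exact ⟨rfl, by ext; omega⟩
  simpa using this

open scoped Classical in
lemma card_notgood {n i r s : ℕ} (hn : 1 ≤ n) (F : List (Equiv.Perm (Fin n))) (hF : F ∈ FF n i)
    (hs : (Bad r F).ncard ≤ s) :
    ((PF n (i + 1)).filter (fun p => ¬ Good r F p)).card ≤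
      (WF (n - 1 + 2 * (i + 1))).card * ((3 * s + 2 * i + 1 + 40 * r) * n ^ 2) := by
  let B : Finset (Fin n) := (Bad r F).toFinset
  have hB : B.card ≤ s := by
    rw [← Set.ncard_eq_toFinset_card']; exact hs
  let D := (Finset.univ : Finset (Fin n)).filter (fun y => y.val ≠ 0 ∧ 2 ≤ Dn F y)
  have hD : D.card ≤ 2 * i := card_multi hn F hF
  let C := (Finset.univ : Finset (Fin n × Fin n)).filter (fun q => q.1 < q.2 ∧ q.2.val ≤ q.1.val + 20 * r)
  have hC : C.card ≤ n * (20 * r) := card_close n _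
  let U : Finset (Fin n) := Finset.univ
  let T1 : Finset (Fin n × Fin n × Fin n) := (B ∪ D ∪ {⟨0, hn⟩}) ×ˢ U ×ˢ U
  let T2 : Finset (Fin n × Fin n × Fin n) := U ×ˢ B ×ˢ U
  let T3 : Finset (Fin n × Fin n × Fin n) := U ×ˢ U ×ˢ B
  let T4 : Finset (Fin n × Fin n × Fin n) := U ×ˢ C
  let T5 : Finset (Fin n × Fin n × Fin n) := (C ×ˢ U).image (fun q => (q.1.1, q.1.2, q.2))
  have sub : (PF n (i + 1)).filter (fun p => ¬ Good r F p) ⊆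
      WF (n - 1 + 2 * (i + 1)) ×ˢ (T1 ∪ T2 ∪ T3 ∪ T4 ∪ T5) := by
    rintro ⟨⟨v, w⟩, a, b, c⟩ h
    rw [Finset.mem_filter, PF_eq, Finset.mem_product] at h
    obtain ⟨⟨h1, h2⟩, h3⟩ := h
    rw [Finset.mem_product]
    refine ⟨h1, ?_⟩
    simp only [TF, Finset.mem_filter, Finset.mem_univ, true_and] at h2
    by_contra H
    apply h3
    simp only [T1, T2, T3, T4, T5, U, Finset.mem_union, Finset.mem_product, Finset.mem_univ, Finset.mem_image, and_true, true_and,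
      not_or, Finset.mem_singleton] at H
    obtain ⟨⟨⟨⟨⟨⟨H1, H2⟩, H3⟩, H4⟩, H5⟩, H6⟩, H7⟩ := H
    simp only [B, Set.mem_toFinset] at H1 H4 H5
    have h0 : a.val ≠ 0 := fun h => H3 (Fin.ext h)
    simp only [D, Finset.mem_filter, Finset.mem_univ, true_and, not_and] at H2
    simp only [C, Finset.mem_filter, Finset.mem_univ, true_and, not_and] at H6
    have H7' : ¬ (b.val ≤ a.val + 20 * r) := fun h => H7 ⟨((a, b), c),
      Finset.mem_filter.2 ⟨Finset.mem_univ _, h2.1, h⟩, rfl⟩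
    have := H2 h0
    have := H6 h2.2
    exact ⟨H1, H4, H5, by dsimp only; omega, h0, by dsimp only; omega, by dsimp only; omega⟩
  refine (Finset.card_le_card sub).trans ?_
  rw [Finset.card_product]
  refine Nat.mul_le_mul_left _ ?_
  have e1 : T1.card ≤ (s + 2 * i + 1) * n ^ 2 := by
    simp only [T1, Finset.card_product, U, Finset.card_fin]
    have := Finset.card_union_le (B ∪ D) {(⟨0, hn⟩ : Fin n)}
    have := Finset.card_union_le B D
    rw [Finset.card_singleton] at *
    rw [pow_two]
    exact Nat.mul_le_mul_right _ (by omega)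
  have e2 : T2.card ≤ s * n ^ 2 := by
    simp only [T2, Finset.card_product, U, Finset.card_fin]
    calc n * (B.card * n) = B.card * n ^ 2 := by ring
      _ ≤ _ := Nat.mul_le_mul_right _ hB
  have e3 : T3.card ≤ s * n ^ 2 := by
    simp only [T3, Finset.card_product, U, Finset.card_fin]
    calc n * (n * B.card) = B.card * n ^ 2 := by ring
      _ ≤ _ := Nat.mul_le_mul_right _ hB
  have e4 : T4.card ≤ 20 * r * n ^ 2 := by
    simp only [T4, Finset.card_product, U, Finset.card_fin]
    calc n * C.card ≤ n * (n * (20 * r)) := Nat.mul_le_mul_left _ hC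
      _ = _ := by ring
  have e5 : T5.card ≤ 20 * r * n ^ 2 := by
    refine Finset.card_image_le.trans ?_
    simp only [Finset.card_product, U, Finset.card_fin]
    calc C.card * n ≤ (n * (20 * r)) * n := Nat.mul_le_mul_right _ hC
      _ = _ := by ring
  have u1 := Finset.card_union_le (T1 ∪ T2 ∪ T3 ∪ T4) T5
  have u2 := Finset.card_union_le (T1 ∪ T2 ∪ T3) T4
  have u3 := Finset.card_union_le (T1 ∪ T2) T3
  have u4 := Finset.card_union_le T1 T2
  calc _ ≤ (s + 2 * i + 1) * n ^ 2 + s * n ^ 2 + s * n ^ 2 + 20 * r * n ^ 2 + 20 * r * n ^ 2 := by omega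
    _ = _ := by ring

end

section

lemma swap_sym2 {α : Type*} [DecidableEq α] {x y x' y' : α} (hxy : x ≠ y)
    (h : Equiv.swap x y = Equiv.swap x' y') : s(x, y) = s(x', y') := by
  have h1 : Equiv.swap x' y' x = y := by rw [← h]; simp
  rw [Sym2.eq_iff]
  by_cases e : x = x'
  · subst e; rw [Equiv.swap_apply_left] at h1; left; exact ⟨rfl, h1.symm⟩
  by_cases e' : x = y'
  · subst e'; rw [Equiv.swap_apply_right] at h1; right; exact ⟨rfl, h1.symm⟩
  · rw [Equiv.swap_apply_of_ne_of_ne e e'] at h1; exact absurd h1 hxy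

lemma trans_len {α : Type*} [Fintype α] [DecidableEq α] [Nonempty α] (L : List (Equiv.Perm α))
    (hL : ∀ t ∈ L, t.IsSwap)
    (h : ∀ s : α → Prop, (∃ x, s x) → (∀ t ∈ L, ∀ x, s x → s (t x)) → ∀ x, s x) :
    Fintype.card α ≤ L.length + 1 := by
  classical
  let G : SimpleGraph α :=
    { Adj := fun x y => x ≠ y ∧ Equiv.swap x y ∈ L
      symm := ⟨fun x y h => ⟨h.1.symm, by rw [Equiv.swap_comm]; exact h.2⟩⟩
      loopless := ⟨fun x h => h.1 rfl⟩ }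
  have hG : G.Connected := by
    rw [SimpleGraph.connected_iff]
    refine ⟨?_, inferInstance⟩
    intro x
    refine h (fun y => G.Reachable x y) ⟨x, SimpleGraph.Reachable.refl _⟩ ?_
    intro t ht y hy
    obtain ⟨p, q, hpq, rfl⟩ := hL t ht
    by_cases e : y = p
    · subst e
      rw [Equiv.swap_apply_left]
      exact hy.trans (SimpleGraph.Adj.reachable ⟨hpq, ht⟩)
    by_cases e' : y = q
    · subst e'
      rw [Equiv.swap_apply_right]
      exact hy.trans (SimpleGraph.Adj.reachable ⟨hpq.symm, by rw [Equiv.swap_comm]; exact ht⟩)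
    · rwa [Equiv.swap_apply_of_ne_of_ne e e']
  have h1 := hG.card_vert_le_card_edgeSet_add_one
  have h2 : Nat.card G.edgeSet ≤ L.toFinset.card := by
    rw [Nat.card_coe_set_eq, ← Set.ncard_coe_finset]
    refine Set.ncard_le_ncard_of_injOn (Sym2.lift ⟨fun x y => Equiv.swap x y, fun x y => Equiv.swap_comm x y⟩) ?_ ?_
    · intro e
      induction e with
      | h x y => 
        intro he
        rw [SimpleGraph.mem_edgeSet] at he
        simpa using he.2
    · intro e
      induction e with
      | h x y => 
        intro he e'
        induction e' with
        | h x' y' =>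
          intro he' hh
          rw [SimpleGraph.mem_edgeSet] at he
          exact swap_sym2 he.1 (by simpa using hh)
  have h3 := L.toFinset_card_le
  rw [Nat.card_eq_fintype_card] at h1
  omega

lemma long_len {α : Type*} [Fintype α] [DecidableEq α] [Nonempty α] (L : List (Equiv.Perm α))
    (hL : ∀ t ∈ L, t.IsSwap) (h : (L.prod).IsCycleOn (Set.univ : Set α)) : Fintype.card α ≤ L.length + 1 := by
  apply trans_len L hL
  rintro s ⟨x, hx⟩ hs y
  refine IsCycleOn.fixed_all h.inv s ?_ hx y
  rw [inv_inv]
  clear h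
  induction L with
  | nil => simp
  | cons t L ih =>
    intro z hz
    rw [List.prod_cons, Equiv.Perm.mul_apply]
    exact hs t (by simp) _ (ih (fun t ht => hL t (by simp [ht])) (fun t ht => hs t (by simp [ht])) z hz)

end

section
set_option linter.unusedSectionVars false

section
variable {α : Type*} [Fintype α] [DecidableEq α]

open scoped Classical in
noncomputable def restr (p : α → Prop) (t : Equiv.Perm α) : Equiv.Perm {x // p x} :=
  if h : ∀ x, p (t x) ↔ p x then t.subtypePerm h else 1

lemma restr_apply {p : α → Prop} {t : Equiv.Perm α} (h : ∀ x, p (t x) ↔ p x) (x : {x // p x}) :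
    ((restr p t x : {x // p x}) : α) = t x := by
  rw [restr, dif_pos h]; rfl

lemma restr_prod {p : α → Prop} (L : List (Equiv.Perm α)) (h : ∀ t ∈ L, ∀ x, p (t x) ↔ p x) :
    (∀ x, p (L.prod x) ↔ p x) ∧ restr p L.prod = (L.map (restr p)).prod := by
  induction L with
  | nil =>
    simp
    ext x
    rw [restr_apply (by simp)]; rfl
  | cons t L ih =>
    obtain ⟨i1, i2⟩ := ih (fun t ht => h t (by simp [ht]))
    have ht := h t (by simp)
    have i3 : ∀ x, p ((t :: L).prod x) ↔ p x := by
      intro x; rw [List.prod_cons, Equiv.Perm.mul_apply, ht, i1]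
    refine ⟨i3, ?_⟩
    ext x
    rw [restr_apply i3, List.map_cons, List.prod_cons, List.prod_cons, Equiv.Perm.mul_apply,
      Equiv.Perm.mul_apply, restr_apply ht, ← i2, restr_apply i1]

lemma restr_swap {p : α → Prop} {x y : α} (hxy : x ≠ y) (hx : p x) (hy : p y)
    (h : ∀ z, p (Equiv.swap x y z) ↔ p z) : (restr p (Equiv.swap x y)).IsSwap := by
  refine ⟨⟨x, hx⟩, ⟨y, hy⟩, by simpa using hxy, ?_⟩
  ext z
  rw [restr_apply h, Equiv.swap_apply_def, Equiv.swap_apply_def]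
  simp only [Subtype.ext_iff]
  split_ifs <;> rfl

lemma restr_swap_one {p : α → Prop} {x y : α} (hx : ¬ p x) (hy : ¬ p y)
    (h : ∀ z, p (Equiv.swap x y z) ↔ p z) : restr p (Equiv.swap x y) = 1 := by
  ext z
  rw [restr_apply h, Equiv.swap_apply_of_ne_of_ne]
  · rfl
  · intro e; exact hx (e ▸ z.2)
  · intro e; exact hy (e ▸ z.2)

lemma ofSubtype_restr {p : α → Prop} [DecidablePred p] {t : Equiv.Perm α} (h : ∀ x, p (t x) ↔ p x)
    (h2 : ∀ x, t x ≠ x → p x) : Equiv.Perm.ofSubtype (restr p t) = t := by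
  rw [restr, dif_pos h]
  exact Equiv.Perm.ofSubtype_subtypePerm h h2

lemma prod_filter_one {β M : Type*} [Monoid M] (f : β → M) (q : β → Bool) (L : List β)
    (h : ∀ t ∈ L, q t = false → f t = 1) : (L.map f).prod = ((L.filter q).map f).prod := by
  induction L with
  | nil => rfl
  | cons t L ih =>
    have := ih (fun t ht => h t (by simp [ht]))
    cases hq : q t
    · rw [List.filter_cons_of_neg (by simp [hq]), List.map_cons, List.prod_cons, this, h t (by simp) hq, one_mul]
    · rw [List.filter_cons_of_pos hq, List.map_cons, List.prod_cons, this, List.map_cons, List.prod_cons]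

lemma filter_inj {β : Type*} (q : β → Bool) (L L' : List β) (h : L.map q = L'.map q)
    (h1 : L.filter q = L'.filter q) (h2 : L.filter (fun t => !q t) = L'.filter (fun t => !q t)) : L = L' := by
  induction L generalizing L' with
  | nil => simp at h; exact h.symm
  | cons t L ih =>
    cases L' with
    | nil => simp at h
    | cons t' L' =>
      simp only [List.map_cons, List.cons.injEq] at h
      cases hq : q t
      · have hq' : q t' = false := by rw [← h.1, hq]
        simp only [List.filter_cons, hq, hq', Bool.not_false, if_true, List.cons.injEq, Bool.false_eq_true, if_false] at h1 h2
        rw [h2.1, ih L' h.2 h1 h2.2]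
      · have hq' : q t' = true := by rw [← h.1, hq]
        simp only [List.filter_cons, hq, hq', Bool.not_true, if_true, List.cons.injEq, Bool.false_eq_true, if_false] at h1 h2
        rw [h1.1, ih L' h.2 h1.2 h2]

def BL : ℕ → ℕ → Finset (List Bool)
  | 0, 0 => {[]}
  | 0, _ + 1 => ∅
  | m + 1, 0 => (BL m 0).image (fun l => false :: l)
  | m + 1, k + 1 => (BL m k).image (fun l => true :: l) ∪ (BL m (k + 1)).image (fun l => false :: l)

lemma card_BL (m k : ℕ) : (BL m k).card ≤ m.choose k := by
  induction m generalizing k with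
  | zero => cases k <;> simp [BL]
  | succ m ih =>
    cases k with
    | zero => rw [BL]; exact Finset.card_image_le.trans ((ih 0).trans (by simp))
    | succ k =>
      rw [BL, Nat.choose_succ_succ]
      refine (Finset.card_union_le _ _).trans ?_
      exact Nat.add_le_add (Finset.card_image_le.trans (ih k)) (Finset.card_image_le.trans (ih (k + 1)))

lemma mem_BL (l : List Bool) : l ∈ BL l.length (l.count true) := by
  induction l with
  | nil => simp [BL]
  | cons b l ih =>
    cases b
    · rw [List.count_cons_of_ne (by simp), List.length_cons]
      cases hc : l.count true with
      | zero => rw [BL, Finset.mem_image]; exact ⟨l, by rw [← hc]; exact ih, rfl⟩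
      | succ k =>
        rw [BL, Finset.mem_union]; right; rw [Finset.mem_image]; exact ⟨l, by rw [← hc]; exact ih, rfl⟩
    · rw [List.count_cons_self, List.length_cons, BL, Finset.mem_union]
      left; rw [Finset.mem_image]; exact ⟨l, ih, rfl⟩

lemma cyc_fixed {p : α → Prop} {π : Equiv.Perm α} (hp : ∀ x, p (π x) ↔ p x)
    (hA : (restr p π).IsCycleOn (Set.univ : Set {x // p x})) (s : α → Prop) (hs : ∀ x, s x → s (π x))
    {x y : α} (hx : p x) (hy : p y) (h : s x) : s y := by
  refine IsCycleOn.fixed_all hA.inv (fun z : {x // p x} => s z) ?_ (x := ⟨x, hx⟩) h ⟨y, hy⟩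
  rw [inv_inv]
  intro z hz
  rw [restr_apply hp]
  exact hs _ hz

lemma prod_pres (L : List (Equiv.Perm α)) (s : α → Prop) (hs : ∀ t ∈ L, ∀ x, s x → s (t x)) (x : α) (h : s x) :
    s (L.prod x) := by
  induction L with
  | nil => simpa using h
  | cons t L ih =>
    rw [List.prod_cons, Equiv.Perm.mul_apply]
    exact hs t (by simp) _ (ih (fun t ht => hs t (by simp [ht])))

lemma split_pres (p : α → Prop) (π : Equiv.Perm α) (hp : ∀ x, p (π x) ↔ p x)
    (hA : (restr p π).IsCycleOn (Set.univ : Set {x // p x}))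
    (hB : (restr (fun x => ¬ p x) π).IsCycleOn (Set.univ : Set {x // ¬ p x}))
    (hc : 2 ≤ Fintype.card α)
    (L : List (Equiv.Perm α)) (hL : L ∈ tup (Fintype.card α - 2) π) {x y : α} (hx : p x) (hy : ¬ p y)
    (hxy : Equiv.swap x y ∈ L) : False := by
  obtain ⟨l1, l2, l3⟩ := mem_tup.1 hL
  have : Nonempty α := ⟨x⟩
  have := trans_len L l2 ?_
  · omega
  rintro s ⟨z, hz⟩ hs z'
  have hπ : ∀ x, s x → s (π x) := fun x hx => by rw [← l3]; exact prod_pres L s hs x hx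
  have hx' : s x ∧ s y := by
    by_cases h : p z
    · have h1 : s x := cyc_fixed hp hA s hπ h hx hz
      have h2 := hs _ hxy x h1
      rw [Equiv.swap_apply_left] at h2
      exact ⟨h1, h2⟩
    · have h1 : s y := cyc_fixed (p := fun x => ¬ p x) (fun x => not_congr (hp x)) hB s hπ h hy hz
      have h2 := hs _ hxy y h1
      rw [Equiv.swap_apply_right] at h2
      exact ⟨h2, h1⟩
  by_cases h : p z'
  · exact cyc_fixed hp hA s hπ hx h hx'.1
  · exact cyc_fixed (p := fun x => ¬ p x) (fun x => not_congr (hp x)) hB s hπ hy h hx'.2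

open scoped Classical in
lemma split_bound (p : α → Prop) (π : Equiv.Perm α) (hp : ∀ x, p (π x) ↔ p x)
    (hA : (restr p π).IsCycleOn (Set.univ : Set {x // p x}))
    (hB : (restr (fun x => ¬ p x) π).IsCycleOn (Set.univ : Set {x // ¬ p x}))
    (exA : ∃ x, p x) (exB : ∃ x, ¬ p x) :
    cnt (Fintype.card α - 2) π ≤
      (Fintype.card α - 2).choose (Fintype.card {x // p x} - 1) *
       (cnt (Fintype.card {x // p x} - 1) (restr p π) * cnt (Fintype.card {x // ¬ p x} - 1) (restr (fun x => ¬ p x) π)) := by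
  have hcard : Fintype.card {x // p x} + Fintype.card {x // ¬ p x} = Fintype.card α := by
    rw [Fintype.card_subtype_compl]
    have := Fintype.card_subtype_le p
    omega
  have nA : Nonempty {x // p x} := ⟨⟨exA.choose, exA.choose_spec⟩⟩
  have nB : Nonempty {x // ¬ p x} := ⟨⟨exB.choose, exB.choose_spec⟩⟩
  have cA : 1 ≤ Fintype.card {x // p x} := Fintype.card_pos
  have cB : 1 ≤ Fintype.card {x // ¬ p x} := Fintype.card_pos
  have hp' : ∀ x, ¬ p (π x) ↔ ¬ p x := fun x => not_congr (hp x)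
  let q : Equiv.Perm α → Bool := fun t => decide (∃ x, p x ∧ t x ≠ x)
  have key : ∀ L ∈ tup (Fintype.card α - 2) π, ∀ t ∈ L, (∀ x, p (t x) ↔ p x) ∧
      ((q t = true ∧ (restr p t).IsSwap ∧ (restr (fun x => ¬ p x) t) = 1 ∧ ∀ x, t x ≠ x → p x) ∨
       (q t = false ∧ (restr p t) = 1 ∧ (restr (fun x => ¬ p x) t).IsSwap ∧ ∀ x, t x ≠ x → ¬ p x)) := by
    intro L hL t ht
    obtain ⟨l1, l2, l3⟩ := mem_tup.1 hL
    obtain ⟨x, y, hxy, rfl⟩ := l2 t ht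
    have hiff : p x ↔ p y := by
      by_contra H
      by_cases h : p x
      · exact split_pres p π hp hA hB (by omega) L hL h (fun h' => H ⟨fun _ => h', fun _ => h⟩) ht
      · have h' : p y := by by_contra h'; exact H ⟨fun a => absurd a h, fun a => absurd a h'⟩
        exact split_pres p π hp hA hB (by omega) L hL h' h (by rw [Equiv.swap_comm]; exact ht)
    have hpres : ∀ z, p (Equiv.swap x y z) ↔ p z := by
      intro z
      rw [Equiv.swap_apply_def]
      split_ifs with e e'
      · rw [e]; exact hiff.symm
      · rw [e']; exact hiff
      · rfl
    have hpres' : ∀ z, ¬ p (Equiv.swap x y z) ↔ ¬ p z := fun z => not_congr (hpres z)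
    have hsup : ∀ z, Equiv.swap x y z ≠ z → z = x ∨ z = y := by
      intro z hz
      by_contra H
      push Not at H
      exact hz (Equiv.swap_apply_of_ne_of_ne H.1 H.2)
    refine ⟨hpres, ?_⟩
    by_cases h : p x
    · left
      refine ⟨?_, restr_swap hxy h (hiff.1 h) hpres, restr_swap_one (not_not.2 h) (not_not.2 (hiff.1 h)) hpres', ?_⟩
      · simp only [q, decide_eq_true_eq]
        exact ⟨x, h, by rw [Equiv.swap_apply_left]; exact hxy.symm⟩
      · intro z hz
        rcases hsup z hz with rfl | rfl
        · exact h
        · exact hiff.1 h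
    · right
      have hs : ∀ z, Equiv.swap x y z ≠ z → ¬ p z := by
        intro z hz
        rcases hsup z hz with rfl | rfl
        · exact h
        · exact fun h' => h (hiff.2 h')
      refine ⟨?_, restr_swap_one h (fun h' => h (hiff.2 h')) hpres, restr_swap hxy h (fun h' => h (hiff.2 h')) hpres', hs⟩
      simp only [q, decide_eq_false_iff_not]
      rintro ⟨z, hz, hz'⟩
      exact hs z hz' hz
  have key2 : ∀ L ∈ tup (Fintype.card α - 2) π,
      ((L.filter q).map (restr p)) ∈ tup (Fintype.card {x // p x} - 1) (restr p π) ∧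
      ((L.filter (fun t => !q t)).map (restr (fun x => ¬ p x))) ∈
        tup (Fintype.card {x // ¬ p x} - 1) (restr (fun x => ¬ p x) π) ∧
      L.map q ∈ BL (Fintype.card α - 2) (Fintype.card {x // p x} - 1) := by
    intro L hL
    have K := key L hL
    obtain ⟨l1, l2, l3⟩ := mem_tup.1 hL
    have pA : ((L.filter q).map (restr p)).prod = restr p π := by
      rw [← l3, (restr_prod L (fun t ht => (K t ht).1)).2]
      refine (prod_filter_one _ q L ?_).symm
      intro t ht hq
      rcases (K t ht).2 with h | h
      · rw [hq] at h; exact absurd h.1 (by simp)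
      · exact h.2.1
    have pB : ((L.filter (fun t => !q t)).map (restr (fun x => ¬ p x))).prod = restr (fun x => ¬ p x) π := by
      rw [← l3, (restr_prod (p := fun x => ¬ p x) L (fun t ht x => not_congr ((K t ht).1 x))).2]
      refine (prod_filter_one _ (fun t => !q t) L ?_).symm
      intro t ht hq
      rcases (K t ht).2 with h | h
      · exact h.2.2.1
      · rw [h.1] at hq; simp at hq
    have sA : ∀ s ∈ (L.filter q).map (restr p), s.IsSwap := by
      intro s hs
      obtain ⟨t, ht, rfl⟩ := List.mem_map.1 hs
      rw [List.mem_filter] at ht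
      rcases (K t ht.1).2 with h | h
      · exact h.2.1
      · rw [ht.2] at h; exact absurd h.1 (by simp)
    have sB : ∀ s ∈ (L.filter (fun t => !q t)).map (restr (fun x => ¬ p x)), s.IsSwap := by
      intro s hs
      obtain ⟨t, ht, rfl⟩ := List.mem_map.1 hs
      rw [List.mem_filter] at ht
      rcases (K t ht.1).2 with h | h
      · have := ht.2; rw [h.1] at this; simp at this
      · exact h.2.2.1
    have lA := long_len _ sA (by rw [pA]; exact hA)
    have lB := long_len _ sB (by rw [pB]; exact hB)
    have lt : (L.filter q).length + (L.filter (fun t => !q t)).length = L.length := by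
      rw [← List.countP_eq_length_filter, ← List.countP_eq_length_filter]
      have := List.length_eq_countP_add_countP q (l := L)
      rw [this]
      congr 1
      exact List.countP_congr (by simp)
    rw [List.length_map] at lA lB
    refine ⟨mem_tup.2 ⟨by rw [List.length_map]; omega, sA, pA⟩, mem_tup.2 ⟨by rw [List.length_map]; omega, sB, pB⟩, ?_⟩
    have := mem_BL (L.map q)
    rw [List.length_map, l1] at this
    have e : (L.map q).count true = Fintype.card {x // p x} - 1 := by
      rw [List.count, List.countP_map]
      have : (L.filter q).length = List.countP ((fun x => x == true) ∘ q) L := by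
        rw [← List.countP_eq_length_filter]
        exact List.countP_congr (by simp)
      omega
    rwa [e] at this
  rw [← card_tup, ← card_tup, ← card_tup]
  refine le_trans ?_ (Nat.mul_le_mul_right _ (card_BL _ _))
  rw [← Finset.card_product, ← Finset.card_product]
  refine Finset.card_le_card_of_injOn (fun L => (L.map q, (L.filter q).map (restr p),
    (L.filter (fun t => !q t)).map (restr (fun x => ¬ p x)))) ?_ ?_
  · intro L hL
    obtain ⟨h1, h2, h3⟩ := key2 L hL
    simp only [Finset.coe_product, Set.mem_prod, Finset.mem_coe]
    exact ⟨h3, h1, h2⟩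
  · intro L hL L' hL' h
    simp only [Prod.mk.injEq] at h
    obtain ⟨h1, h2, h3⟩ := h
    have rA : ∀ L ∈ tup (Fintype.card α - 2) π,
        ((L.filter q).map (restr p)).map (fun t => Equiv.Perm.ofSubtype t) = L.filter q := by
      intro L hL
      rw [List.map_map]
      conv_rhs => rw [← List.map_id (L.filter q)]
      apply List.map_congr_left
      intro t ht
      rw [List.mem_filter] at ht
      rcases key L hL t ht.1 with ⟨k1, k2 | k2⟩
      · exact ofSubtype_restr k1 k2.2.2.2
      · rw [ht.2] at k2; exact absurd k2.1 (by simp)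
    have rB : ∀ L ∈ tup (Fintype.card α - 2) π,
        ((L.filter (fun t => !q t)).map (restr (fun x => ¬ p x))).map (fun t => Equiv.Perm.ofSubtype t) =
          L.filter (fun t => !q t) := by
      intro L hL
      rw [List.map_map]
      conv_rhs => rw [← List.map_id (L.filter (fun t => !q t))]
      apply List.map_congr_left
      intro t ht
      rw [List.mem_filter] at ht
      rcases key L hL t ht.1 with ⟨k1, k2 | k2⟩
      · have := ht.2; rw [k2.1] at this; simp at this
      · exact ofSubtype_restr (p := fun x => ¬ p x) (fun x => not_congr (k1 x)) k2.2.2.2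
    refine filter_inj q L L' h1 ?_ ?_
    · rw [← rA L hL, ← rA L' hL', h2]
    · rw [← rB L hL, ← rB L' hL', h3]
end

end

section

lemma long_of_base {β : Type*} (ρ : Equiv.Perm β) (e : β)
    (h : ∀ s : β → Prop, s e → (∀ y, s y ↔ s (ρ y)) → ∀ y, s y) : ρ.IsCycleOn (Set.univ : Set β) := by
  have h1 : ∀ y, ρ.SameCycle e y := h (fun y => ρ.SameCycle e y) (Equiv.Perm.SameCycle.refl _ _)
    (fun y => (Equiv.Perm.sameCycle_apply_right).symm)
  refine ⟨Set.bijOn_univ.2 ρ.bijective, fun x _ y _ => (h1 x).symm.trans (h1 y)⟩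

section
variable {n : ℕ} (x z : Fin n) (hxz : x < z)
include hxz

lemma pi_val (y : Fin n) : ((Equiv.swap x z * (finRotate n)⁻¹) y).val =
    if y.val = 0 then (if z.val = n - 1 then x.val else n - 1)
    else if y.val = x.val + 1 then z.val else if y.val = z.val + 1 then x.val else y.val - 1 := by
  rw [Equiv.Perm.mul_apply, swap_val, finRotate_inv_val]
  have := x.isLt
  have := z.isLt
  have := y.isLt
  rw [Fin.lt_def] at hxz
  split_ifs <;> omega

lemma blk_pres (y : Fin n) : (x < (Equiv.swap x z * (finRotate n)⁻¹) y ∧ (Equiv.swap x z * (finRotate n)⁻¹) y ≤ z) ↔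
    (x < y ∧ y ≤ z) := by
  have := pi_val x z hxz y
  have := x.isLt
  have := z.isLt
  have := y.isLt
  simp only [Fin.lt_def, Fin.le_def] at *
  rw [pi_val x z hxz y]
  split_ifs <;> omega

lemma blk_cycA : (restr (fun y => x < y ∧ y ≤ z) (Equiv.swap x z * (finRotate n)⁻¹)).IsCycleOn Set.univ := by
  refine long_of_base _ ⟨z, hxz, le_rfl⟩ ?_
  intro s h0 hs
  have key : ∀ k, ∀ y : {y : Fin n // x < y ∧ y ≤ z}, y.1.val + k = z.val → s y := by
    intro k
    induction k with
    | zero =>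
      intro y hy
      have : y = ⟨z, hxz, le_rfl⟩ := by ext; simpa using hy
      rw [this]; exact h0
    | succ k ih =>
      intro y hy
      have hy2 := y.2
      simp only [Fin.lt_def, Fin.le_def] at hy2
      have hlt : y.1.val + 1 < n := by have := z.isLt; omega
      obtain ⟨y', e⟩ : ∃ y' : {y : Fin n // x < y ∧ y ≤ z}, y'.1.val = y.1.val + 1 := ⟨⟨⟨y.1.val + 1, hlt⟩, by
        simp only [Fin.lt_def, Fin.le_def]; omega⟩, rfl⟩
      have h1 : s y' := ih y' (by omega)
      rw [hs] at h1
      have : restr (fun y => x < y ∧ y ≤ z) (Equiv.swap x z * (finRotate n)⁻¹) y' = y := by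
        apply Subtype.ext
        rw [restr_apply (blk_pres x z hxz)]
        ext
        rw [pi_val x z hxz]
        have := z.isLt
        rw [e, if_neg (by omega)]
        split_ifs <;> omega
      rwa [this] at h1
  intro y
  have := y.2.2
  exact key (z.val - y.1.val) y (by simp only [Fin.le_def] at this; omega)

lemma blk_cycB : (restr (fun y => ¬ (x < y ∧ y ≤ z)) (Equiv.swap x z * (finRotate n)⁻¹)).IsCycleOn Set.univ := by
  have hp := fun y => not_congr (blk_pres x z hxz y)
  refine long_of_base _ ⟨x, by simp⟩ ?_
  intro s h0 hs
  have step : ∀ y y' : {y : Fin n // ¬ (x < y ∧ y ≤ z)}, ((Equiv.swap x z * (finRotate n)⁻¹) y'.1).val = y.1.val → (s y' ↔ s y) := by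
    intro y y' h
    rw [hs y']
    have : restr (fun y => ¬ (x < y ∧ y ≤ z)) (Equiv.swap x z * (finRotate n)⁻¹) y' = y := by
      apply Subtype.ext
      rw [restr_apply hp]
      ext; exact h
    rw [this]
  have hxz' : x.val < z.val := hxz
  have key : ∀ k, ∀ y : {y : Fin n // ¬ (x < y ∧ y ≤ z)}, y.1.val + k = x.val → s y := by
    intro k
    induction k with
    | zero =>
      intro y hy
      have : y = ⟨x, by simp⟩ := by ext; simpa using hy
      rw [this]; exact h0
    | succ k ih =>
      intro y hy
      have hlt : y.1.val + 1 < n := by have := x.isLt; omega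
      obtain ⟨y', e⟩ : ∃ y' : {y : Fin n // ¬ (x < y ∧ y ≤ z)}, y'.1.val = y.1.val + 1 := ⟨⟨⟨y.1.val + 1, hlt⟩, by
        simp only [Fin.lt_def, Fin.le_def]; omega⟩, rfl⟩
      have h1 : s y' := ih y' (by omega)
      rwa [step y y'] at h1
      rw [pi_val x z hxz]
      rw [e, if_neg (by omega)]
      split_ifs <;> omega
  have key2 : ∀ k, ∀ y : {y : Fin n // ¬ (x < y ∧ y ≤ z)}, y.1.val = z.val + 1 + k → s y := by
    intro k
    induction k with
    | zero =>
      intro y hy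
      rw [step ⟨x, by simp⟩ y]
      · exact h0
      rw [pi_val x z hxz]
      have := y.1.isLt
      show _ = x.val
      split_ifs <;> omega
    | succ k ih =>
      intro y hy
      let y' : {y : Fin n // ¬ (x < y ∧ y ≤ z)} := ⟨⟨y.1.val - 1, by have := y.1.isLt; omega⟩, by
        simp only [Fin.lt_def, Fin.le_def]; omega⟩
      have h1 : s y' := ih y' (by simp only [y']; omega)
      rwa [← step y' y] at h1
      rw [pi_val x z hxz]
      have e : y'.1.val = y.1.val - 1 := rfl
      have := y.1.isLt
      have := z.isLt
      rw [e, if_neg (by omega)]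
      split_ifs <;> omega
  intro y
  have := y.2
  simp only [Fin.lt_def, Fin.le_def] at this
  rcases le_or_gt y.1.val x.val with h | h
  · exact key (x.val - y.1.val) y (by omega)
  · exact key2 (y.1.val - (z.val + 1)) y (by omega)

lemma W_bound : cnt (n - 2) (Equiv.swap x z * (finRotate n)⁻¹) * ((z.val - x.val) * (n - (z.val - x.val))) ≤
    (n - 2).choose (z.val - x.val - 1) *
      ((z.val - x.val) ^ (z.val - x.val - 1) * (n - (z.val - x.val)) ^ (n - (z.val - x.val) - 1)) := by
  classical
  have hA := blk_cycA x z hxz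
  have hB := blk_cycB x z hxz
  have hxz' : x.val < z.val := hxz
  have h := split_bound (fun y => x < y ∧ y ≤ z) _ (blk_pres x z hxz) hA hB ⟨z, hxz, le_rfl⟩ ⟨x, by simp⟩
  have cA : Fintype.card {y : Fin n // x < y ∧ y ≤ z} = z.val - x.val := by
    rw [Fintype.card_subtype]
    have : (Finset.univ.filter (fun y : Fin n => x < y ∧ y ≤ z)) = Finset.Ioc x z := by ext; simp
    rw [this, Fin.card_Ioc]
  have cB : Fintype.card {y : Fin n // ¬ (x < y ∧ y ≤ z)} = n - (z.val - x.val) := by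
    rw [Fintype.card_subtype_compl, cA, Fintype.card_fin]
  have hz := z.isLt
  have gen : ∀ {β : Type} (i1 i2 : Fintype β) (d1 d2 : DecidableEq β) (ρ : Equiv.Perm β) (m : ℕ),
      @cnt β i1 d1 m ρ = @cnt β i2 d2 m ρ := by
    intro β i1 i2 d1 d2 ρ m
    rw [Subsingleton.elim i1 i2, Subsingleton.elim d1 d2]
  have zA := cnt_long_zero (by rw [cA]; omega) _ hA
  have zB := cnt_long_zero (by rw [cB]; omega) _ hB
  rw [cA] at zA
  rw [cB] at zB
  have cA' : ∀ i : Fintype {y : Fin n // x < y ∧ y ≤ z}, @Fintype.card _ i = z.val - x.val := by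
    intro i; rw [← cA]; congr!
  have cB' : ∀ i : Fintype {y : Fin n // ¬ (x < y ∧ y ≤ z)}, @Fintype.card _ i = n - (z.val - x.val) := by
    intro i; rw [← cB]; congr!
  rw [Fintype.card_fin] at h
  simp only [cA', cB'] at h
  rw [← zA, ← zB]
  refine (Nat.mul_le_mul_right _ h).trans (le_of_eq ?_)
  rw [gen _ _ _ _ _ (z.val - x.val - 1), gen _ _ _ _ _ (n - (z.val - x.val) - 1)]
  ring
end

end

section

def Tch {α : Type*} (F : List (Equiv.Perm α)) (u : ℕ) : Equiv.Perm α :=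
  (F.take u).prod * F.getD u 1 * ((F.take u).prod)⁻¹

lemma Tch_append {α : Type*} (X Y : List (Equiv.Perm α)) (s : Equiv.Perm α) :
    Tch (X ++ s :: Y) X.length = X.prod * s * X.prod⁻¹ := by
  simp [Tch]

lemma exists_split {α : Type*} (F : List α) (u : ℕ) (hu : u < F.length) :
    ∃ X s Y, F = X ++ s :: Y ∧ X.length = u := by
  refine ⟨F.take u, F[u], F.drop (u+1), ?_, by simp; omega⟩
  simp

open scoped Classical in
lemma chord_count {α : Type*} [Fintype α] [DecidableEq α] (m u : ℕ) (hu : u ≤ m) (π : Equiv.Perm α)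
    (P : Equiv.Perm α → Prop) :
    ((tup (m+1) π).filter (fun F => P (Tch F u))).card ≤ ∑ t ∈ (swaps α).filter P, cnt m (t * π) := by
  simp only [← card_tup]
  rw [← Finset.card_sigma]
  apply Finset.card_le_card_of_injOn (fun F => ⟨Tch F u, F.eraseIdx u⟩)
  · intro F hF
    simp only [Finset.coe_filter, Set.mem_ofPred_eq, mem_tup] at hF
    obtain ⟨⟨h1, h2, h3⟩, h4⟩ := hF
    obtain ⟨X, s, Y, rfl, rfl⟩ := exists_split F u (by omega)
    have hs : s.IsSwap := h2 s (by simp)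
    simp only [Finset.coe_sigma, Set.mem_sigma_iff, Finset.mem_coe, Finset.mem_filter, mem_tup]
    refine ⟨⟨?_, h4⟩, ?_, ?_, ?_⟩
    · rw [Tch_append, mem_swaps]
      obtain ⟨a, b, hab, rfl⟩ := hs
      exact ⟨X.prod a, X.prod b, by simpa using hab, by rw [Equiv.swap_apply_apply]⟩
    · rw [List.eraseIdx_append_of_length_le le_rfl]; simp at h1 ⊢; omega
    · intro t ht
      apply h2
      rw [List.eraseIdx_append_of_length_le le_rfl] at ht
      simp at ht ⊢; tauto
    · rw [List.eraseIdx_append_of_length_le le_rfl, Tch_append, ← h3]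
      have := IsSwap.mul_self_eq hs
      simp only [Nat.sub_self, List.eraseIdx_cons_zero, List.prod_append, List.prod_cons]
      have e : X.prod * s * X.prod⁻¹ * (X.prod * (s * Y.prod)) = X.prod * (s * s) * Y.prod := by group
      rw [e, this, mul_one]
  · intro F hF F' hF' h
    simp only [Finset.coe_filter, Set.mem_ofPred_eq, mem_tup] at hF hF'
    obtain ⟨⟨h1, h2, h3⟩, h4⟩ := hF
    obtain ⟨⟨h1', h2', h3'⟩, h4'⟩ := hF'
    obtain ⟨X, s, Y, rfl, hX⟩ := exists_split F u (by omega)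
    obtain ⟨X', s', Y', rfl, hX'⟩ := exists_split F' u (by omega)
    simp only [Sigma.mk.injEq, heq_eq_eq] at h
    obtain ⟨ha, hb⟩ := h
    have e1 : Tch (X ++ s :: Y) u = X.prod * s * X.prod⁻¹ := by rw [← hX, Tch_append]
    have e2 : Tch (X' ++ s' :: Y') u = X'.prod * s' * X'.prod⁻¹ := by rw [← hX', Tch_append]
    rw [e1, e2] at ha
    have e3 : (X ++ s :: Y).eraseIdx u = X ++ Y := by
      rw [List.eraseIdx_append_of_length_le (by omega)]; simp [hX]
    have e4 : (X' ++ s' :: Y').eraseIdx u = X' ++ Y' := by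
      rw [List.eraseIdx_append_of_length_le (by omega)]; simp [hX']
    rw [e3, e4] at hb
    obtain ⟨rfl, rfl⟩ := List.append_inj hb (by omega)
    have : s = s' := by simpa using ha
    rw [this]

/-- number of factors moving `y` -/
def mv {n : ℕ} (L : List (Equiv.Perm (Fin n))) (y : Fin n) : ℕ :=
  ((Finset.range L.length).filter (fun u => L.getD u 1 y ≠ y)).card

def longT {n : ℕ} (l : ℕ) (t : Equiv.Perm (Fin n)) : Prop := ∃ i : Fin n, i.val + l < (t i).val ∨ (t i).val + l < i.val

open scoped Classical in
noncomputable def Nl {n : ℕ} (l : ℕ) (L : List (Equiv.Perm (Fin n))) : ℕ :=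
  ((Finset.range L.length).filter (fun u => longT l (Tch L u))).card

lemma Tch_Qv {n : ℕ} (L : List (Equiv.Perm (Fin n))) (u : ℕ) (hu : u < L.length) (y : Fin n) :
    Tch L u (Qv L u y) = Qv L (u+1) y := by
  rw [Qv_succ L u hu, Tch, Qv, Qv]
  rw [List.getD_eq_getElem _ _ hu]; simp

lemma Qv_dist {n : ℕ} (L : List (Equiv.Perm (Fin n))) (l : ℕ) (y : Fin n)
    (h : ∀ u < L.length, L.getD u 1 y ≠ y → ¬ longT l (Tch L u)) (u : ℕ) (hu : u ≤ L.length) :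
    (Qv L u y).val ≤ y.val + l * ((Finset.range u).filter (fun u => L.getD u 1 y ≠ y)).card ∧
    y.val ≤ (Qv L u y).val + l * ((Finset.range u).filter (fun u => L.getD u 1 y ≠ y)).card := by
  induction u with
  | zero => simp [Qv_zero]
  | succ u ih =>
    have ih := ih (by omega)
    rw [Finset.range_add_one, Finset.filter_insert]
    split_ifs with hm
    · rw [Finset.card_insert_of_notMem (by simp)]
      have := h u (by omega) hm
      rw [longT] at this
      push Not at this
      have := this (Qv L u y)
      rw [Tch_Qv L u (by omega)] at this
      rw [mul_add]
      omega
    · push Not at hm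
      rw [Qv_succ L u (by omega)]
      rw [List.getD_eq_getElem _ _ (by omega)] at hm
      rw [hm]
      exact ih

lemma swap_moves {n : ℕ} (t : Equiv.Perm (Fin n)) (h : t.IsSwap) :
    (Finset.univ.filter (fun y => t y ≠ y)).card = 2 := by
  have := Equiv.Perm.card_support_eq_two.2 h
  rw [← this]; congr 1

open scoped Classical in
lemma bad_bound {n : ℕ} (L : List (Equiv.Perm (Fin n))) (hL : ∀ t ∈ L, t.IsSwap) (K l r : ℕ) (hr : l * K ≤ r) :
    (K + 1) * (Bad r L).ncard ≤ 2 * L.length + (K+1) * (2 * Nl l L) := by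
  have sw : ∀ u < L.length, (Finset.univ.filter (fun y => L.getD u 1 y ≠ y)).card = 2 := by
    intro u hu
    apply swap_moves
    rw [List.getD_eq_getElem _ _ hu]
    exact hL _ (List.getElem_mem hu)
  have h1 : (Bad r L) ⊆ ((Finset.univ.filter (fun y => K + 1 ≤ mv L y) ∪
      ((Finset.range L.length).filter (fun u => longT l (Tch L u))).biUnion
        (fun u => Finset.univ.filter (fun y => L.getD u 1 y ≠ y)) : Finset (Fin n)) : Set (Fin n)) := by
    intro y hy
    by_contra hc
    simp only [Finset.coe_union, Set.mem_union, Finset.mem_coe, Finset.mem_filter, Finset.mem_univ, true_and,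
      Finset.mem_biUnion, Finset.mem_range, not_or, not_exists, not_and, not_le] at hc
    obtain ⟨c1, c2⟩ := hc
    have key := Qv_dist L l y (fun u hu hm hl => c2 u ⟨hu, hl⟩ hm)
    obtain ⟨u, hu⟩ := hy
    have mono : ∀ u ≤ L.length, l * ((Finset.range u).filter (fun u => L.getD u 1 y ≠ y)).card ≤ r := by
      intro u hu
      refine le_trans (Nat.mul_le_mul_left l ?_) hr
      have : ((Finset.range u).filter (fun u => L.getD u 1 y ≠ y)).card ≤ mv L y := by
        apply Finset.card_le_card
        apply Finset.filter_subset_filter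
        simpa using hu
      omega
    rcases le_or_gt u L.length with h | h
    · have := key u h
      have := mono u h
      omega
    · rw [Qv_of_le L u h.le, ← Qv_of_le L L.length le_rfl] at hu
      have := key L.length le_rfl
      have := mono L.length le_rfl
      omega
  have h2 : (Bad r L).ncard ≤ (Finset.univ.filter (fun y => K + 1 ≤ mv L y)).card + 2 * Nl l L := by
    refine (Set.ncard_le_ncard h1 (Finset.finite_toSet _)).trans ?_
    rw [Set.ncard_coe_finset]
    refine (Finset.card_union_le _ _).trans (Nat.add_le_add_left ?_ _)
    refine Finset.card_biUnion_le.trans ?_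
    rw [Finset.sum_congr rfl (g := fun _ => 2)]
    · simp [Nl, mul_comm]
    · intro u hu
      simp at hu
      convert sw u hu.1
  have h3 : (K+1) * (Finset.univ.filter (fun y => K + 1 ≤ mv L y)).card ≤ 2 * L.length := by
    have : ∑ y, mv L y = 2 * L.length := by
      simp only [mv, Finset.card_filter]
      rw [Finset.sum_comm]
      simp only [← Finset.card_filter]
      rw [Finset.sum_congr rfl (g := fun _ => 2)]
      · simp [mul_comm]
      · intro u hu
        convert sw u (by simpa using hu)
    rw [← this]
    calc _ = ∑ y ∈ Finset.univ.filter (fun y => K + 1 ≤ mv L y), (K+1) := by simp [mul_comm]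
      _ ≤ ∑ y ∈ Finset.univ.filter (fun y => K + 1 ≤ mv L y), mv L y :=
        Finset.sum_le_sum (fun y hy => by simpa using hy)
      _ ≤ _ := Finset.sum_le_sum_of_subset (Finset.filter_subset _ _)
  have := Nat.mul_le_mul_left (K+1) h2
  rw [mul_add] at this
  omega

end

section

lemma fact_upper (n : ℕ) (hn : 1 ≤ n) : (n.factorial : ℝ) ≤ Real.exp 1 * √n * (n / Real.exp 1) ^ n := by
  have h := Stirling.stirlingSeq'_antitone (Nat.zero_le (n-1))
  simp only [Function.comp, Nat.succ_eq_add_one, Nat.sub_add_cancel hn, zero_add] at h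
  rw [Stirling.stirlingSeq_one, Stirling.stirlingSeq, div_le_iff₀ (by positivity)] at h
  refine h.trans (le_of_eq ?_)
  push_cast
  rw [Real.sqrt_mul (by norm_num)]
  have : √2 ≠ 0 := by positivity
  field_simp

lemma b_bound (n d : ℕ) (h1 : 1 ≤ d) (h2 : d < n) :
    (n.choose d : ℝ) * (d:ℝ) ^ d * ((n - d : ℕ) : ℝ) ^ (n - d) * √(d * (n - d : ℕ)) ≤ (n:ℝ) ^ n * √n := by
  set e := n - d with he
  have hn : n = d + e := by omega
  have hd0 : (0:ℝ) < d := by exact_mod_cast h1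
  have he0 : (0:ℝ) < e := by exact_mod_cast (show 0 < e by omega)
  have hc : (n.choose d : ℝ) * (d.factorial * e.factorial) = n.factorial := by
    rw [← mul_assoc]
    exact_mod_cast Nat.choose_mul_factorial_mul_factorial h2.le
  have l1 := Stirling.le_factorial_stirling d
  have l2 := Stirling.le_factorial_stirling e
  have l3 := fact_upper n (by omega)
  have hE := Real.exp_pos 1
  have key : (n.choose d : ℝ) * ((√(2 * Real.pi * d) * (d / Real.exp 1) ^ d) * (√(2 * Real.pi * e) * (e / Real.exp 1) ^ e)) ≤
      Real.exp 1 * √n * (n / Real.exp 1) ^ n := by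
    refine le_trans ?_ l3
    rw [← hc]
    gcongr
  have e1 : √(2 * Real.pi * d) * √(2 * Real.pi * e) = 2 * Real.pi * √(d * e) := by
    rw [← Real.sqrt_mul (by positivity)]
    rw [show 2 * Real.pi * d * (2 * Real.pi * e) = (2 * Real.pi)^2 * (d * e : ℝ) by ring]
    rw [Real.sqrt_mul (by positivity), Real.sqrt_sq (by positivity)]
  have e2 : (n.choose d : ℝ) * ((√(2 * Real.pi * d) * (d / Real.exp 1) ^ d) * (√(2 * Real.pi * e) * (e / Real.exp 1) ^ e))
      = (n.choose d : ℝ) * (d:ℝ) ^ d * (e : ℝ) ^ e * √(d * e) * (2 * Real.pi) / Real.exp 1 ^ n := by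
    rw [hn, pow_add, div_pow, div_pow]
    have : √(2 * Real.pi * d) * √(2 * Real.pi * e) = 2 * Real.pi * √(d * e) := e1
    field_simp
    linear_combination (((d+e).choose d : ℝ)) * this
  rw [e2, div_pow, div_le_iff₀ (by positivity)] at key
  have e3 : Real.exp 1 * √n * ((n:ℝ)^n / Real.exp 1 ^ n) * Real.exp 1 ^ n = Real.exp 1 * √n * (n:ℝ)^n := by
    field_simp
  rw [e3] at key
  have hpi : Real.exp 1 ≤ 2 * Real.pi := by
    have := Real.exp_one_lt_d9
    have := Real.pi_gt_three
    linarith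
  have k2 : (n.choose d : ℝ) * (d:ℝ) ^ d * (e : ℝ) ^ e * √(d * e) * (2 * Real.pi) ≤ ((n:ℝ) ^ n * √n) * (2 * Real.pi) := by
    refine key.trans ?_
    have : 0 ≤ √n * (n:ℝ)^n := by positivity
    nlinarith
  exact le_of_mul_le_mul_right k2 (by positivity)

lemma choose_id (n d : ℕ) (h1 : 1 ≤ d) (h2 : d < n) :
    (n - 2).choose (d - 1) * (n * (n - 1)) = n.choose d * (d * (n - d)) := by
  obtain ⟨d, rfl⟩ : ∃ k, d = k + 1 := ⟨d - 1, by omega⟩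
  obtain ⟨m, rfl⟩ : ∃ m, n = m + 2 := ⟨n - 2, by omega⟩
  have a := Nat.add_one_mul_choose_eq (m+1) d
  have b := Nat.choose_mul_succ_eq m d
  simp only [Nat.add_sub_cancel, Nat.succ_eq_add_one] at *
  have : m + 2 - (d+1) = m + 1 - d := by omega
  rw [this, show m + 2 - 1 = m + 1 by omega]
  calc m.choose d * ((m+2)*(m+1)) = (m+2) * (m.choose d * (m+1)) := by ring
    _ = ((m+1+1) * (m+1).choose d) * (m+1-d) := by rw [b]; ring
    _ = _ := by rw [a]; ring

lemma W_real {n : ℕ} (x z : Fin n) (hxz : x < z) (d : ℕ) (hd : d = z.val - x.val) :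
    (cnt (n - 2) (Equiv.swap x z * (finRotate n)⁻¹) : ℝ) * ((n - d : ℕ) : ℝ) ≤
      (n:ℝ) ^ n / (n * (n-1 : ℕ)) * (√n / (d * √d * √(n-d : ℕ))) := by
  have hx : x.val < z.val := hxz
  have hz := z.isLt
  have h1 : 1 ≤ d := by omega
  have h2 : d < n := by omega
  have hW := W_bound x z hxz
  rw [← hd] at hW
  have hb := b_bound n d h1 h2
  have hc := choose_id n d h1 h2
  set W := cnt (n - 2) (Equiv.swap x z * (finRotate n)⁻¹)
  set e := n - d with he
  have hd0 : (0:ℝ) < d := by exact_mod_cast h1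
  have he0 : (0:ℝ) < e := by exact_mod_cast (show 0 < e by omega)
  have hn0 : (0:ℝ) < n := by exact_mod_cast (show 0 < n by omega)
  have hn1 : (0:ℝ) < (n - 1 : ℕ) := by exact_mod_cast (show 0 < n - 1 by omega)
  have k1 : W * (d * e) * (n * (n-1)) ≤ n.choose d * (d ^ d * e ^ e) := by
    calc W * (d * e) * (n * (n-1)) ≤ ((n-2).choose (d-1) * (d ^ (d-1) * e ^ (e-1))) * (n * (n-1)) := Nat.mul_le_mul_right _ hW
      _ = ((n-2).choose (d-1) * (n * (n-1))) * (d ^ (d-1) * e ^ (e-1)) := by ring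
      _ = n.choose d * ((d ^ (d-1) * d) * (e ^ (e-1) * e)) := by rw [hc]; ring
      _ = _ := by rw [← pow_succ, ← pow_succ, Nat.sub_add_cancel h1, Nat.sub_add_cancel (by omega : 1 ≤ e)]
  have k2 : (W:ℝ) * (d * e) * (n * (n-1 : ℕ)) ≤ n.choose d * ((d:ℝ) ^ d * (e:ℝ) ^ e) := by exact_mod_cast k1
  have k3 : (W:ℝ) * (d * e) * (n * (n-1 : ℕ)) * √(d * e) ≤ (n:ℝ) ^ n * √n := by
    refine le_trans ?_ hb
    refine le_trans (mul_le_mul_of_nonneg_right k2 (Real.sqrt_nonneg _)) (le_of_eq (by ring))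
  rw [Real.sqrt_mul hd0.le] at k3
  rw [div_mul_div_comm, le_div_iff₀ (by positivity)]
  refine le_trans (le_of_eq ?_) k3
  ring

lemma sum_inv_sqrt (m : ℕ) : ∑ k ∈ Finset.range m, 1 / √((k+1 : ℕ) : ℝ) ≤ 2 * √m := by
  induction m with
  | zero => simp
  | succ m ih =>
    rw [Finset.sum_range_succ]
    have h : 1 / √((m+1 : ℕ) : ℝ) ≤ 2 * (√((m+1 : ℕ) : ℝ) - √m) := by
      have hp : 0 < √((m+1 : ℕ) : ℝ) := by positivity
      rw [div_le_iff₀ hp]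
      have a := Real.sq_sqrt (show (0:ℝ) ≤ ((m+1:ℕ):ℝ) by positivity)
      have b := Real.sq_sqrt (show (0:ℝ) ≤ (m:ℝ) by positivity)
      push_cast at *
      nlinarith [sq_nonneg (√((m:ℝ)+1) - √m)]
    linarith

end

section

lemma pair_sum (n : ℕ) (G : ℕ → ℝ) (hG : ∀ d, 0 ≤ G d) :
    ∑ p ∈ (Finset.univ : Finset (Fin n × Fin n)).filter (fun p => p.1 < p.2), G (p.2.val - p.1.val) ≤
      ∑ d ∈ Finset.range n, ((n - d : ℕ) : ℝ) * G d := by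
  rw [← Finset.sum_fiberwise_of_maps_to (t := Finset.range n) (g := fun p => p.2.val - p.1.val)]
  · apply Finset.sum_le_sum
    intro d hd
    rw [Finset.sum_congr rfl (g := fun _ => G d)]
    · rw [Finset.sum_const, nsmul_eq_mul]
      apply mul_le_mul_of_nonneg_right _ (hG d)
      norm_cast
      rw [← Finset.card_range (n - d)]
      apply Finset.card_le_card_of_injOn (fun p => p.1.val)
      · intro p hp
        simp at hp ⊢
        have := p.2.isLt
        have := p.1.isLt
        omega
      · intro p hp q hq h
        simp only [Finset.coe_filter, Set.mem_ofPred_eq, Finset.mem_filter, Fin.lt_def] at hp hq h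
        ext
        · exact h
        · omega
    · intro p hp
      simp at hp
      rw [hp.2]
  · intro p _
    have := p.2.isLt
    simp; omega

open scoped Classical in
lemma S_bound (n l : ℕ) (hn : 2 ≤ n) (hl : 1 ≤ l) :
    ((∑ t ∈ (swaps (Fin n)).filter (longT l), cnt (n - 2) (t * (finRotate n)⁻¹) : ℕ) : ℝ) ≤
      (FF n 0).card * (4 * (n / (l * √l))) := by
  have hl0 : (0:ℝ) < l := by exact_mod_cast hl
  have hn0 : (0:ℝ) < n := by exact_mod_cast (show 0 < n by omega)
  have hn1 : (0:ℝ) < (n - 1 : ℕ) := by exact_mod_cast (show 0 < n - 1 by omega)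
  let W : Fin n × Fin n → ℝ := fun p => cnt (n - 2) (Equiv.swap p.1 p.2 * (finRotate n)⁻¹)
  let A : ℝ := (n:ℝ) ^ n / (n * (n-1 : ℕ))
  let G : ℕ → ℝ := fun d => A * √n / (l * √l) * (1 / (((n - d : ℕ) : ℝ) * √(n - d : ℕ)))
  let S := (Finset.univ : Finset (Fin n × Fin n)).filter (fun p => p.1.val + l < p.2.val)
  have hG : ∀ d, 0 ≤ G d := fun d => by positivity
  have h1 : ((∑ t ∈ (swaps (Fin n)).filter (longT l), cnt (n - 2) (t * (finRotate n)⁻¹) : ℕ) : ℝ) ≤ ∑ p ∈ S, W p := by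
    push_cast
    rw [← Finset.sum_fiberwise_of_maps_to (s := S) (t := S.image (fun p => Equiv.swap p.1 p.2)) (g := fun p => Equiv.swap p.1 p.2)
      (fun p hp => Finset.mem_image_of_mem _ hp)]
    refine le_trans (Finset.sum_le_sum_of_subset_of_nonneg (t := S.image (fun p => Equiv.swap p.1 p.2)) ?_ (fun _ _ _ => by positivity)) ?_
    · intro t ht
      rw [Finset.mem_filter, mem_swaps] at ht
      obtain ⟨⟨a, b, hab, rfl⟩, i, hi⟩ := ht
      rw [swap_val] at hi
      rw [Finset.mem_image]
      rcases lt_or_gt_of_ne (show a.val ≠ b.val from fun h => hab (Fin.ext h)) with h | h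
      · refine ⟨(a, b), ?_, rfl⟩
        simp only [S, Finset.mem_filter, Finset.mem_univ, true_and]
        split_ifs at hi <;> omega
      · refine ⟨(b, a), ?_, Equiv.swap_comm _ _⟩
        simp only [S, Finset.mem_filter, Finset.mem_univ, true_and]
        split_ifs at hi <;> omega
    · apply Finset.sum_le_sum
      intro t ht
      obtain ⟨p, hp, rfl⟩ := Finset.mem_image.1 ht
      exact Finset.single_le_sum (f := W) (s := S.filter (fun q => Equiv.swap q.1 q.2 = Equiv.swap p.1 p.2)) (fun _ _ => by positivity)
        (by rw [Finset.mem_filter]; exact ⟨hp, rfl⟩)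
  have h2 : ∑ p ∈ S, W p ≤ ∑ p ∈ S, G (p.2.val - p.1.val) := by
    apply Finset.sum_le_sum
    intro p hp
    simp only [S, Finset.mem_filter, Finset.mem_univ, true_and] at hp
    have hlt : p.1 < p.2 := by rw [Fin.lt_def]; omega
    have := W_real p.1 p.2 hlt _ rfl
    set d := p.2.val - p.1.val
    have hd : l ≤ d := by omega
    have hdn : d < n := by have := p.2.isLt; omega
    have he0 : (0:ℝ) < (n - d : ℕ) := by exact_mod_cast (show 0 < n - d by omega)
    have hW : W p ≤ A * (√n / (d * √d * √(n-d : ℕ))) / (n - d : ℕ) := by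
      rw [le_div_iff₀ he0]; exact this
    refine hW.trans ?_
    have hld : (l:ℝ) ≤ d := by exact_mod_cast hd
    have : A * (√n / (d * √d * √(n-d : ℕ))) / (n - d : ℕ) ≤ A * (√n / (l * √l * √(n-d : ℕ))) / (n - d : ℕ) := by
      gcongr
    refine this.trans (le_of_eq ?_)
    simp only [G]
    field_simp
  have h3 : ∑ p ∈ S, G (p.2.val - p.1.val) ≤ ∑ d ∈ Finset.range n, ((n - d : ℕ) : ℝ) * G d := by
    refine le_trans ?_ (pair_sum n G hG)
    apply Finset.sum_le_sum_of_subset_of_nonneg _ (fun _ _ _ => hG _)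
    intro p hp
    simp only [S, Finset.mem_filter, Finset.mem_univ, true_and, Fin.lt_def] at hp ⊢
    omega
  have h4 : ∑ d ∈ Finset.range n, ((n - d : ℕ) : ℝ) * G d = A * √n / (l * √l) * ∑ k ∈ Finset.range n, 1 / √((k+1 : ℕ) : ℝ) := by
    rw [← Finset.sum_range_reflect (fun k => 1 / √((k+1 : ℕ) : ℝ)), Finset.mul_sum]
    apply Finset.sum_congr rfl
    intro d hd
    rw [Finset.mem_range] at hd
    have he0 : (0:ℝ) < (n - d : ℕ) := by exact_mod_cast (show 0 < n - d by omega)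
    rw [show n - 1 - d + 1 = n - d by omega]
    simp only [G]
    field_simp
  have h5 : A ≤ 2 * (FF n 0).card := by
    have hc : ((FF n 0).card : ℝ) * n = (n:ℝ) ^ (n-1) := by exact_mod_cast card_FF_zero n (by omega)
    have : (n:ℝ)^n = (FF n 0).card * n * n := by
      rw [hc, ← pow_succ, Nat.sub_add_cancel (by omega)]
    simp only [A]
    rw [this, div_le_iff₀ (by positivity)]
    have h2 : (n:ℝ) ≤ 2 * (n-1 : ℕ) := by exact_mod_cast (show n ≤ 2 * (n-1) by omega)
    have h0 : (0:ℝ) ≤ (FF n 0).card * n := by positivity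
    nlinarith
  have h6 := sum_inv_sqrt n
  calc _ ≤ A * √n / (l * √l) * ∑ k ∈ Finset.range n, 1 / √((k+1 : ℕ) : ℝ) := by
        rw [← h4]; exact h1.trans (h2.trans h3)
    _ ≤ (2 * (FF n 0).card) * √n / (l * √l) * (2 * √n) := by gcongr
    _ = (FF n 0).card * (4 * ((√n * √n) / (l * √l))) := by ring
    _ = _ := by rw [Real.mul_self_sqrt hn0.le]

open scoped Classical in
lemma N_sum (n l : ℕ) (hn : 2 ≤ n) (hl : 1 ≤ l) :
    ((∑ F ∈ FF n 0, Nl l F : ℕ) : ℝ) ≤ n * ((FF n 0).card * (4 * (n / (l * √l)))) := by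
  have h1 : ∑ F ∈ FF n 0, Nl l F ≤ n * ∑ t ∈ (swaps (Fin n)).filter (longT l), cnt (n - 2) (t * (finRotate n)⁻¹) := by
    have : ∑ F ∈ FF n 0, Nl l F = ∑ u ∈ Finset.range (n-1), ((FF n 0).filter (fun F => longT l (Tch F u))).card := by
      simp only [Finset.card_filter]
      rw [Finset.sum_comm]
      apply Finset.sum_congr rfl
      intro F hF
      rw [Nl, (mem_FF.1 hF).1, Finset.card_filter]; rfl
    rw [this]
    calc _ ≤ ∑ u ∈ Finset.range (n-1), ∑ t ∈ (swaps (Fin n)).filter (longT l), cnt (n - 2) (t * (finRotate n)⁻¹) := by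
          apply Finset.sum_le_sum
          intro u hu
          rw [Finset.mem_range] at hu
          have := chord_count (n-2) u (by omega) (finRotate n)⁻¹ (longT l)
          rw [show n - 2 + 1 = n - 1 + 2 * 0 by omega] at this
          exact this
      _ ≤ _ := by
        rw [Finset.sum_const, Finset.card_range, smul_eq_mul]
        exact Nat.mul_le_mul_right _ (by omega)
  have h2 := S_bound n l hn hl
  have h3 : ((∑ F ∈ FF n 0, Nl l F : ℕ) : ℝ) ≤ n * ((∑ t ∈ (swaps (Fin n)).filter (longT l), cnt (n - 2) (t * (finRotate n)⁻¹) : ℕ) : ℝ) := by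
    exact_mod_cast h1
  refine h3.trans ?_
  gcongr

open scoped Classical in
lemma genus0_count (n K l : ℕ) (hn : 2 ≤ n) (hK : 1 ≤ K) (hl : 1 ≤ l) (r : ℕ) (hr : l * K ≤ r) :
    (((FF n 0).filter (fun F => ¬ (K * (Bad r F).ncard ≤ 4 * n))).card : ℝ) ≤ (FF n 0).card * (4 * K * (n / (l * √l))) := by
  have h1 : n * ((FF n 0).filter (fun F => ¬ (K * (Bad r F).ncard ≤ 4 * n))).card ≤ K * ∑ F ∈ FF n 0, Nl l F := by
    rw [Finset.mul_sum]
    calc _ = ∑ F ∈ (FF n 0).filter (fun F => ¬ (K * (Bad r F).ncard ≤ 4 * n)), n := by simp [mul_comm]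
      _ ≤ ∑ F ∈ (FF n 0).filter (fun F => ¬ (K * (Bad r F).ncard ≤ 4 * n)), K * Nl l F := by
        apply Finset.sum_le_sum
        intro F hF
        rw [Finset.mem_filter] at hF
        obtain ⟨hF, hb⟩ := hF
        by_contra hc
        apply hb
        push Not at hc
        have h := bad_bound F (mem_FF.1 hF).2.1 K l r hr
        rw [(mem_FF.1 hF).1] at h
        have h' := Nat.mul_le_mul_left K h
        have h3 : (K+1) * (K * (Bad r F).ncard) ≤ (K+1) * (4 * n) := by
          calc _ = K * ((K+1) * (Bad r F).ncard) := by ring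
            _ ≤ _ := h'
            _ = K * (2 * (n - 1)) + (K+1) * 2 * (K * Nl l F) := by ring
            _ ≤ (K+1) * (2 * n) + (K+1) * 2 * n := by
              gcongr <;> omega
            _ = _ := by ring
        exact Nat.le_of_mul_le_mul_left h3 (by omega)
      _ ≤ _ := Finset.sum_le_sum_of_subset (Finset.filter_subset _ _)
  have h2 := N_sum n l hn hl
  have hn0 : (0:ℝ) < n := by exact_mod_cast (show 0 < n by omega)
  have h3 : (n:ℝ) * ((FF n 0).filter (fun F => ¬ (K * (Bad r F).ncard ≤ 4 * n))).card ≤ K * ((∑ F ∈ FF n 0, Nl l F : ℕ) : ℝ) := by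
    exact_mod_cast h1
  have h4 : (n:ℝ) * ((FF n 0).filter (fun F => ¬ (K * (Bad r F).ncard ≤ 4 * n))).card ≤ n * ((FF n 0).card * (4 * K * (n / (l * √l)))) := by
    refine h3.trans ?_
    refine (mul_le_mul_of_nonneg_left h2 (by positivity)).trans (le_of_eq (by ring))
  exact le_of_mul_le_mul_left h4 hn0

open scoped Classical in
open Filter in
lemma genus0 (K : ℕ) (hK : 1 ≤ K) (η : ℝ) (hη : 0 < η) :
    ∀ᶠ n : ℕ in atTop, (((FF n 0).filter (fun F => ¬ (K * (Bad (n / K) F).ncard ≤ 4 * n))).card : ℝ) ≤ η * (FF n 0).card := by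
  have hK0 : (0:ℝ) < K := by exact_mod_cast hK
  -- l = n / (K*K)
  have hlim : Tendsto (fun n : ℕ => n / (K*K)) atTop atTop := Nat.tendsto_div_const_atTop (by positivity)
  have hs : Tendsto (fun n : ℕ => √((n / (K*K) : ℕ) : ℝ)) atTop atTop :=
    Real.tendsto_sqrt_atTop.comp (tendsto_natCast_atTop_atTop.comp hlim)
  filter_upwards [hlim.eventually_ge_atTop 1, hs.eventually_ge_atTop (8 * K ^ 3 / η), eventually_ge_atTop 2] with n h1 h2 hn
  set l := n / (K*K) with hl
  have hr : l * K ≤ n / K := by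
    rw [Nat.le_div_iff_mul_le (by omega), mul_assoc]
    exact Nat.div_mul_le_self _ _
  refine (genus0_count n K l hn hK h1 (n / K) hr).trans ?_
  rw [mul_comm η]
  gcongr
  have hl0 : (0:ℝ) < l := by exact_mod_cast h1
  have hnl : (n:ℝ) ≤ 2 * (K*K) * l := by
    have : n ≤ 2 * (K*K) * l := by
      have := Nat.lt_mul_div_succ n (show 0 < K*K by positivity)
      rw [← hl] at this
      nlinarith [Nat.mul_le_mul_left (K*K) h1]
    exact_mod_cast this
  have hsl : 0 < √(l:ℝ) := by positivity
  have : (n:ℝ) / (l * √l) ≤ 2 * (K*K) / √l := by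
    rw [div_le_div_iff₀ (by positivity) (by positivity)]
    nlinarith
  calc 4 * K * ((n:ℝ) / (l * √l)) ≤ 4 * K * (2 * (K*K) / √l) := by gcongr
    _ = (8 * K^3) / √l := by ring
    _ ≤ η := by
      rw [div_le_iff₀ hsl]
      rw [div_le_iff₀ hη] at h2
      linarith

end

section

open scoped Classical in
noncomputable def PS (n : ℕ) : ℕ → Finset (List (Param n))
  | 0 => {[]}
  | i + 1 => (PS n i ×ˢ PF n (i+1)).image (fun q => q.1 ++ [q.2])

lemma paramsOK_snoc (n i : ℕ) (ps : List (Param n)) (p : Param n) :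
    paramsOK n (i+1) (ps ++ [p]) ↔ paramsOK n i ps ∧ paramOK n (i+1) p := by
  simp only [paramsOK, List.length_append, List.length_singleton, add_left_inj]
  constructor
  · rintro ⟨h1, h2⟩
    subst h1
    refine ⟨⟨rfl, ?_⟩, ?_⟩
    · intro j
      have := h2 ⟨j.val, by simp⟩
      simpa using this
    · have := h2 ⟨ps.length, by simp⟩
      simpa using this
  · rintro ⟨⟨h1, h2⟩, h3⟩
    subst h1
    refine ⟨rfl, ?_⟩
    intro j
    have hj := j.isLt
    simp only [List.length_append, List.length_singleton] at hj
    rcases Nat.lt_succ_iff_lt_or_eq.1 hj with h | h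
    · have := h2 ⟨j.val, h⟩
      simpa [List.getElem_append_left, h] using this
    · simp only [List.get_eq_getElem]
      rw [List.getElem_append_right (by omega)]
      simpa [h] using h3

lemma mem_PS {n i : ℕ} {ps : List (Param n)} : ps ∈ PS n i ↔ paramsOK n i ps := by
  classical
  induction i generalizing ps with
  | zero =>
    simp only [PS, Finset.mem_singleton, paramsOK]
    constructor
    · rintro rfl; simp
    · rintro ⟨h, -⟩; exact List.length_eq_zero_iff.1 h
  | succ i ih =>
    simp only [PS, Finset.mem_image, Finset.mem_product]
    constructor
    · rintro ⟨q, ⟨h1, h2⟩, rfl⟩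
      exact (paramsOK_snoc _ _ _ _).2 ⟨ih.1 h1, mem_PF.1 h2⟩
    · intro h
      have hne : ps ≠ [] := by rintro rfl; simp [paramsOK] at h
      rw [← List.dropLast_append_getLast hne, paramsOK_snoc] at h
      exact ⟨(ps.dropLast, ps.getLast hne), ⟨ih.2 h.1, mem_PF.2 h.2⟩, List.dropLast_append_getLast hne⟩

lemma snoc_inj {β : Type*} : Function.Injective (fun q : List β × β => q.1 ++ [q.2]) := by
  rintro ⟨a, b⟩ ⟨c, d⟩ h
  simp only at h
  obtain ⟨h1, h2⟩ := List.append_inj' h rfl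
  simp at h2
  rw [h1, h2]

lemma card_PS (n i : ℕ) : (PS n i).card = ∏ j ∈ Finset.range i, (PF n (j+1)).card := by
  classical
  induction i with
  | zero => simp [PS]
  | succ i ih => rw [PS, Finset.card_image_of_injective _ snoc_inj, Finset.card_product, ih, Finset.prod_range_succ]

lemma lamIter_snoc (n : ℕ) (ps : List (Param n)) (p : Param n) (y : Option (List (Equiv.Perm (Fin n)))) :
    lamIter n (ps ++ [p]) y = (lamIter n ps y).bind (fun F => lamDet n F p) := by
  induction ps generalizing y with
  | nil => rfl
  | cons q ps ih => rw [List.cons_append, lamIter, lamIter, ih]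

abbrev Hist (n : ℕ) := List (Equiv.Perm (Fin n)) × List (Param n)

noncomputable def outH {n : ℕ} (h : Hist n) : List (Equiv.Perm (Fin n)) := (lamIter n h.2 (some h.1)).getD []

open scoped Classical in
noncomputable def HG (n r s : ℕ) : ℕ → Finset (Hist n)
  | 0 => ((FF n 0).filter (fun F => (Bad r F).ncard ≤ s)).image (fun F => (F, []))
  | i + 1 => ((HG n r s i ×ˢ PF n (i+1)).filter (fun q => Good r (outH q.1) q.2)).image
      (fun q => (q.1.1, q.1.2 ++ [q.2]))

lemma outH_snoc {n i r : ℕ} (h : Hist n) (h1 : lamIter n h.2 (some h.1) = some (outH h)) (h2 : outH h ∈ FF n i)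
    (p : Param n) (hp : p ∈ PF n (i+1)) (hg : Good r (outH h) p) :
    lamIter n (h.2 ++ [p]) (some h.1) = some (outH (h.1, h.2 ++ [p])) ∧
    lamDet n (outH h) p = some (outH (h.1, h.2 ++ [p])) ∧ outH (h.1, h.2 ++ [p]) ∈ FF n (i+1) := by
  obtain ⟨x, σ, hx, hx2, -⟩ := good_out (outH h) h2 p hp hg
  have e : lamIter n (h.2 ++ [p]) (some h.1) = some x := by
    rw [lamIter_snoc, h1]; exact hx
  have e2 : outH (h.1, h.2 ++ [p]) = x := by rw [outH]; simp only [e, Option.getD_some]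
  rw [e2]
  exact ⟨e, hx, hx2⟩

lemma HG_inv {n r s i : ℕ} (h : Hist n) (hh : h ∈ HG n r s i) :
    h.1 ∈ FF n 0 ∧ paramsOK n i h.2 ∧ lamIter n h.2 (some h.1) = some (outH h) ∧ outH h ∈ FF n i ∧
    (Bad r (outH h)).ncard ≤ s + i * (3 * (4 * r + 1)) := by
  classical
  induction i generalizing h with
  | zero =>
    simp only [HG, Finset.mem_image, Finset.mem_filter] at hh
    obtain ⟨F, ⟨h1, h2⟩, rfl⟩ := hh
    refine ⟨h1, by simp [paramsOK], rfl, h1, ?_⟩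
    have e : outH ((F, []) : Hist n) = F := rfl
    rw [e]; simpa using h2
  | succ i ih =>
    simp only [HG, Finset.mem_image, Finset.mem_filter, Finset.mem_product] at hh
    obtain ⟨⟨h, p⟩, ⟨⟨h1, h2⟩, h3⟩, rfl⟩ := hh
    simp only at h1 h2 h3 ⊢
    obtain ⟨a1, a2, a3, a4, a5⟩ := ih h h1
    obtain ⟨b1, b2, b3⟩ := outH_snoc h a3 a4 p h2 h3
    refine ⟨a1, (paramsOK_snoc _ _ _ _).2 ⟨a2, mem_PF.1 h2⟩, b1, b3, ?_⟩
    have := bad_step _ a4 p h2 h3 _ b2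
    rw [add_mul]; omega

open scoped Classical in
lemma HG_fiber {n r s i : ℕ} (hn : 1 ≤ n) (x : List (Equiv.Perm (Fin n))) :
    ((HG n r s i).filter (fun h => outH h = x)).card ≤ 2 ^ i * i.factorial := by
  induction i generalizing x with
  | zero =>
    simp only [pow_zero, Nat.factorial_zero, mul_one]
    rw [Finset.card_le_one]
    intro a ha b hb
    simp only [HG, Finset.mem_image, Finset.mem_filter] at ha hb
    obtain ⟨⟨F, -, rfl⟩, h1⟩ := ha
    obtain ⟨⟨F', -, rfl⟩, h2⟩ := hb
    have : F = x := h1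
    have : F' = x := h2
    simp_all
  | succ i ih =>
    rw [HG, Finset.filter_image]
    refine Finset.card_image_le.trans ?_
    have := fiber_card (i := i) (r := r) hn x
    refine (Finset.card_le_mul_card_image_of_maps_to (f := fun q : Hist n × Param n => (outH q.1, q.2)) 
      (t := (FF n i ×ˢ PF n (i + 1)).filter
      (fun q => Good r q.1 q.2 ∧ lamDet n q.1 q.2 = some x)) ?_ (2 ^ i * i.factorial) ?_).trans ?_
    · intro q hq
      simp only [Finset.mem_filter, Finset.mem_product] at hq ⊢
      obtain ⟨⟨⟨h1, h2⟩, h3⟩, h4⟩ := hq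
      obtain ⟨a1, a2, a3, a4, a5⟩ := HG_inv _ h1
      obtain ⟨b1, b2, b3⟩ := outH_snoc q.1 a3 a4 q.2 h2 h3
      refine ⟨⟨a4, h2⟩, h3, ?_⟩
      rw [b2, h4]
    · intro b hb
      refine le_trans ?_ (ih b.1)
      apply Finset.card_le_card_of_injOn (fun q => q.1)
      · intro q hq
        simp only [Finset.coe_filter, Set.mem_ofPred_eq, Finset.mem_filter, Finset.mem_product] at hq ⊢
        exact ⟨hq.1.1.1.1, by rw [← hq.2]⟩
      · intro q hq q' hq' h
        simp only [Finset.coe_filter, Set.mem_ofPred_eq] at hq hq'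
        ext1
        · exact h
        · have := hq.2.trans hq'.2.symm
          exact (Prod.ext_iff.1 this).2
    · calc _ ≤ 2 ^ i * i.factorial * (2 * (i+1)) := Nat.mul_le_mul_left _ this
        _ = _ := by rw [pow_succ, Nat.factorial_succ]; ring

lemma HG_size {n r s i : ℕ} (hn : 1 ≤ n) :
    (HG n r s i).card * (PF n (i+1)).card ≤ (HG n r s (i+1)).card +
      (HG n r s i).card * ((WF (n - 1 + 2 * (i + 1))).card * ((3 * (s + i * (3 * (4 * r + 1))) + 2 * i + 1 + 40 * r) * n ^ 2)) := by
  classical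
  rw [HG, Finset.card_image_of_injective]
  · rw [← Finset.card_product, ← Finset.card_filter_add_card_filter_not (s := HG n r s i ×ˢ PF n (i+1)) (fun q => Good r (outH q.1) q.2)]
    apply Nat.add_le_add_left
    rw [mul_comm (HG n r s i).card]
    apply Finset.card_le_mul_card_image_of_maps_to (f := fun q => q.1)
    · intro q hq
      simp only [Finset.mem_filter, Finset.mem_product] at hq
      exact hq.1.1
    · intro h hh
      obtain ⟨a1, a2, a3, a4, a5⟩ := HG_inv _ hh
      refine le_trans ?_ (card_notgood hn (outH h) a4 a5)
      apply Finset.card_le_card_of_injOn (fun q => q.2)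
      · intro q hq
        simp only [Finset.coe_filter, Set.mem_ofPred_eq, Finset.mem_filter, Finset.mem_product] at hq ⊢
        obtain ⟨⟨⟨b1, b2⟩, b3⟩, rfl⟩ := hq
        exact ⟨b2, b3⟩
      · intro q hq q' hq' e
        simp only [Finset.coe_filter, Set.mem_ofPred_eq] at hq hq'
        ext1
        · rw [hq.2, hq'.2]
        · exact e
  · rintro ⟨⟨a, b⟩, c⟩ ⟨⟨a', b'⟩, c'⟩ h
    simp only [Prod.mk.injEq] at h
    have := @snoc_inj _ (b, c) (b', c') h.2
    simp_all

end

section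

noncomputable def kap (n g : ℕ) : ℝ := ((n:ℝ) ^ 3 / (6 * (n.choose 3 : ℝ))) ^ g

lemma fact_prod (n g : ℕ) : n.factorial * (∏ j ∈ Finset.range g, (n + 2 * (j+1)).choose 2) * 2 ^ g = (n + 2 * g).factorial := by
  induction g with
  | zero => simp
  | succ g ih =>
    rw [Finset.prod_range_succ, pow_succ]
    have h : (n + 2 * (g+1)).choose 2 * 2 = (n + 2 * g + 2) * (n + 2 * g + 1) := by
      rw [Nat.choose_two_right, show n + 2 * (g+1) = n + 2 * g + 2 by ring]
      rw [Nat.div_mul_cancel]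
      · simp
      · exact (Nat.even_mul_pred_self _).two_dvd
    rw [show n + 2 * (g+1) = n + 2 * g + 1 + 1 by ring, Nat.factorial_succ, Nat.factorial_succ, ← ih]
    rw [show n + 2 * (g+1) = n + 2 * g + 1 + 1 by ring] at h
    calc _ = n.factorial * (∏ j ∈ Finset.range g, (n + 2 * (j+1)).choose 2) * 2 ^ g * ((n + 2 * g + 1 + 1).choose 2 * 2) := by ring
      _ = _ := by rw [h]; ring

lemma kap_bound (n g : ℕ) (hn : 3 ≤ n) :
    ((FF n g).card : ℝ) * (2 ^ g * (g.factorial : ℝ)) ≤ kap n g * ((FF n 0).card * (PS n g).card) := by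
  have hX : (0:ℝ) < n.choose 3 := by exact_mod_cast Nat.choose_pos hn
  set X : ℝ := ((n.choose 3 : ℕ) : ℝ)
  set Q : ℝ := ∏ j ∈ Finset.range g, ((n - 1 + 2 * (j+1)).choose 2 : ℝ) with hQ
  have hn0 : (0:ℝ) < n := by exact_mod_cast (show 0 < n by omega)
  have h1 : Q * X ^ g ≤ (PS n g).card := by
    rw [card_PS, hQ]
    have : X ^ g = ∏ j ∈ Finset.range g, X := by simp
    rw [this, ← Finset.prod_mul_distrib]
    push_cast
    apply Finset.prod_le_prod
    · intro i _; positivity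
    · intro i _
      rw [PF_eq, Finset.card_product]
      push_cast
      have a := card_WF_ge (n - 1 + 2 * (i+1))
      have b := card_TF_ge n
      have b2 : X ≤ (TF n).card := by simp only [X]; exact_mod_cast b
      gcongr
  have h2 : ((n-1).factorial : ℝ) * Q * 2 ^ g = (n - 1 + 2 * g).factorial := by
    rw [hQ]; exact_mod_cast fact_prod (n-1) g
  have h3 := card_FF_le n g (by omega)
  have h4 : ((FF n 0).card : ℝ) * n = (n:ℝ) ^ (n-1) := by exact_mod_cast card_FF_zero n (by omega)
  have h5 : (n.factorial : ℝ) = n * (n-1).factorial := by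
    exact_mod_cast (Nat.mul_factorial_pred (by omega)).symm
  have hf : (0:ℝ) < (n-1).factorial := by exact_mod_cast Nat.factorial_pos _
  rw [← h2, h5, pow_add, ← h4] at h3
  have h6 : ((FF n g).card : ℝ) * (24 ^ g * (g.factorial : ℝ)) ≤ (FF n 0).card * (n:ℝ) ^ (3 * g) * Q * 2 ^ g := by
    apply le_of_mul_le_mul_right _ (mul_pos hn0 hf)
    calc _ = ((FF n g).card : ℝ) * (n * (n-1).factorial) * (24 ^ g * (g.factorial : ℝ)) := by ring
      _ ≤ _ := h3
      _ = _ := by rw [show 3 * g = 2 * g + g by ring, pow_add]; ring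
  have e24 : (24:ℝ) ^ g = 2 ^ g * 2 ^ g * 6 ^ g := by
    rw [← mul_pow, ← mul_pow]; norm_num
  have h7 : ((FF n g).card : ℝ) * (2 ^ g * (g.factorial : ℝ)) ≤ (FF n 0).card * (n:ℝ) ^ (3 * g) * Q / 6 ^ g := by
    rw [le_div_iff₀ (by positivity)]
    apply le_of_mul_le_mul_right _ (show (0:ℝ) < 2 ^ g by positivity)
    rw [e24] at h6
    refine le_trans (le_of_eq (by ring)) h6
  refine h7.trans ?_
  have : (FF n 0).card * (n:ℝ) ^ (3 * g) * Q / 6 ^ g = kap n g * ((FF n 0).card * (Q * X ^ g)) := by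
    rw [kap, div_pow, mul_pow, ← pow_mul]
    have : X ≠ 0 := hX.ne'
    change _ = _ / (6 ^ g * X ^ g) * _
    field_simp
  rw [this]
  have : 0 ≤ kap n g := by unfold kap; positivity
  gcongr

lemma kap_ge (n g : ℕ) (hn : 3 ≤ n) : 1 ≤ kap n g := by
  have hX : (0:ℝ) < n.choose 3 := by exact_mod_cast Nat.choose_pos hn
  apply one_le_pow₀
  rw [le_div_iff₀ (by positivity), one_mul]
  have := @Nat.choose_le_pow_div ℝ _ _ _ 3 n
  rw [le_div_iff₀ (by positivity)] at this
  norm_num [Nat.factorial] at this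
  linarith

lemma HG_card (n r s g : ℕ) (hn : 3 ≤ n) (θ : ℝ)
    (hθ : ((3 * (s + g * (3 * (4 * r + 1))) + 2 * g + 1 + 40 * r : ℕ) : ℝ) * (n:ℝ) ^ 2 ≤ θ * n.choose 3) (hθ1 : θ ≤ 1) :
    ((HG n r s 0).card : ℝ) * (PS n g).card * (1 - θ) ^ g ≤ (HG n r s g).card := by
  have key : ∀ i ≤ g, ((HG n r s 0).card : ℝ) * (PS n i).card * (1 - θ) ^ i ≤ (HG n r s i).card := by
    intro i hi
    induction i with
    | zero => simp [PS]
    | succ i ih =>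
      have ih := ih (by omega)
      have h := @HG_size n r s i (by omega)
      have hR : ((HG n r s i).card : ℝ) * (PF n (i+1)).card ≤ (HG n r s (i+1)).card +
          (HG n r s i).card * ((WF (n - 1 + 2 * (i + 1))).card * (((3 * (s + i * (3 * (4 * r + 1))) + 2 * i + 1 + 40 * r : ℕ) : ℝ) * (n:ℝ) ^ 2)) := by
        exact_mod_cast h
      have hθ0 : 0 ≤ θ := by
        have hX : (0:ℝ) < n.choose 3 := by exact_mod_cast Nat.choose_pos hn
        by_contra hc
        push Not at hc
        have : θ * n.choose 3 < 0 := mul_neg_of_neg_of_pos hc hX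
        have : 0 ≤ ((3 * (s + g * (3 * (4 * r + 1))) + 2 * g + 1 + 40 * r : ℕ) : ℝ) * (n:ℝ) ^ 2 := by positivity
        linarith
      have c1 : ((3 * (s + i * (3 * (4 * r + 1))) + 2 * i + 1 + 40 * r : ℕ) : ℝ) * (n:ℝ) ^ 2 ≤ θ * (TF n).card := by
        have : ((3 * (s + i * (3 * (4 * r + 1))) + 2 * i + 1 + 40 * r : ℕ) : ℝ) ≤ ((3 * (s + g * (3 * (4 * r + 1))) + 2 * g + 1 + 40 * r : ℕ) : ℝ) := by
          have : i ≤ g := by omega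
          have h2 : i * (3 * (4 * r + 1)) ≤ g * (3 * (4 * r + 1)) := Nat.mul_le_mul_right _ this
          exact_mod_cast (by omega)
        calc _ ≤ _ := mul_le_mul_of_nonneg_right this (by positivity)
          _ ≤ _ := hθ
          _ ≤ _ := mul_le_mul_of_nonneg_left (by exact_mod_cast card_TF_ge n) hθ0
      have c2 : ((PF n (i+1)).card : ℝ) = (WF (n - 1 + 2 * (i + 1))).card * (TF n).card := by
        rw [PF_eq, Finset.card_product]; push_cast; ring
      have c3 : ((HG n r s i).card : ℝ) * ((WF (n - 1 + 2 * (i + 1))).card * (((3 * (s + i * (3 * (4 * r + 1))) + 2 * i + 1 + 40 * r : ℕ) : ℝ) * (n:ℝ) ^ 2))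
          ≤ (HG n r s i).card * ((PF n (i+1)).card * θ) := by
        rw [c2]
        apply mul_le_mul_of_nonneg_left _ (by positivity)
        rw [mul_assoc]
        apply mul_le_mul_of_nonneg_left _ (by positivity)
        linarith
      have c4 : ((HG n r s i).card : ℝ) * ((PF n (i+1)).card * (1 - θ)) ≤ (HG n r s (i+1)).card := by
        nlinarith
      refine le_trans ?_ c4
      have e : ((PS n (i+1)).card : ℝ) = (PS n i).card * (PF n (i+1)).card := by
        rw [card_PS, card_PS, Finset.prod_range_succ]; push_cast; ring
      rw [e, pow_succ]
      calc _ = ((HG n r s 0).card : ℝ) * (PS n i).card * (1 - θ) ^ i * ((PF n (i+1)).card * (1 - θ)) := by ring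
        _ ≤ _ := mul_le_mul_of_nonneg_right ih (mul_nonneg (by positivity) (by linarith))
  exact key g le_rfl

end

section

open scoped Classical in
lemma tv_bound (n r s g : ℕ) (hn : 3 ≤ n) (hpos : 0 < (HG n r s g).card) :
    dTV (lamIterDist n g) (unifF n g) ≤ kap n g - (HG n r s g).card / ((FF n 0).card * (PS n g).card) := by
  obtain ⟨h0, hh0⟩ := Finset.card_pos.1 hpos
  obtain ⟨a1, a2, a3, a4, a5⟩ := HG_inv _ hh0
  have p0 : (0:ℝ) < (FF n 0).card := by exact_mod_cast Finset.card_pos.2 ⟨_, a1⟩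
  have pg : (0:ℝ) < (FF n g).card := by exact_mod_cast Finset.card_pos.2 ⟨_, a4⟩
  have pp : (0:ℝ) < (PS n g).card := by exact_mod_cast Finset.card_pos.2 ⟨_, mem_PS.2 a2⟩
  set M : ℝ := (FF n 0).card * (PS n g).card with hM
  have pM : 0 < M := mul_pos p0 pp
  let f : Hist n → Option (List (Equiv.Perm (Fin n))) := fun q => lamIter n q.2 (some q.1)
  let A := FF n 0 ×ˢ PS n g
  let T := A.image f ∪ (FF n g).image some
  have cA : (A.card : ℝ) = M := by simp [A, hM, Finset.card_product]
  have sub : HG n r s g ⊆ A := by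
    intro h hh
    obtain ⟨b1, b2, b3, b4, b5⟩ := HG_inv _ hh
    exact Finset.mem_product.2 ⟨b1, mem_PS.2 b2⟩
  have hμ : ∀ x, lamIterDist n g x = (A.filter (fun q => f q = x)).card / M := by
    intro x
    rw [lamIterDist]
    congr 1
    · rw [← Set.ncard_coe_finset]
      congr 2
      ext q
      simp only [Set.mem_ofPred_eq, Finset.coe_filter, A, f, Finset.mem_product, mem_PS, Fcal_eq, Finset.mem_coe]
      tauto
    · rw [hM, Fcal_eq, Set.ncard_coe_finset, ← Set.ncard_coe_finset (PS n g)]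
      congr 3
      ext ps
      simp [mem_PS]
  let ν : Option (List (Equiv.Perm (Fin n))) → ℝ := fun x => ((HG n r s g).filter (fun q => f q = x)).card / M
  have hνμ : ∀ x, ν x ≤ lamIterDist n g x := by
    intro x
    rw [hμ]
    simp only [ν]
    gcongr
  have hκ := kap_bound n g hn
  have hκ1 := kap_ge n g hn
  have hu0 : ∀ x, 0 ≤ unifF n g x := by
    intro x
    cases x with
    | none => exact le_rfl
    | some l => 
      simp only [unifF]
      exact Set.indicator_nonneg (fun _ _ => by positivity) _
  have hu : ∀ l ∈ FF n g, unifF n g (some l) = 1 / (FF n g).card := by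
    intro l hl
    simp only [unifF]
    rw [Set.indicator_of_mem (by rw [Fcal_eq]; exact hl), Fcal_eq, Set.ncard_coe_finset]
  have hu' : ∀ x, x ∉ (FF n g).image some → unifF n g x = 0 := by
    intro x hx
    cases x with
    | none => rfl
    | some l =>
      simp only [unifF]
      apply Set.indicator_of_notMem
      rw [Fcal_eq]
      simpa using hx
  have hνu : ∀ x, ν x ≤ kap n g * unifF n g x := by
    intro x
    by_cases hx : ∃ h ∈ HG n r s g, f h = x
    · obtain ⟨h, hh, rfl⟩ := hx
      obtain ⟨b1, b2, b3, b4, b5⟩ := HG_inv _ hh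
      have e : f h = some (outH h) := b3
      rw [e, hu _ b4]
      have c : ((HG n r s g).filter (fun q => f q = some (outH h))).card ≤ 2 ^ g * g.factorial := by
        refine le_trans (Finset.card_le_card ?_) (HG_fiber (r := r) (s := s) (i := g) (show 1 ≤ n by omega) (outH h))
        intro q hq
        rw [Finset.mem_filter] at hq ⊢
        refine ⟨hq.1, ?_⟩
        obtain ⟨_, _, d3, _, _⟩ := HG_inv _ hq.1
        have := hq.2
        simp only [f] at this
        rw [d3] at this
        exact Option.some.inj this
      have c' : (((HG n r s g).filter (fun q => f q = some (outH h))).card : ℝ) ≤ 2 ^ g * g.factorial := by exact_mod_cast c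
      simp only [ν]
      rw [mul_one_div, div_le_div_iff₀ pM pg]
      calc _ ≤ (2 ^ g * g.factorial : ℝ) * (FF n g).card := mul_le_mul_of_nonneg_right c' pg.le
        _ ≤ _ := by linarith
    · have : (HG n r s g).filter (fun q => f q = x) = ∅ := by
        rw [Finset.filter_eq_empty_iff]
        intro q hq h
        exact hx ⟨q, hq, h⟩
      simp only [ν, this]
      simp only [Finset.card_empty, Nat.cast_zero, zero_div]
      exact mul_nonneg (by linarith) (hu0 x)
  have sμ : ∑ x ∈ T, lamIterDist n g x = 1 := by
    simp only [hμ]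
    rw [← Finset.sum_div, ← Nat.cast_sum, ← Finset.card_eq_sum_card_fiberwise, cA, div_self pM.ne']
    intro q hq
    exact Finset.mem_union_left _ (Finset.mem_image_of_mem _ hq)
  have sν : ∑ x ∈ T, ν x = (HG n r s g).card / M := by
    simp only [ν]
    rw [← Finset.sum_div, ← Nat.cast_sum, ← Finset.card_eq_sum_card_fiberwise]
    intro q hq
    exact Finset.mem_union_left _ (Finset.mem_image_of_mem _ (sub hq))
  have su : ∑ x ∈ T, unifF n g x = 1 := by
    rw [← Finset.sum_subset (Finset.subset_union_right : (FF n g).image some ⊆ T) (fun x _ hx => hu' x hx),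
      Finset.sum_image (fun a _ b _ h => Option.some.inj h), Finset.sum_congr rfl hu]
    simp [pg.ne']
  rw [dTV, tsum_eq_sum (s := T)]
  · have : ∑ x ∈ T, |lamIterDist n g x - unifF n g x| ≤
        ∑ x ∈ T, ((lamIterDist n g x - ν x) + (kap n g * unifF n g x - ν x) + (kap n g * unifF n g x - unifF n g x)) := by
      apply Finset.sum_le_sum
      intro x _
      have := hνμ x
      have := hνu x
      have : unifF n g x ≤ kap n g * unifF n g x := by nlinarith [hu0 x]
      rw [abs_le]
      constructor <;> linarith
    rw [Finset.sum_add_distrib, Finset.sum_add_distrib, Finset.sum_sub_distrib, Finset.sum_sub_distrib, Finset.sum_sub_distrib,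
      ← Finset.mul_sum, sμ, sν, su] at this
    linarith
  · intro x hx
    have h1 : lamIterDist n g x = 0 := by
      rw [hμ]
      have : A.filter (fun q => f q = x) = ∅ := by
        rw [Finset.filter_eq_empty_iff]
        intro q hq h
        exact hx (Finset.mem_union_left _ (h ▸ Finset.mem_image_of_mem _ hq))
      rw [this]; simp
    rw [h1, hu' x (fun h => hx (Finset.mem_union_right _ h))]
    simp

end

section

open Filter Topology

lemma six_choose (n : ℕ) (hn : 3 ≤ n) : (6 * (n.choose 3 : ℝ)) = n * (n - 1) * (n - 2) := by
  obtain ⟨m, rfl⟩ : ∃ m, n = m + 3 := ⟨n - 3, by omega⟩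
  have h := Nat.descFactorial_eq_factorial_mul_choose (m+3) 3
  have h2 : 6 * (m+3).choose 3 = (m+3) * (m+2) * (m+1) := by
    have : Nat.factorial 3 = 6 := rfl
    rw [this] at h
    rw [← h]
    simp [Nat.descFactorial]
    ring
  have h3 : (6:ℝ) * ((m+3).choose 3 : ℕ) = (m+3) * (m+2) * (m+1) := by exact_mod_cast h2
  rw [h3]; push_cast; ring

lemma kap_tendsto (g : ℕ) : Tendsto (fun n => kap n g) atTop (𝓝 1) := by
  have h1 : Tendsto (fun n : ℕ => (1:ℝ) / n) atTop (𝓝 0) := tendsto_one_div_atTop_nhds_zero_nat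
  have h2 : Tendsto (fun n : ℕ => (1 / ((1 - (1:ℝ) / n) * (1 - 2 * ((1:ℝ) / n)))) ^ g) atTop (𝓝 ((1 / ((1 - 0) * (1 - 2 * 0))) ^ g)) := by
    apply Tendsto.pow
    apply Tendsto.div tendsto_const_nhds _ (by norm_num)
    exact (tendsto_const_nhds.sub h1).mul (tendsto_const_nhds.sub (h1.const_mul 2))
  rw [show ((1:ℝ) / ((1 - 0) * (1 - 2 * 0))) ^ g = 1 by norm_num] at h2
  refine h2.congr' ?_
  filter_upwards [eventually_ge_atTop 3] with n hn
  rw [kap, six_choose n hn]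
  congr 1
  have hn' : (3:ℝ) ≤ n := by exact_mod_cast hn
  have a : (n:ℝ) ≠ 0 := by linarith
  have b : (n:ℝ) - 1 ≠ 0 := by linarith
  have c : (n:ℝ) - 2 ≠ 0 := by linarith
  field_simp

open scoped Classical in
lemma main_ev (g : ℕ) (δ : ℝ) (hδ : 0 < δ) (hδ1 : (g+1) * δ < 1) :
    ∀ᶠ n : ℕ in atTop, dTV (lamIterDist n g) (unifF n g) ≤ (g + 2) * δ := by
  have hδ2 : δ < 1 := by nlinarith [show (0:ℝ) ≤ g by positivity]
  obtain ⟨K, hK⟩ := exists_nat_ge (12 * (53 + 36 * g) / δ)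
  have hK0 : (0:ℝ) < K := lt_of_lt_of_le (by positivity) hK
  have hK1 : 1 ≤ K := by exact_mod_cast hK0
  rw [div_le_iff₀ hδ] at hK
  filter_upwards [genus0 K hK1 δ hδ, (kap_tendsto g).eventually_le_const (show (1:ℝ) < 1 + δ by linarith),
    eventually_ge_atTop 6, eventually_ge_atTop (K * (11 * g + 1))] with n h1 h2 h3 h4
  have hn0 : (0:ℝ) < n := by exact_mod_cast (show 0 < n by omega)
  set r := n / K with hr
  set s := 4 * n / K with hs
  have p0 : (0:ℝ) < (FF n 0).card := by
    have := card_FF_zero n (by omega)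
    have : 0 < (FF n 0).card * n := by rw [this]; exact Nat.pow_pos (by omega)
    exact_mod_cast Nat.pos_of_mul_pos_right this
  have g0 : (1 - δ) * (FF n 0).card ≤ (HG n r s 0).card := by
    have e : (HG n r s 0).card = ((FF n 0).filter (fun F => K * (Bad r F).ncard ≤ 4 * n)).card := by
      rw [HG, Finset.card_image_of_injective _ (fun a b h => (Prod.ext_iff.1 h).1)]
      congr 1
      apply Finset.filter_congr
      intro F _
      rw [hs, Nat.le_div_iff_mul_le hK1, mul_comm]
    have := Finset.card_filter_add_card_filter_not (s := FF n 0) (fun F => K * (Bad r F).ncard ≤ 4 * n)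
    rw [← e] at this
    have t : ((HG n r s 0).card : ℝ) + ((FF n 0).filter (fun F => ¬ (K * (Bad r F).ncard ≤ 4 * n))).card = (FF n 0).card := by
      exact_mod_cast this
    linarith
  have hθ : ((3 * (s + g * (3 * (4 * r + 1))) + 2 * g + 1 + 40 * r : ℕ) : ℝ) * (n:ℝ) ^ 2 ≤ δ * n.choose 3 := by
    have e1 : K * (3 * (s + g * (3 * (4 * r + 1))) + 2 * g + 1 + 40 * r) ≤ (53 + 36 * g) * n := by
      have a : K * r ≤ n := Nat.mul_div_le n K
      have b : K * s ≤ 4 * n := Nat.mul_div_le _ K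
      calc _ = 3 * (K * s) + (36 * g + 40) * (K * r) + K * (11 * g + 1) := by ring
        _ ≤ 3 * (4 * n) + (36 * g + 40) * n + n := by gcongr
        _ = _ := by ring
    have e2 : (K:ℝ) * ((3 * (s + g * (3 * (4 * r + 1))) + 2 * g + 1 + 40 * r : ℕ) : ℝ) ≤ (53 + 36 * g) * n := by exact_mod_cast e1
    have e3 := six_choose n (by omega)
    have e4 : (n:ℝ)^3 ≤ 12 * n.choose 3 := by
      have h6 : (6:ℝ) ≤ n := by exact_mod_cast h3
      have : (n:ℝ)^2 ≤ 2 * ((n-1) * (n-2)) := by nlinarith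
      nlinarith
    apply le_of_mul_le_mul_left _ hK0
    calc _ = (K:ℝ) * ((3 * (s + g * (3 * (4 * r + 1))) + 2 * g + 1 + 40 * r : ℕ) : ℝ) * (n:ℝ)^2 := by ring
      _ ≤ (53 + 36 * g) * n * (n:ℝ)^2 := mul_le_mul_of_nonneg_right e2 (by positivity)
      _ = (53 + 36 * g) * (n:ℝ)^3 := by ring
      _ ≤ (53 + 36 * g) * (12 * n.choose 3) := mul_le_mul_of_nonneg_left e4 (by positivity)
      _ = 12 * (53 + 36 * g) * n.choose 3 := by ring
      _ ≤ K * δ * n.choose 3 := mul_le_mul_of_nonneg_right hK (by positivity)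
      _ = _ := by ring
  have hc := HG_card n r s g (by omega) δ hθ hδ2.le
  have pp : (0:ℝ) < (PS n g).card := by
    have : 0 < (PS n g).card := by
      rw [card_PS]
      apply Finset.prod_pos
      intro i _
      rw [PF_eq, Finset.card_product]
      apply Nat.mul_pos
      · exact lt_of_lt_of_le (Nat.choose_pos (by omega)) (card_WF_ge _)
      · exact lt_of_lt_of_le (Nat.choose_pos (by omega)) (card_TF_ge _)
    exact_mod_cast this
  have hb : 1 - (g + 1) * δ ≤ (1 - δ) ^ (g+1) := by
    have := one_add_mul_le_pow (show (-2:ℝ) ≤ -δ by linarith) (g+1)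
    push_cast at this
    calc _ = 1 + ((g:ℝ)+1) * (-δ) := by ring
      _ ≤ _ := this
      _ = _ := by rw [← sub_eq_add_neg]
  have hd : (1 - (g+1) * δ) * ((FF n 0).card * (PS n g).card) ≤ (HG n r s g).card := by
    refine le_trans ?_ hc
    calc _ ≤ (1 - δ) ^ (g+1) * ((FF n 0).card * (PS n g).card) := mul_le_mul_of_nonneg_right hb (by positivity)
      _ = ((1 - δ) * (FF n 0).card) * (PS n g).card * (1 - δ) ^ g := by ring
      _ ≤ _ := by
        have : 0 ≤ 1 - δ := by linarith
        gcongr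
  have hpos : 0 < (HG n r s g).card := by
    have : (0:ℝ) < (HG n r s g).card := lt_of_lt_of_le (mul_pos (by linarith) (mul_pos p0 pp)) hd
    exact_mod_cast this
  have ht := tv_bound n r s g (by omega) hpos
  have : 1 - (g+1) * δ ≤ (HG n r s g).card / ((FF n 0).card * (PS n g).card) := by
    rw [le_div_iff₀ (mul_pos p0 pp)]; exact hd
  linarith

lemma dTV_nonneg' {X : Type*} (μ ν : X → ℝ) : 0 ≤ dTV μ ν := by
  unfold dTV
  have : 0 ≤ ∑' x, |μ x - ν x| := tsum_nonneg (fun _ => abs_nonneg _)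
  positivity

lemma stmt5_aux (g : ℕ) :
    Filter.Tendsto (fun n => dTV (lamIterDist n g) (unifF n g))
      Filter.atTop (nhds 0) := by
  rw [Metric.tendsto_atTop']
  intro ε hε
  have hg2 : (0:ℝ) < g + 2 := by positivity
  set δ := min (ε / 2) (1/2) / (g + 2) with hδ
  have hm : 0 < min (ε / 2) (1/2 : ℝ) := by positivity
  have hδ0 : 0 < δ := by positivity
  have e : (g + 2) * δ = min (ε / 2) (1/2) := by rw [hδ]; field_simp
  have h1 := min_le_left (ε/2) (1/2 : ℝ)
  have h2 := min_le_right (ε/2) (1/2 : ℝ)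
  have := main_ev g δ hδ0 (by nlinarith)
  obtain ⟨N, hN⟩ := eventually_atTop.1 this
  refine ⟨N, fun n hn => ?_⟩
  rw [Real.dist_eq, sub_zero, abs_of_nonneg (dTV_nonneg' _ _)]
  have := hN n hn.le
  linarith

end

theorem stmt5 (g : ℕ) (hg : 1 ≤ g) :
    Filter.Tendsto (fun n => dTV (lamIterDist n g) (unifF n g))
      Filter.atTop (nhds 0) := by
  exact stmt5_aux g
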